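/- arXiv:1810.09599 — 3 statements merged into one kernel-verified Lean document; each statement's English description precedes it below -/
import Mathlib

section
/- Fix m ≥ 1, c₀ > 0 and C₁ > 0. There exist constants σ⋆, τ⋆ ∈ (0,1) and δ⋆ > 0, depending only on m, c₀, C₁, such that the following holds for any δ ∈ (0, δ⋆]. Let A be a C¹ field of symmetric m×m matrices on B₂(0) ⊂ ℝ^m with |A − Id| ≤ δ, let v ∈ C²(B₂(0)) satisfy div(A∇v) ≤ c₀ e^{−v} + δ in B₂(0), set V := e^{−v}, and assume the integral estimate: for every ball B_r(y) ⊂ B₂(0), ∫_{B_{r/2}(y)} V² ≤ C₁ (r^{−2} + δ) ∫_{B_r(y)} V. Then for every y ∈ B₁(0) and r ∈ (0,1): if r^{2−m} ∫_{B_r(y)} V ≤ σ⋆, then (τ⋆ r)^{2−m} ∫_{B_{τ⋆ r}(y)} V ≤ (1/2) r^{2−m} ∫_{B_r(y)} V. -/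
open Set Metric MeasureTheory Filter
open scoped RealInnerProductSpace

noncomputable section

/-- Euclidean space `ℝⁿ`. -/
abbrev Euc (n : ℕ) : Type := EuclideanSpace ℝ (Fin n)

/-- Standard orthonormal basis vector of `ℝⁿ`. -/
def eb (n : ℕ) (i : Fin n) : Euc n := EuclideanSpace.basisFun (Fin n) ℝ i

/-- Laplacian, as the trace of the second derivative along the standard orthonormal basis. -/
def lap {n : ℕ} (f : Euc n → ℝ) (x : Euc n) : ℝ :=
  ∑ i : Fin n, iteratedFDeriv ℝ 2 f x ![eb n i, eb n i]

/-- Divergence of a vector field. -/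
def divg {n : ℕ} (F : Euc n → Euc n) (x : Euc n) : ℝ :=
  ∑ i : Fin n, ⟪fderiv ℝ F x (eb n i), eb n i⟫

/-- Squared Frobenius norm of the Hessian. -/
def hessSq {n : ℕ} (f : Euc n → ℝ) (x : Euc n) : ℝ :=
  ∑ i : Fin n, ∑ j : Fin n, (iteratedFDeriv ℝ 2 f x ![eb n i, eb n j]) ^ 2

open Classical in
/-- `|B(u)(x)|`, with value `0` where the gradient vanishes. -/
def Bnorm {n : ℕ} (u : Euc n → ℝ) (x : Euc n) : ℝ :=
  if gradient u x = 0 then 0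
  else Real.sqrt ((hessSq u x - ‖gradient (fun y => ‖gradient u y‖) x‖ ^ 2) /
    ‖gradient u x‖ ^ 2)

/-- Mean curvature of level sets: `div(∇u/|∇u|)`. -/
def meanCurv {n : ℕ} (u : Euc n → ℝ) (x : Euc n) : ℝ :=
  divg (fun y => ‖gradient u y‖⁻¹ • gradient u y) x

/-- Orthogonal projection onto the tangent space of the level set of `u` through `x`. -/
def tproj {n : ℕ} (u : Euc n → ℝ) (x X : Euc n) : Euc n :=
  X - (⟪gradient u x, X⟫ / ‖gradient u x‖ ^ 2) • gradient u x

/-- Second fundamental form of the level set of `u` through `x`, extended to all of `ℝⁿ`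
via the tangential projection. -/
def sff {n : ℕ} (u : Euc n → ℝ) (x X Y : Euc n) : ℝ :=
  iteratedFDeriv ℝ 2 u x ![tproj u x X, tproj u x Y] / ‖gradient u x‖

/-- `W` is a double-well potential. -/
def IsDoubleWell (W : ℝ → ℝ) : Prop :=
  ContDiffOn ℝ 3 W (Icc (-1) 1) ∧ (∀ t ∈ Ioo (-1:ℝ) 1, 0 < W t) ∧
  W (-1) = 0 ∧ W 1 = 0 ∧ deriv W (-1) = 0 ∧ deriv W 1 = 0 ∧
  iteratedDeriv 2 W (-1) = 1 ∧ iteratedDeriv 2 W 1 = 1 ∧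
  deriv W 0 = 0 ∧ ∀ t ∈ Ioo (-1:ℝ) 1, deriv W t = 0 → t = 0

/-- `u` is a classical solution of the singularly perturbed Allen–Cahn equation
`ε Δu = ε⁻¹ W′(u)`, `|u| < 1`, on `Ω`. -/
def ACSolution {n : ℕ} (W : ℝ → ℝ) (ε : ℝ) (u : Euc n → ℝ) (Ω : Set (Euc n)) : Prop :=
  ContDiffOn ℝ 2 u Ω ∧ (∀ x ∈ Ω, u x ∈ Ioo (-1:ℝ) 1) ∧
  ∀ x ∈ Ω, ε * lap u x = ε⁻¹ * deriv W (u x)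

/-- Stability: `∫_Ω ε²|∇η|² + W″(u)η² ≥ 0` for all smooth `η` compactly supported in `Ω`. -/
def StableAC {n : ℕ} (W : ℝ → ℝ) (ε : ℝ) (u : Euc n → ℝ) (Ω : Set (Euc n)) : Prop :=
  ∀ η : Euc n → ℝ, ContDiff ℝ (⊤ : ℕ∞) η → HasCompactSupport η → tsupport η ⊆ Ω →
    0 ≤ ∫ x in Ω, (ε ^ 2 * ‖gradient η x‖ ^ 2 + iteratedDeriv 2 W (u x) * (η x) ^ 2)

/-- `∇u ≠ 0` and `|B(u)| ≤ Λ` on `{|u| ≤ 1−b} ∩ Ω`. -/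
def CurvBound {n : ℕ} (u : Euc n → ℝ) (b Λ : ℝ) (Ω : Set (Euc n)) : Prop :=
  ∀ x ∈ Ω, |u x| ≤ 1 - b → gradient u x ≠ 0 ∧ Bnorm u x ≤ Λ

/-- The part of the zero set `{u = 0}` away from the connected component of `x`. -/
def compSet {n : ℕ} (u : Euc n → ℝ) (x : Euc n) : Set (Euc n) :=
  {y | u y = 0} \ connectedComponentIn {y | u y = 0} x

/-- `A(r) = sup { e^{−D(x)} : x ∈ {u = 0} ∩ closure(B_r(0)) }`, where
`D(x) = dist(x, {u=0} ∖ Γ_x)` and points with `{u=0} ∖ Γ_x = ∅` contribute `0`. -/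
def Afun {n : ℕ} (u : Euc n → ℝ) (r : ℝ) : ℝ :=
  sSup {t : ℝ | ∃ x : Euc n, u x = 0 ∧ x ∈ closedBall 0 r ∧ (compSet u x).Nonempty ∧
    t = Real.exp (-Metric.infDist x (compSet u x))}

/-- The rescaled stable Allen–Cahn setting: `Δu = W′(u)` on `B_{1/ε}(0)`, stable, with
`∇u ≠ 0` and `|B(u)| ≤ Λε` on `{|u| ≤ 1−b}`. -/
def RescaledSetting {n : ℕ} (W : ℝ → ℝ) (b Λ ε : ℝ) (u : Euc n → ℝ) : Prop :=
  ACSolution W 1 u (ball 0 (1/ε)) ∧ StableAC W 1 u (ball 0 (1/ε)) ∧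
  CurvBound u b (Λ * ε) (ball 0 (1/ε))


/-- A field of symmetric continuous linear operators. -/
def SymmField {m : ℕ} (A : Euc m → (Euc m →L[ℝ] Euc m)) : Prop :=
  ∀ y v w, ⟪A y v, w⟫ = ⟪v, A y w⟫

theorem fderiv_apply_eq_sum_inner {n : ℕ} (L : Euc n →L[ℝ] ℝ) (w : Euc n) :
    L w = ∑ i : Fin n, ⟪w, eb n i⟫ * L (eb n i) := by
  conv_lhs => rw [← (EuclideanSpace.basisFun (Fin n) ℝ).sum_repr' w]
  simp [map_sum, eb, real_inner_comm]

/-- Integration by parts for a `C¹` function and a `C¹` vector field, one of which has compact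
support. -/
theorem integral_fderiv_apply_eq_neg_integral_mul_divg {n : ℕ} {φ : Euc n → ℝ}
    {F : Euc n → Euc n} (hφ : ContDiff ℝ 1 φ) (hF : ContDiff ℝ 1 F)
    (h : HasCompactSupport φ ∨ HasCompactSupport F) :
    ∫ x, fderiv ℝ φ x (F x) = -∫ x, φ x * divg F x := by
  have hφ' : Continuous (fderiv ℝ φ) := hφ.continuous_fderiv (by norm_num)
  have hF' : Continuous (fderiv ℝ F) := hF.continuous_fderiv (by norm_num)
  have hFi (i : Fin n) : ContDiff ℝ 1 (fun x => ⟪F x, eb n i⟫) := hF.inner ℝ contDiff_const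
  have hdF (i : Fin n) (x : Euc n) (w : Euc n) :
      fderiv ℝ (fun x => ⟪F x, eb n i⟫) x w = ⟪fderiv ℝ F x w, eb n i⟫ := by
    rw [fderiv_inner_apply ℝ (hF.differentiable (by norm_num) x)
      (differentiableAt_const _)]
    simp
  have hcs (i : Fin n) (u : Euc n → ℝ) (z : Euc n → Euc n → ℝ) (hu : Continuous u)
      (hc : HasCompactSupport u) (hz : Continuous fun x => z x (eb n i)) :
      Integrable (fun x => u x * z x (eb n i)) :=
    (hu.mul hz).integrable_of_hasCompactSupport hc.mul_right
  have i1 (i : Fin n) : Integrable fun x => ⟪F x, eb n i⟫ * fderiv ℝ φ x (eb n i) := by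
    refine Continuous.integrable_of_hasCompactSupport (by fun_prop) ?_
    rcases h with h | h
    · exact ((h.fderiv_apply (𝕜 := ℝ) (eb n i))).mul_left
    · refine HasCompactSupport.mul_right (h.mono fun x hx => ?_)
      contrapose! hx
      simp_all
  have i2 (i : Fin n) : Integrable fun x => φ x * ⟪fderiv ℝ F x (eb n i), eb n i⟫ := by
    refine Continuous.integrable_of_hasCompactSupport (by fun_prop) ?_
    rcases h with h | h
    · exact h.mul_right
    · refine HasCompactSupport.mul_left ((h.fderiv_apply (𝕜 := ℝ) (eb n i)).mono fun x hx => ?_)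
      contrapose! hx
      simp_all
  have i3 (i : Fin n) : Integrable fun x => ⟪F x, eb n i⟫ * φ x := by
    refine Continuous.integrable_of_hasCompactSupport (by fun_prop) ?_
    rcases h with h | h
    · exact h.mul_left
    · refine HasCompactSupport.mul_right (h.mono fun x hx => ?_)
      contrapose! hx
      simp_all
  have key (i : Fin n) : ∫ x, ⟪F x, eb n i⟫ * fderiv ℝ φ x (eb n i) =
      -∫ x, φ x * ⟪fderiv ℝ F x (eb n i), eb n i⟫ := by
    rw [integral_mul_fderiv_eq_neg_fderiv_mul_of_integrable _ (i1 i) (i3 i)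
      (fun x _ => (hFi i).differentiable (by norm_num) x)
      (fun x _ => hφ.differentiable (by norm_num) x)]
    · simp only [hdF, mul_comm]
    · simp only [hdF]
      simpa only [mul_comm] using i2 i
  simp only [fderiv_apply_eq_sum_inner (fderiv ℝ φ _) (F _), divg, Finset.mul_sum]
  rw [integral_finsetSum _ fun i _ => i1 i, integral_finsetSum _ fun i _ => i2 i,
    ← Finset.sum_neg_distrib]
  exact Finset.sum_congr rfl fun i _ => key i

/-- The weak form, for nonnegative test functions supported in the ball of radius `1/2`, of
`div F ≤ c₀ e^{-v} + δ`. -/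
def WeakDivLE {n : ℕ} (c₀ δ : ℝ) (v : Euc n → ℝ) (F : Euc n → Euc n) : Prop :=
  ∀ φ : Euc n → ℝ, ContDiff ℝ 1 φ → (∀ x, 0 ≤ φ x) → tsupport φ ⊆ ball 0 (1 / 2) →
    -∫ x, fderiv ℝ φ x (F x) ≤ ∫ x, φ x * (c₀ * Real.exp (-v x) + δ)

theorem hasCompactSupport_of_tsupport_subset_ball {n : ℕ} {φ : Euc n → ℝ} {r : ℝ}
    (h : tsupport φ ⊆ ball 0 r) : HasCompactSupport φ :=
  (isCompact_closedBall (0 : Euc n) r).of_isClosed_subset (isClosed_tsupport φ)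
    (h.trans ball_subset_closedBall)

theorem fderiv_eq_inner_gradient {n : ℕ} (v : Euc n → ℝ) (x w : Euc n) :
    fderiv ℝ v x w = ⟪gradient v x, w⟫ := by
  simp [gradient]

theorem norm_gradient {n : ℕ} (v : Euc n → ℝ) (x : Euc n) :
    ‖gradient v x‖ = ‖fderiv ℝ v x‖ := by
  simp [gradient]

theorem half_norm_sq_le_inner {n : ℕ} {G w : Euc n} {δ : ℝ} (hδ : δ ≤ 1 / 2)
    (h : ‖w - G‖ ≤ δ * ‖G‖) : 1 / 2 * ‖G‖ ^ 2 ≤ ⟪G, w⟫ := by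
  have h1 : ⟪G, w⟫ = ‖G‖ ^ 2 + ⟪G, w - G⟫ := by
    rw [inner_sub_right, real_inner_self_eq_norm_sq]; ring
  have h2 := abs_le.1 (abs_real_inner_le_norm G (w - G))
  have h3 : ‖G‖ * ‖w - G‖ ≤ ‖G‖ * (1 / 2 * ‖G‖) := by
    refine mul_le_mul_of_nonneg_left (h.trans ?_) (norm_nonneg _)
    exact mul_le_mul_of_nonneg_right hδ (norm_nonneg _)
  nlinarith [h2.1]

theorem norm_le_three_halves {n : ℕ} {G w : Euc n} {δ : ℝ} (hδ : δ ≤ 1 / 2)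
    (h : ‖w - G‖ ≤ δ * ‖G‖) : ‖w‖ ≤ 3 / 2 * ‖G‖ := by
  have h1 : ‖w‖ ≤ ‖w - G‖ + ‖G‖ := by simpa using norm_add_le (w - G) G
  nlinarith [norm_nonneg G]

/-- Caccioppoli inequality for `V = e^{-v}`. -/
theorem WeakDivLE.caccioppoli {n : ℕ} {c₀ δ : ℝ} {v χ : Euc n → ℝ} {F : Euc n → Euc n}
    (hW : WeakDivLE c₀ δ v F) (hv : ContDiff ℝ 1 v) (hF : Continuous F) (hχ : ContDiff ℝ 1 χ)
    (hχs : tsupport χ ⊆ ball 0 (1 / 2)) (hδ : δ ≤ 1 / 2)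
    (hE : ∀ x ∈ ball (0 : Euc n) (1 / 2), ‖F x - gradient v x‖ ≤ δ * ‖gradient v x‖) :
    ∫ x, χ x ^ 2 * Real.exp (-v x) * ‖fderiv ℝ v x‖ ^ 2 ≤
      36 * (∫ x, ‖fderiv ℝ χ x‖ ^ 2 * Real.exp (-v x)) +
        4 * ∫ x, χ x ^ 2 * Real.exp (-v x) * (c₀ * Real.exp (-v x) + δ) := by
  have hc : HasCompactSupport χ := hasCompactSupport_of_tsupport_subset_ball hχs
  have hvc : Continuous v := hv.continuous
  have hχc : Continuous χ := hχ.continuous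
  have hv' : Continuous (fderiv ℝ v) := hv.continuous_fderiv (by norm_num)
  have hχ' : Continuous (fderiv ℝ χ) := hχ.continuous_fderiv (by norm_num)
  have hφ : ContDiff ℝ 1 fun x => χ x ^ 2 * Real.exp (-v x) := by fun_prop
  have hφc : HasCompactSupport fun x => χ x ^ 2 * Real.exp (-v x) := by
    refine HasCompactSupport.mul_right (hc.mono fun x hx => ?_)
    contrapose! hx
    simp_all
  have hφs : tsupport (fun x => χ x ^ 2 * Real.exp (-v x)) ⊆ ball 0 (1 / 2) := by
    refine (closure_mono fun x hx => ?_).trans hχs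
    contrapose! hx
    simp_all
  have hφ' : Continuous (fderiv ℝ fun x => χ x ^ 2 * Real.exp (-v x)) :=
    hφ.continuous_fderiv (by norm_num)
  have h := hW _ hφ (fun x => by positivity) hφs
  have i1 : Integrable fun x => χ x ^ 2 * Real.exp (-v x) * ‖fderiv ℝ v x‖ ^ 2 :=
    (hφ.continuous.mul (by fun_prop)).integrable_of_hasCompactSupport hφc.mul_right
  have i2 : Integrable fun x => ‖fderiv ℝ χ x‖ ^ 2 * Real.exp (-v x) := by
    refine Continuous.integrable_of_hasCompactSupport (by fun_prop) ?_
    refine HasCompactSupport.mul_right ((hc.fderiv (𝕜 := ℝ)).mono fun x hx => ?_)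
    contrapose! hx
    simp_all
  have i3 : Integrable fun x => fderiv ℝ (fun x => χ x ^ 2 * Real.exp (-v x)) x (F x) := by
    refine Continuous.integrable_of_hasCompactSupport (by fun_prop) ?_
    refine (hφc.fderiv (𝕜 := ℝ)).mono fun x hx => ?_
    contrapose! hx
    simp_all
  have hfd (x : Euc n) : fderiv ℝ (fun x => χ x ^ 2 * Real.exp (-v x)) x (F x) =
      2 * χ x * Real.exp (-v x) * fderiv ℝ χ x (F x) -
        χ x ^ 2 * Real.exp (-v x) * fderiv ℝ v x (F x) := by
    have e1 := ((hχ.differentiable (by norm_num) x).hasFDerivAt.pow 2).mul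
      (hv.differentiable (by norm_num) x).hasFDerivAt.neg.exp
    have e2 : fderiv ℝ (fun x => χ x ^ 2 * Real.exp (-v x)) x = _ := e1.fderiv
    rw [e2]
    simp
    ring
  have hpt (x : Euc n) : 1 / 4 * (χ x ^ 2 * Real.exp (-v x) * ‖fderiv ℝ v x‖ ^ 2) -
      9 * (‖fderiv ℝ χ x‖ ^ 2 * Real.exp (-v x)) ≤
      -fderiv ℝ (fun x => χ x ^ 2 * Real.exp (-v x)) x (F x) := by
    rw [hfd]
    by_cases hx : x ∈ tsupport χ
    · have hEx := hE x (hχs hx)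
      have h1 := half_norm_sq_le_inner hδ hEx
      have h2 := norm_le_three_halves hδ hEx
      rw [← fderiv_eq_inner_gradient] at h1
      rw [norm_gradient] at h1 h2
      have h3 : |χ x * fderiv ℝ χ x (F x)| ≤
          |χ x| * (‖fderiv ℝ χ x‖ * (3 / 2 * ‖fderiv ℝ v x‖)) := by
        rw [abs_mul]
        gcongr
        exact ((fderiv ℝ χ x).le_opNorm (F x)).trans (by gcongr)
      have h4 := (abs_le.1 h3).2
      have key : 1 / 4 * (χ x ^ 2 * ‖fderiv ℝ v x‖ ^ 2) - 9 * ‖fderiv ℝ χ x‖ ^ 2 ≤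
          -(2 * (χ x * fderiv ℝ χ x (F x))) + χ x ^ 2 * fderiv ℝ v x (F x) := by
        have h5 := mul_le_mul_of_nonneg_left h1 (sq_nonneg (χ x))
        have h6 := sq_nonneg (1 / 2 * (|χ x| * ‖fderiv ℝ v x‖) - 3 * ‖fderiv ℝ χ x‖)
        have h7 := sq_abs (χ x)
        nlinarith
      have := mul_le_mul_of_nonneg_right key (Real.exp_pos (-v x)).le
      nlinarith
    · have h1 : χ x = 0 := image_eq_zero_of_notMem_tsupport hx
      have h2 : fderiv ℝ χ x = 0 := by
        by_contra h
        exact hx (support_fderiv_subset ℝ h)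
      simp [h1, h2]
  have := integral_mono ((i1.const_mul (1 / 4)).sub (i2.const_mul 9)) i3.neg hpt
  simp only [Pi.sub_apply, Pi.neg_apply] at this
  rw [integral_neg, integral_sub (i1.const_mul _) (i2.const_mul _), integral_const_mul,
    integral_const_mul] at this
  linarith

theorem integrableOn_ball_of_continuous {n : ℕ} {f : Euc n → ℝ} (hf : Continuous f) (x : Euc n)
    (r : ℝ) : IntegrableOn f (ball x r) :=
  (hf.continuousOn.integrableOn_compact (isCompact_closedBall x r)).mono_set ball_subset_closedBall

theorem integral_le_setIntegral_ball {n : ℕ} {f g : Euc n → ℝ} {r : ℝ} (hf : Integrable f)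
    (hg : Continuous g) (h : ∀ x ∈ ball (0 : Euc n) r, f x ≤ g x)
    (h0 : ∀ x ∉ ball (0 : Euc n) r, f x ≤ 0) :
    ∫ x, f x ≤ ∫ x in ball (0 : Euc n) r, g x := by
  rw [← integral_indicator measurableSet_ball]
  refine integral_mono hf ?_ fun x => ?_
  · exact (integrableOn_ball_of_continuous hg 0 r).integrable_indicator measurableSet_ball
  · by_cases hx : x ∈ ball (0 : Euc n) r
    · simpa [indicator_of_mem hx] using h x hx
    · simpa [indicator_of_notMem hx] using h0 x hx

/-- `L¹` gradient bounds for `V = e^{-v}`. -/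
theorem WeakDivLE.integral_gradient_le {n : ℕ} {c₀ C δ M σ : ℝ} {v χ : Euc n → ℝ}
    {F : Euc n → Euc n} (hc₀ : 0 ≤ c₀)
    (hW : WeakDivLE c₀ δ v F) (hv : ContDiff ℝ 1 v) (hF : Continuous F) (hχ : ContDiff ℝ 1 χ)
    (hχs : tsupport χ ⊆ ball 0 (1 / 2)) (hχ0 : ∀ x, 0 ≤ χ x) (hχ1 : ∀ x, χ x ≤ 1)
    (hM : ∀ x, ‖fderiv ℝ χ x‖ ≤ M) (hδ0 : 0 ≤ δ) (hδ : δ ≤ 1 / 2)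
    (hE : ∀ x ∈ ball (0 : Euc n) (1 / 2), ‖F x - gradient v x‖ ≤ δ * ‖gradient v x‖)
    (h1 : ∫ x in ball (0 : Euc n) (1 / 2), Real.exp (-v x) ≤ σ)
    (h2 : ∫ x in ball (0 : Euc n) (1 / 2), Real.exp (-v x) ^ 2 ≤ C * σ) :
    (∫ x, χ x * Real.exp (-v x) * ‖fderiv ℝ v x‖ ≤ (M + 18 * M ^ 2 + 2 * c₀ * C + 2) * σ) ∧
      ∫ x, ‖fderiv ℝ (fun x => χ x * Real.exp (-v x)) x‖ ≤
        (M + 18 * M ^ 2 + 2 * c₀ * C + 2) * σ := by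
  have hc : HasCompactSupport χ := hasCompactSupport_of_tsupport_subset_ball hχs
  have hvc : Continuous v := hv.continuous
  have hχc : Continuous χ := hχ.continuous
  have hv' : Continuous (fderiv ℝ v) := hv.continuous_fderiv (by norm_num)
  have hχ' : Continuous (fderiv ℝ χ) := hχ.continuous_fderiv (by norm_num)
  have hM0 : 0 ≤ M := (norm_nonneg _).trans (hM 0)
  have hout (x : Euc n) (hx : x ∉ ball (0 : Euc n) (1 / 2)) : χ x = 0 ∧ fderiv ℝ χ x = 0 := by
    refine ⟨image_eq_zero_of_notMem_tsupport fun h => hx (hχs h), ?_⟩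
    by_contra h
    exact hx (hχs (support_fderiv_subset ℝ h))
  have hcacc := hW.caccioppoli hv hF hχ hχs hδ hE
  have cont {f : Euc n → ℝ} (hf : Continuous f) (h : ∀ x, χ x = 0 → f x = 0) :
      Integrable f := by
    refine hf.integrable_of_hasCompactSupport (hc.mono fun x hx => ?_)
    contrapose! hx
    simp_all
  have hd : HasCompactSupport fun x => ‖fderiv ℝ χ x‖ := (hc.fderiv (𝕜 := ℝ)).norm
  have iV : IntegrableOn (fun x => Real.exp (-v x)) (ball (0 : Euc n) (1 / 2)) :=
    integrableOn_ball_of_continuous (by fun_prop) _ _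
  have iV2 : IntegrableOn (fun x => Real.exp (-v x) ^ 2) (ball (0 : Euc n) (1 / 2)) :=
    integrableOn_ball_of_continuous (by fun_prop) _ _
  have hσ : 0 ≤ σ := le_trans (integral_nonneg fun x => (Real.exp_pos _).le) h1
  have hd2 : Integrable fun x => ‖fderiv ℝ χ x‖ ^ 2 * Real.exp (-v x) := by
    refine Continuous.integrable_of_hasCompactSupport (by fun_prop) ?_
    refine HasCompactSupport.mul_right (hd.mono fun x hx => ?_)
    contrapose! hx
    simp_all
  have hd1 : Integrable fun x => ‖fderiv ℝ χ x‖ * Real.exp (-v x) :=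
    Continuous.integrable_of_hasCompactSupport (by fun_prop) hd.mul_right
  have b1 : ∫ x, ‖fderiv ℝ χ x‖ ^ 2 * Real.exp (-v x) ≤ M ^ 2 * σ := by
    refine (integral_le_setIntegral_ball (r := 1 / 2)
      (g := fun x => M ^ 2 * Real.exp (-v x)) hd2 (by fun_prop) ?_ ?_).trans ?_
    · intro x _
      have := hM x
      gcongr
    · intro x hx
      simp [(hout x hx).2]
    · rw [integral_const_mul]
      gcongr
  have b2 : ∫ x, χ x ^ 2 * Real.exp (-v x) * (c₀ * Real.exp (-v x) + δ) ≤
      (c₀ * C + δ) * σ := by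
    refine (integral_le_setIntegral_ball (r := 1 / 2)
      (g := fun x => c₀ * Real.exp (-v x) ^ 2 + δ * Real.exp (-v x))
      (cont (by fun_prop) (by simp_all)) (by fun_prop) ?_ ?_).trans ?_
    · intro x _
      have h3 : χ x ^ 2 ≤ 1 := pow_le_one₀ (hχ0 x) (hχ1 x)
      have h4 : 0 ≤ Real.exp (-v x) * (c₀ * Real.exp (-v x) + δ) := by positivity
      nlinarith
    · intro x hx
      simp [(hout x hx).1]
    · rw [integral_add (iV2.const_mul _) (iV.const_mul _), integral_const_mul, integral_const_mul]
      nlinarith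
  have i3 : Integrable fun x => χ x ^ 2 * Real.exp (-v x) * ‖fderiv ℝ v x‖ ^ 2 :=
    cont (by fun_prop) (by simp_all)
  have i4 : Integrable fun x => χ x * Real.exp (-v x) * ‖fderiv ℝ v x‖ :=
    cont (by fun_prop) (by simp_all)
  have b3 : ∫ x, χ x * Real.exp (-v x) * ‖fderiv ℝ v x‖ ≤
      (18 * M ^ 2 + 2 * c₀ * C + 2) * σ := by
    have h3 : ∫ x, (χ x * Real.exp (-v x) * ‖fderiv ℝ v x‖ -
        1 / 2 * (χ x ^ 2 * Real.exp (-v x) * ‖fderiv ℝ v x‖ ^ 2)) ≤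
        ∫ x in ball (0 : Euc n) (1 / 2), 1 / 2 * Real.exp (-v x) := by
      refine integral_le_setIntegral_ball (i4.sub (i3.const_mul _)) (by fun_prop) ?_ ?_
      · intro x _
        have h4 := mul_nonneg (Real.exp_pos (-v x)).le (sq_nonneg (χ x * ‖fderiv ℝ v x‖ - 1))
        nlinarith
      · intro x hx
        simp [(hout x hx).1]
    rw [integral_sub i4 (i3.const_mul _), integral_const_mul, integral_const_mul] at h3
    nlinarith
  refine ⟨b3.trans (by nlinarith), ?_⟩
  have hφ : ContDiff ℝ 1 fun x => χ x * Real.exp (-v x) := by fun_prop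
  have hφ' : Continuous (fderiv ℝ fun x => χ x * Real.exp (-v x)) :=
    hφ.continuous_fderiv (by norm_num)
  have i5 : Integrable fun x => ‖fderiv ℝ (fun x => χ x * Real.exp (-v x)) x‖ :=
    Continuous.integrable_of_hasCompactSupport (by fun_prop)
      ((HasCompactSupport.mul_right hc).fderiv (𝕜 := ℝ)).norm
  have b4 : ∫ x, ‖fderiv ℝ χ x‖ * Real.exp (-v x) ≤ M * σ := by
    refine (integral_le_setIntegral_ball (r := 1 / 2)
      (g := fun x => M * Real.exp (-v x)) hd1 (by fun_prop) ?_ ?_).trans ?_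
    · intro x _
      have := hM x
      gcongr
    · intro x hx
      simp [(hout x hx).2]
    · rw [integral_const_mul]
      gcongr
  have b5 : ∫ x, ‖fderiv ℝ (fun x => χ x * Real.exp (-v x)) x‖ ≤
      ∫ x, (‖fderiv ℝ χ x‖ * Real.exp (-v x) + χ x * Real.exp (-v x) * ‖fderiv ℝ v x‖) := by
    refine integral_mono i5 (hd1.add i4) fun x => ?_
    have e1 := (hχ.differentiable (by norm_num) x).hasFDerivAt.mul
      (hv.differentiable (by norm_num) x).hasFDerivAt.neg.exp
    have e2 : fderiv ℝ (fun x => χ x * Real.exp (-v x)) x = _ := e1.fderiv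
    simp only [e2]
    refine (norm_add_le _ _).trans (le_of_eq ?_)
    rw [norm_smul, norm_smul, norm_smul, norm_neg, Real.norm_of_nonneg (hχ0 x),
      Real.norm_of_nonneg (Real.exp_pos _).le, Pi.neg_apply]
    ring
  rw [integral_add hd1 i4] at b5
  nlinarith

/-- Gagliardo-Nirenberg-Sobolev with real integrals. -/
theorem exists_integral_rpow_le {n : ℕ} (hn : 2 ≤ n) : ∃ K : ℝ, 0 ≤ K ∧
    ∀ u : Euc n → ℝ, ContDiff ℝ 1 u → HasCompactSupport u → (∀ x, 0 ≤ u x) →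
      ∫ x, u x ^ ((n : ℝ) / (n - 1)) ≤ K * (∫ x, ‖fderiv ℝ u x‖) ^ ((n : ℝ) / (n - 1)) := by
  have hn' : (1 : ℝ) < n := by exact_mod_cast hn
  set p : ℝ := (n : ℝ) / (n - 1) with hp
  have hp0 : 0 < p := div_pos (by linarith) (by linarith)
  have hpc : Real.HolderConjugate (Module.finrank ℝ (Euc n)) p := by
    rw [finrank_euclideanSpace_fin]
    exact Real.HolderConjugate.conjExponent hn'
  refine ⟨lintegralPowLePowLIntegralFDerivConst (volume : Measure (Euc n)) p, NNReal.coe_nonneg _,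
    fun u hu hc h0 => ?_⟩
  have hu' : Continuous (fderiv ℝ u) := hu.continuous_fderiv (by norm_num)
  have hint : Integrable (fun x => ‖fderiv ℝ u x‖) :=
    hu'.norm.integrable_of_hasCompactSupport (hc.fderiv (𝕜 := ℝ)).norm
  have h := lintegral_pow_le_pow_lintegral_fderiv (volume : Measure (Euc n)) hu hc hpc
  have e1 : ∫⁻ x, ‖fderiv ℝ u x‖ₑ = ENNReal.ofReal (∫ x, ‖fderiv ℝ u x‖) := by
    rw [ofReal_integral_eq_lintegral_ofReal hint (ae_of_all _ fun x => norm_nonneg _)]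
    simp only [ofReal_norm]
  have hcont : Continuous fun x => u x ^ p :=
    hu.continuous.rpow_const fun x => Or.inr hp0.le
  have e2 : ∫⁻ x, ‖u x‖ₑ ^ p = ∫⁻ x, ENNReal.ofReal (u x ^ p) := by
    refine lintegral_congr fun x => ?_
    rw [Real.enorm_eq_ofReal (h0 x), ENNReal.ofReal_rpow_of_nonneg (h0 x) hp0.le]
  have hI : 0 ≤ ∫ x, ‖fderiv ℝ u x‖ := integral_nonneg fun x => norm_nonneg _
  rw [integral_eq_lintegral_of_nonneg_ae (ae_of_all _ fun x => Real.rpow_nonneg (h0 x) _)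
    hcont.aestronglyMeasurable, ← e2]
  refine ENNReal.toReal_le_of_le_ofReal (by positivity) (h.trans (le_of_eq ?_))
  rw [e1, ENNReal.ofReal_mul (NNReal.coe_nonneg _), ENNReal.ofReal_coe_nnreal,
    ENNReal.ofReal_rpow_of_nonneg hI hp0.le]

theorem exists_radial_profile {n : ℕ} (hn : 1 ≤ n) : ∃ K : ℝ, 0 ≤ K ∧ ∀ τ : ℝ, 0 < τ → τ ≤ 1 / 8 →
    ∃ p p' : ℝ → ℝ, (∀ s ∈ Ioi (-τ ^ 2), HasDerivAt p (p' s) s) ∧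
      ContinuousOn p' (Ioi (-τ ^ 2)) ∧ (∀ s ∈ Ioi (-τ ^ 2), 0 ≤ p s) ∧
      (∀ s, 1 / 16 ≤ s → p s = 0) ∧
      (∀ s, 0 ≤ s → -(K * τ ^ n) ≤ 2 * n * p s + 4 * s * p' s) ∧
      (∀ s, 0 ≤ s → s < τ ^ 2 → 1 ≤ 2 * n * p s + 4 * s * p' s) := by
  have hn1 : (1 : ℝ) ≤ n := by exact_mod_cast hn
  set χ : ℝ → ℝ := fun s => Real.smoothTransition (2 - 32 * s) with hχdef
  have hχ : ContDiff ℝ 1 χ := Real.smoothTransition.contDiff.comp (by fun_prop)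
  have hχ' : Continuous (deriv χ) := hχ.continuous_deriv (by norm_num)
  have hχ0 (s : ℝ) : 0 ≤ χ s := Real.smoothTransition.nonneg _
  have hχone (s : ℝ) (hs : s ≤ 1 / 32) : χ s = 1 :=
    Real.smoothTransition.one_of_one_le (by linarith)
  have hχzero (s : ℝ) (hs : 1 / 16 ≤ s) : χ s = 0 :=
    Real.smoothTransition.zero_of_nonpos (by linarith)
  have hdone (s : ℝ) (hs : s < 1 / 32) : deriv χ s = 0 := by
    have : χ =ᶠ[nhds s] fun _ => 1 := by
      filter_upwards [Iio_mem_nhds hs] with z hz using hχone z (le_of_lt hz)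
    rw [this.deriv_eq, deriv_const]
  have hdzero (s : ℝ) (hs : 1 / 16 < s) : deriv χ s = 0 := by
    have : χ =ᶠ[nhds s] fun _ => 0 := by
      filter_upwards [Ioi_mem_nhds hs] with z hz using hχzero z (le_of_lt hz)
    rw [this.deriv_eq, deriv_const]
  obtain ⟨M, hM⟩ := (isCompact_Icc (a := (1 / 32 : ℝ)) (b := 1 / 16)).exists_bound_of_continuousOn
    hχ'.continuousOn
  have hM0 : 0 ≤ M := (norm_nonneg _).trans (hM (1 / 16) (by norm_num))
  refine ⟨2 ^ ((n : ℝ) / 2) * (1 / 4 * M * (1 / 32) ^ (-(n : ℝ) / 2)), by positivity,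
    fun τ hτ hτ8 => ?_⟩
  set κ : ℝ := 2 ^ ((n : ℝ) / 2) * τ ^ n with hκ
  have hκ0 : 0 < κ := by positivity
  have hτ2 : 0 < τ ^ 2 := by positivity
  have hτ32 : τ ^ 2 ≤ 1 / 32 := by nlinarith
  refine ⟨fun s => κ * (χ s * (s + τ ^ 2) ^ (-(n : ℝ) / 2)),
    fun s => κ * (deriv χ s * (s + τ ^ 2) ^ (-(n : ℝ) / 2) +
      χ s * (-(n : ℝ) / 2 * (s + τ ^ 2) ^ (-(n : ℝ) / 2 - 1))), ?_, ?_, ?_, ?_, ?_⟩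
  · intro s hs
    have hs' : 0 < s + τ ^ 2 := by have := mem_Ioi.1 hs; linarith
    have h1 : HasDerivAt (fun s => (s + τ ^ 2) ^ (-(n : ℝ) / 2))
        (-(n : ℝ) / 2 * (s + τ ^ 2) ^ (-(n : ℝ) / 2 - 1)) s := by
      have := ((hasDerivAt_id s).add_const (τ ^ 2)).rpow_const (p := -(n : ℝ) / 2)
        (Or.inl hs'.ne')
      simpa using this
    exact ((hχ.differentiable (by norm_num) s).hasDerivAt.mul h1).const_mul κ
  · have h (a : ℝ) : ContinuousOn (fun s : ℝ => (s + τ ^ 2) ^ a) (Ioi (-τ ^ 2)) := by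
      refine ContinuousOn.rpow_const (by fun_prop) fun s hs => Or.inl ?_
      have := mem_Ioi.1 hs
      linarith
    have h1 := h (-(n : ℝ) / 2)
    have h2 := h (-(n : ℝ) / 2 - 1)
    have h3 := hχ.continuous
    fun_prop
  · intro s hs
    have hs' : 0 < s + τ ^ 2 := by have := mem_Ioi.1 hs; linarith
    have := hχ0 s
    positivity
  · intro s hs
    simp [hχzero s hs]
  have hform (s : ℝ) (hs : 0 ≤ s) :
      2 * n * (κ * (χ s * (s + τ ^ 2) ^ (-(n : ℝ) / 2))) +
        4 * s * (κ * (deriv χ s * (s + τ ^ 2) ^ (-(n : ℝ) / 2) +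
          χ s * (-(n : ℝ) / 2 * (s + τ ^ 2) ^ (-(n : ℝ) / 2 - 1)))) =
      κ * (2 * n * τ ^ 2 * χ s * (s + τ ^ 2) ^ (-(n : ℝ) / 2 - 1) +
        4 * s * deriv χ s * (s + τ ^ 2) ^ (-(n : ℝ) / 2)) := by
    have hs' : 0 < s + τ ^ 2 := by linarith
    have : (s + τ ^ 2) ^ (-(n : ℝ) / 2) =
        (s + τ ^ 2) ^ (-(n : ℝ) / 2 - 1) * (s + τ ^ 2) := by
      rw [Real.rpow_sub_one hs'.ne']
      field_simp
    rw [this]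
    ring
  refine ⟨fun s hs => ?_, fun s hs hst => ?_⟩
  · rw [hform s hs]
    have hs' : 0 < s + τ ^ 2 := by linarith
    have hA : 0 ≤ 2 * n * τ ^ 2 * χ s * (s + τ ^ 2) ^ (-(n : ℝ) / 2 - 1) := by
      have := hχ0 s
      positivity
    have hB : -(1 / 4 * M * (1 / 32) ^ (-(n : ℝ) / 2)) ≤
        4 * s * deriv χ s * (s + τ ^ 2) ^ (-(n : ℝ) / 2) := by
      have hneg : -(1 / 4 * M * (1 / 32 : ℝ) ^ (-(n : ℝ) / 2)) ≤ 0 := by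
        have : 0 ≤ 1 / 4 * M * (1 / 32 : ℝ) ^ (-(n : ℝ) / 2) := by positivity
        linarith
      rcases lt_or_ge s (1 / 32) with h | h
      · simpa [hdone s h] using hneg
      rcases lt_or_ge (1 / 16) s with h' | h'
      · simpa [hdzero s h'] using hneg
      have h1 : |deriv χ s| ≤ M := hM s ⟨h, h'⟩
      have h2 : (s + τ ^ 2) ^ (-(n : ℝ) / 2) ≤ (1 / 32 : ℝ) ^ (-(n : ℝ) / 2) :=
        Real.rpow_le_rpow_of_nonpos (by norm_num) (by linarith) (by linarith)
      have h3 : 0 ≤ (s + τ ^ 2) ^ (-(n : ℝ) / 2) := by positivity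
      have h4 : |4 * s * deriv χ s * (s + τ ^ 2) ^ (-(n : ℝ) / 2)| ≤
          1 / 4 * M * (1 / 32) ^ (-(n : ℝ) / 2) := by
        rw [abs_mul, abs_mul, abs_of_nonneg h3, abs_of_nonneg (by linarith : 0 ≤ 4 * s)]
        gcongr
        linarith
      exact (abs_le.1 h4).1
    calc _ = κ * (-(1 / 4 * M * (1 / 32) ^ (-(n : ℝ) / 2))) := by rw [hκ]; ring
      _ ≤ _ := mul_le_mul_of_nonneg_left (by linarith) hκ0.le
  · rw [hform s hs, hχone s (by linarith), hdone s (by linarith)]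
    have h1 : (2 * τ ^ 2) ^ (-(n : ℝ) / 2 - 1) ≤ (s + τ ^ 2) ^ (-(n : ℝ) / 2 - 1) :=
      Real.rpow_le_rpow_of_nonpos (by linarith) (by linarith) (by linarith)
    have h2 : κ * (2 * n * τ ^ 2 * (2 * τ ^ 2) ^ (-(n : ℝ) / 2 - 1)) = n := by
      rw [Real.rpow_sub_one (by positivity), hκ, neg_div, Real.rpow_neg (by positivity),
        Real.mul_rpow (by norm_num) hτ2.le, ← Real.rpow_natCast τ 2, ← Real.rpow_mul hτ.le]
      have : τ ^ ((2 : ℕ) * ((n : ℝ) / 2)) = τ ^ n := by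
        rw [← Real.rpow_natCast τ n]
        congr 1
        push_cast
        ring
      rw [this]
      have : (2 : ℝ) ^ ((n : ℝ) / 2) ≠ 0 := by positivity
      field_simp
    calc (1 : ℝ) ≤ n := hn1
      _ = κ * (2 * n * τ ^ 2 * (2 * τ ^ 2) ^ (-(n : ℝ) / 2 - 1)) := h2.symm
      _ ≤ κ * (2 * n * τ ^ 2 * (s + τ ^ 2) ^ (-(n : ℝ) / 2 - 1)) := by gcongr
      _ = _ := by ring

theorem divg_radial {n : ℕ} {p : ℝ → ℝ} {p' : ℝ} {x : Euc n}
    (h : HasDerivAt p p' (‖x‖ ^ 2)) :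
    divg (fun x => (-2 * p (‖x‖ ^ 2)) • x) x =
      -(2 * n * p (‖x‖ ^ 2) + 4 * ‖x‖ ^ 2 * p') := by
  have h1 : HasFDerivAt (fun x : Euc n => ‖x‖ ^ 2) (2 • innerSL ℝ x) x :=
    (hasStrictFDerivAt_norm_sq x).hasFDerivAt
  have h2 := ((h.comp_hasFDerivAt x h1).const_mul (-2)).smul (hasFDerivAt_id x)
  have h3 : fderiv ℝ (fun x => (-2 * p (‖x‖ ^ 2)) • x) x = _ := h2.fderiv
  have hs : ∑ i : Fin n, ⟪x, eb n i⟫ * ⟪x, eb n i⟫ = ‖x‖ ^ 2 := by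
    have := fderiv_apply_eq_sum_inner (innerSL ℝ x) x
    simp only [innerSL_apply_apply] at this
    rw [← this, real_inner_self_eq_norm_sq]
  have he (i : Fin n) : ⟪eb n i, eb n i⟫ = (1 : ℝ) := by
    rw [real_inner_self_eq_norm_sq]
    simp [eb]
  have hi (i : Fin n) : ⟪fderiv ℝ (fun x => (-2 * p (‖x‖ ^ 2)) • x) x (eb n i), eb n i⟫ =
      -2 * p (‖x‖ ^ 2) + -4 * p' * (⟪x, eb n i⟫ * ⟪x, eb n i⟫) := by
    rw [h3]
    simp only [add_apply, smul_apply,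
      ContinuousLinearMap.smulRight_apply, inner_add_left, real_inner_smul_left, innerSL_apply_apply,
      ContinuousLinearMap.id_apply, he, smul_eq_mul, Function.comp_apply, nsmul_eq_mul,
      id_eq]
    push_cast
    ring
  simp only [divg, hi]
  rw [Finset.sum_add_distrib, Finset.sum_const, ← Finset.mul_sum, hs]
  simp
  ring

/-- A test function which is superharmonic up to a small error and whose Laplacian is at most
`-1` in a small ball. -/
theorem exists_test_function {n : ℕ} (hn : 1 ≤ n) : ∃ K : ℝ, 0 ≤ K ∧
    ∀ τ : ℝ, 0 < τ → τ ≤ 1 / 8 → ∃ (ψ : Euc n → ℝ) (G : Euc n → Euc n),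
      ContDiff ℝ 1 ψ ∧ ContDiff ℝ 1 G ∧ (∀ x, 0 ≤ ψ x) ∧
      (∀ x ∉ ball (0 : Euc n) (1 / 4), ψ x = 0) ∧ (∀ x ∉ ball (0 : Euc n) (1 / 4), G x = 0) ∧
      (∀ x w, fderiv ℝ ψ x w = ⟪G x, w⟫) ∧
      (∀ x, -(K * τ ^ n) ≤ -divg G x) ∧ (∀ x ∈ ball (0 : Euc n) τ, 1 ≤ -divg G x) := by
  obtain ⟨K, hK, h⟩ := exists_radial_profile hn
  refine ⟨K, hK, fun τ hτ hτ8 => ?_⟩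
  obtain ⟨p, p', hp, hp'c, hp0, hpz, hlow, hone⟩ := h τ hτ hτ8
  have hτ2 : 0 < τ ^ 2 := by positivity
  have hpos (s : ℝ) (hs : 0 ≤ s) : s ∈ Ioi (-τ ^ 2) := by
    rw [mem_Ioi]; linarith
  have hmem (x : Euc n) : ‖x‖ ^ 2 ∈ Ioi (-τ ^ 2) := hpos _ (sq_nonneg _)
  have hpc : ContinuousOn p (Ioi (-τ ^ 2)) := fun s hs => (hp s hs).continuousAt.continuousWithinAt
  have hpC : ContDiffOn ℝ 1 p (Ioi (-τ ^ 2)) := by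
    rw [← zero_add (1 : WithTop ℕ∞), contDiffOn_succ_iff_deriv_of_isOpen isOpen_Ioi, contDiffOn_zero]
    exact ⟨fun s hs => (hp s hs).differentiableAt.differentiableWithinAt, by simp,
      hp'c.congr fun s hs => (hp s hs).deriv⟩
  have hnorm : ContDiff ℝ 1 fun x : Euc n => ‖x‖ ^ 2 := contDiff_norm_sq ℝ
  have hpn : ContDiff ℝ 1 fun x : Euc n => p (‖x‖ ^ 2) := by
    rw [← contDiffOn_univ]
    exact hpC.comp hnorm.contDiffOn fun x _ => hmem x
  set q : ℝ → ℝ := fun s => ∫ z in s..1, p z with hq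
  have hqd (s : ℝ) (hs : 0 ≤ s) : HasDerivAt q (-p s) s := by
    refine intervalIntegral.integral_hasDerivAt_left ?_ ?_ (hp s (hpos s hs)).continuousAt
    · refine (hpc.mono fun z hz => hpos z ?_).intervalIntegrable
      have := (mem_uIcc.1 hz)
      rcases this with h | h <;> linarith [h.1]
    · exact hpc.stronglyMeasurableAtFilter isOpen_Ioi s (hpos s hs)
  have hqz (s : ℝ) (hs : 1 / 16 ≤ s) : q s = 0 := by
    rw [hq]
    refine intervalIntegral.integral_zero_ae (ae_of_all _ fun z hz => hpz z ?_)
    rcases mem_uIoc.1 hz with h | h <;> linarith [h.1]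
  have hq0 (s : ℝ) (hs : 0 ≤ s) : 0 ≤ q s := by
    rcases le_or_gt s 1 with h | h
    · exact intervalIntegral.integral_nonneg h fun z hz => hp0 z (hpos z (hs.trans hz.1))
    · exact (hqz s (by linarith)).ge
  have hψd (x : Euc n) : HasFDerivAt (fun x : Euc n => q (‖x‖ ^ 2))
      (innerSL ℝ ((-2 * p (‖x‖ ^ 2)) • x)) x := by
    have h1 := (hqd _ (sq_nonneg ‖x‖)).comp_hasFDerivAt x (hasStrictFDerivAt_norm_sq x).hasFDerivAt
    have h2 : innerSL ℝ ((-2 * p (‖x‖ ^ 2)) • x) = -p (‖x‖ ^ 2) • 2 • innerSL ℝ x := by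
      ext w
      simp only [innerSL_apply_apply, real_inner_smul_left, smul_apply, smul_eq_mul, nsmul_eq_mul]
      push_cast
      ring
    rw [h2]
    exact h1
  have hG : ContDiff ℝ 1 fun x : Euc n => (-2 * p (‖x‖ ^ 2)) • x := 
    (contDiff_const.mul hpn).smul contDiff_id
  have hout (x : Euc n) (hx : x ∉ ball (0 : Euc n) (1 / 4)) : 1 / 16 ≤ ‖x‖ ^ 2 := by
    rw [mem_ball_zero_iff, not_lt] at hx
    nlinarith
  refine ⟨fun x => q (‖x‖ ^ 2), fun x => (-2 * p (‖x‖ ^ 2)) • x, ?_, hG,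
    fun x => hq0 _ (sq_nonneg _), fun x hx => hqz _ (hout x hx), fun x hx => ?_,
    fun x w => ?_, fun x => ?_, fun x hx => ?_⟩
  · rw [contDiff_one_iff_fderiv]
    refine ⟨fun x => (hψd x).differentiableAt, ?_⟩
    have : (fderiv ℝ fun x : Euc n => q (‖x‖ ^ 2)) =
        fun x => innerSL ℝ ((-2 * p (‖x‖ ^ 2)) • x) := funext fun x => (hψd x).fderiv
    rw [this]
    exact (innerSL ℝ).continuous.comp hG.continuous
  · simp [hpz _ (hout x hx)]
  · rw [(hψd x).fderiv, innerSL_apply_apply]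
  · rw [divg_radial (hp _ (hmem x)), neg_neg]
    exact hlow _ (sq_nonneg _)
  · rw [divg_radial (hp _ (hmem x)), neg_neg]
    refine hone _ (sq_nonneg _) ?_
    rw [mem_ball_zero_iff] at hx
    gcongr

theorem fderiv_log_one_add_exp_neg {n : ℕ} {v : Euc n → ℝ} {x : Euc n}
    (hv : DifferentiableAt ℝ v x) (w : Euc n) :
    fderiv ℝ (fun x => Real.log (1 + Real.exp (-v x))) x w =
      -(Real.exp (-v x) / (1 + Real.exp (-v x)) * fderiv ℝ v x w) := by
  have h0 : 1 + Real.exp (-v x) ≠ 0 := by positivity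
  have e1 := (hv.hasFDerivAt.neg.exp.const_add 1).log h0
  have e2 : fderiv ℝ (fun x => Real.log (1 + Real.exp (-v x))) x = _ := e1.fderiv
  rw [e2]
  simp
  ring

theorem fderiv_mul_exp_neg_div {n : ℕ} {v ψ : Euc n → ℝ} {x : Euc n}
    (hψ : DifferentiableAt ℝ ψ x) (hv : DifferentiableAt ℝ v x) (w : Euc n) :
    fderiv ℝ (fun x => ψ x * (Real.exp (-v x) / (1 + Real.exp (-v x)))) x w =
      Real.exp (-v x) / (1 + Real.exp (-v x)) * fderiv ℝ ψ x w -
        ψ x * (Real.exp (-v x) / (1 + Real.exp (-v x)) ^ 2) * fderiv ℝ v x w := by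
  have h0 : 1 + Real.exp (-v x) ≠ 0 := by positivity
  have e0 := hv.hasFDerivAt.neg.exp
  have e1 := hψ.hasFDerivAt.mul (e0.mul ((hasDerivAt_inv h0).comp_hasFDerivAt x (e0.const_add 1)))
  have e2 : fderiv ℝ (fun x => ψ x * (Real.exp (-v x) / (1 + Real.exp (-v x)))) x = _ := e1.fderiv
  rw [e2]
  simp
  field_simp
  ring

theorem WeakDivLE.setIntegral_ball_le {n : ℕ} {c₀ δ D S S' K e τ σ : ℝ} {v χ ψ : Euc n → ℝ}
    {F G : Euc n → Euc n} (hc₀ : 0 ≤ c₀)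
    (hW : WeakDivLE c₀ δ v F) (hv : ContDiff ℝ 1 v) (hF : Continuous F) (hχ : Continuous χ)
    (hχc : HasCompactSupport χ) (hχ0 : ∀ x, 0 ≤ χ x)
    (hχone : ∀ x ∈ ball (0 : Euc n) (1 / 4), χ x = 1) (hδ0 : 0 ≤ δ) (hδ : δ ≤ 1 / 2)
    (hE : ∀ x ∈ ball (0 : Euc n) (1 / 2), ‖F x - gradient v x‖ ≤ δ * ‖gradient v x‖)
    (h1 : ∫ x in ball (0 : Euc n) (1 / 2), Real.exp (-v x) ≤ σ)
    (h2 : ∫ x, χ x * Real.exp (-v x) * ‖fderiv ℝ v x‖ ≤ D * σ)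
    (h3 : ∫ x in ball (0 : Euc n) (1 / 4),
      Real.exp (-v x) ^ 2 / (1 + Real.exp (-v x)) ≤ e * σ)
    (hτ8 : τ ≤ 1 / 8) (hψ : ContDiff ℝ 1 ψ) (hG : ContDiff ℝ 1 G)
    (hψ0 : ∀ x, 0 ≤ ψ x) (hψz : ∀ x ∉ ball (0 : Euc n) (1 / 4), ψ x = 0)
    (hGz : ∀ x ∉ ball (0 : Euc n) (1 / 4), G x = 0)
    (hψG : ∀ x w, fderiv ℝ ψ x w = ⟪G x, w⟫) (hK : 0 ≤ K) (hGK : ∀ x, -K ≤ -divg G x)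
    (hGone : ∀ x ∈ ball (0 : Euc n) τ, 1 ≤ -divg G x)
    (hS : ∀ x, ψ x ≤ S) (hS' : ∀ x, ‖G x‖ ≤ S') :
    ∫ x in ball (0 : Euc n) τ, Real.exp (-v x) ≤
      (e + K + S * (c₀ * e + δ) + δ * S' * D) * σ := by
  have hvc : Continuous v := hv.continuous
  have hv' : Continuous (fderiv ℝ v) := hv.continuous_fderiv (by norm_num)
  have hψ' : Continuous (fderiv ℝ ψ) := hψ.continuous_fderiv (by norm_num)
  have hden (x : Euc n) : 1 + Real.exp (-v x) ≠ 0 := by positivity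
  have hS0 : 0 ≤ S := (hψ0 0).trans (hS 0)
  have hS0' : 0 ≤ S' := (norm_nonneg _).trans (hS' 0)
  have hsub14 : ball (0 : Euc n) (1 / 4) ⊆ ball 0 (1 / 2) := ball_subset_ball (by norm_num)
  have hsubτ : ball (0 : Euc n) τ ⊆ ball 0 (1 / 4) := ball_subset_ball (by linarith)
  have hcl : tsupport ψ ⊆ closedBall 0 (1 / 4) := by
    refine closure_minimal (fun x hx => ?_) isClosed_closedBall
    by_contra h
    exact hx (hψz x fun h' => h (ball_subset_closedBall h'))
  have hclG : tsupport G ⊆ closedBall 0 (1 / 4) := by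
    refine closure_minimal (fun x hx => ?_) isClosed_closedBall
    by_contra h
    exact hx (hGz x fun h' => h (ball_subset_closedBall h'))
  have hclosed : closedBall (0 : Euc n) (1 / 4) ⊆ ball 0 (1 / 2) :=
    closedBall_subset_ball (by norm_num)
  have hψc : HasCompactSupport ψ := hasCompactSupport_of_tsupport_subset_ball (hcl.trans hclosed)
  have hGc : HasCompactSupport G :=
    (isCompact_closedBall (0 : Euc n) (1 / 4)).of_isClosed_subset (isClosed_tsupport G) hclG
  have hg : ContDiff ℝ 1 fun x => Real.log (1 + Real.exp (-v x)) :=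
    ContDiff.log (by fun_prop) hden
  have hg' : Continuous (fderiv ℝ fun x => Real.log (1 + Real.exp (-v x))) :=
    hg.continuous_fderiv (by norm_num)
  have hgc : Continuous fun x => Real.log (1 + Real.exp (-v x)) := hg.continuous
  have hg0 (x : Euc n) : 0 ≤ Real.log (1 + Real.exp (-v x)) :=
    Real.log_nonneg (by linarith [Real.exp_pos (-v x)])
  have hgV (x : Euc n) : Real.log (1 + Real.exp (-v x)) ≤ Real.exp (-v x) := by
    have := Real.log_le_sub_one_of_pos (by positivity : 0 < 1 + Real.exp (-v x))
    linarith
  have hVg (x : Euc n) : Real.exp (-v x) ≤ Real.log (1 + Real.exp (-v x)) +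
      Real.exp (-v x) ^ 2 / (1 + Real.exp (-v x)) := by
    have h := Real.one_sub_inv_le_log_of_pos (by positivity : 0 < 1 + Real.exp (-v x))
    have h' : 1 - (1 + Real.exp (-v x))⁻¹ =
        Real.exp (-v x) - Real.exp (-v x) ^ 2 / (1 + Real.exp (-v x)) := by
      field_simp
      ring
    linarith
  have hq : Continuous fun x => Real.exp (-v x) ^ 2 / (1 + Real.exp (-v x)) :=
    Continuous.div (by fun_prop) (by fun_prop) hden
  have hqi := integrableOn_ball_of_continuous hq
  have hVi : ∀ y r, IntegrableOn (fun x => Real.exp (-v x)) (ball (y : Euc n) r) :=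
    integrableOn_ball_of_continuous (by fun_prop)
  have hgi := integrableOn_ball_of_continuous hgc
  -- the test function
  have hh : ContDiff ℝ 1 fun x => Real.exp (-v x) / (1 + Real.exp (-v x)) :=
    ContDiff.div (by fun_prop) (by fun_prop) hden
  have hφ : ContDiff ℝ 1 fun x => ψ x * (Real.exp (-v x) / (1 + Real.exp (-v x))) := hψ.mul hh
  have hφ' : Continuous (fderiv ℝ fun x => ψ x * (Real.exp (-v x) / (1 + Real.exp (-v x)))) :=
    hφ.continuous_fderiv (by norm_num)
  have hφc : HasCompactSupport fun x => ψ x * (Real.exp (-v x) / (1 + Real.exp (-v x))) :=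
    hψc.mul_right
  have hw := hW _ hφ (fun x => mul_nonneg (hψ0 x) (by positivity))
    ((tsupport_mul_subset_left).trans (hcl.trans hclosed))
  -- the right-hand side
  have hR : ∫ x, ψ x * (Real.exp (-v x) / (1 + Real.exp (-v x))) *
      (c₀ * Real.exp (-v x) + δ) ≤ S * (c₀ * e + δ) * σ := by
    have hV14 : ∫ x in ball (0 : Euc n) (1 / 4), Real.exp (-v x) ≤ σ :=
      (setIntegral_mono_set (hVi _ _) (ae_of_all _ fun x => (Real.exp_pos _).le)
        hsub14.eventuallyLE).trans h1
    have iR : Integrable fun x => ψ x * (Real.exp (-v x) / (1 + Real.exp (-v x))) *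
        (c₀ * Real.exp (-v x) + δ) :=
      (hφ.continuous.mul (by fun_prop)).integrable_of_hasCompactSupport hφc.mul_right
    refine (integral_le_setIntegral_ball (r := 1 / 4)
      (g := fun x => S * (c₀ * (Real.exp (-v x) ^ 2 / (1 + Real.exp (-v x))) +
        δ * Real.exp (-v x)))
      iR (by fun_prop) ?_ ?_).trans ?_
    · intro x _
      have hle : Real.exp (-v x) / (1 + Real.exp (-v x)) ≤ Real.exp (-v x) :=
        div_le_self (Real.exp_pos _).le (by linarith [Real.exp_pos (-v x)])
      calc _ = ψ x * (c₀ * (Real.exp (-v x) ^ 2 / (1 + Real.exp (-v x))) +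
            δ * (Real.exp (-v x) / (1 + Real.exp (-v x)))) := by ring
        _ ≤ _ := by
          have := hS x
          gcongr
    · intro x hx
      simp [hψz x hx]
    · rw [integral_const_mul, integral_add ((hqi _ _).const_mul _) ((hVi _ _).const_mul _),
        integral_const_mul, integral_const_mul]
      have : c₀ * ∫ x in ball (0 : Euc n) (1 / 4),
          Real.exp (-v x) ^ 2 / (1 + Real.exp (-v x)) ≤ c₀ * (e * σ) := by gcongr
      have : δ * ∫ x in ball (0 : Euc n) (1 / 4), Real.exp (-v x) ≤ δ * σ := by gcongr
      rw [mul_assoc]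
      gcongr
      linarith
  -- the left-hand side
  have i1 : Integrable fun x => fderiv ℝ (fun x => Real.log (1 + Real.exp (-v x))) x (G x) := by
    refine Continuous.integrable_of_hasCompactSupport (hg'.clm_apply hG.continuous)
      (hGc.mono fun x hx => ?_)
    contrapose! hx
    simp_all
  have i2 : Integrable fun x => χ x * Real.exp (-v x) * ‖fderiv ℝ v x‖ :=
    Continuous.integrable_of_hasCompactSupport (by fun_prop) hχc.mul_right.mul_right
  have i3 : Integrable fun x =>
      fderiv ℝ (fun x => ψ x * (Real.exp (-v x) / (1 + Real.exp (-v x)))) x (F x) := by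
    refine Continuous.integrable_of_hasCompactSupport (hφ'.clm_apply hF)
      ((hφc.fderiv (𝕜 := ℝ)).mono fun x hx => ?_)
    contrapose! hx
    simp_all
  have hpt (x : Euc n) : fderiv ℝ (fun x => Real.log (1 + Real.exp (-v x))) x (G x) -
      δ * S' * (χ x * Real.exp (-v x) * ‖fderiv ℝ v x‖) ≤
      -fderiv ℝ (fun x => ψ x * (Real.exp (-v x) / (1 + Real.exp (-v x)))) x (F x) := by
    rw [fderiv_log_one_add_exp_neg (hv.differentiable (by norm_num) x),
      fderiv_mul_exp_neg_div (hψ.differentiable (by norm_num) x)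
        (hv.differentiable (by norm_num) x), hψG, fderiv_eq_inner_gradient v x (G x),
      fderiv_eq_inner_gradient v x (F x), real_inner_comm (G x) (gradient v x)]
    by_cases hx : x ∈ ball (0 : Euc n) (1 / 4)
    · have hEx := hE x (hsub14 hx)
      have h5 := (half_norm_sq_le_inner hδ hEx).trans' (by positivity)
      have h6 : 0 ≤ ψ x * (Real.exp (-v x) / (1 + Real.exp (-v x)) ^ 2) *
          ⟪gradient v x, F x⟫ :=
        mul_nonneg (mul_nonneg (hψ0 x) (by positivity)) h5
      have h7 : ⟪G x, F x⟫ - ⟪G x, gradient v x⟫ ≤ S' * (δ * ‖fderiv ℝ v x‖) := by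
        rw [← inner_sub_right, ← norm_gradient]
        refine (real_inner_le_norm _ _).trans ?_
        have := hS' x
        gcongr
      have hle : Real.exp (-v x) / (1 + Real.exp (-v x)) ≤ Real.exp (-v x) :=
        div_le_self (Real.exp_pos _).le (by linarith [Real.exp_pos (-v x)])
      have h8 : Real.exp (-v x) / (1 + Real.exp (-v x)) *
          (⟪G x, F x⟫ - ⟪G x, gradient v x⟫) ≤
          Real.exp (-v x) * (S' * (δ * ‖fderiv ℝ v x‖)) := by
        refine (mul_le_mul_of_nonneg_left h7 (by positivity)).trans ?_
        gcongr
      rw [hχone x hx]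
      linarith
    · have := hχ0 x
      simp only [hψz x hx, hGz x hx, inner_zero_left, mul_zero, zero_mul, neg_zero, sub_zero,
        zero_sub, Left.neg_nonpos_iff]
      positivity
  have hL := integral_mono (i1.sub (i2.const_mul (δ * S'))) i3.neg hpt
  simp only [Pi.sub_apply, Pi.neg_apply] at hL
  rw [integral_neg, integral_sub i1 (i2.const_mul _), integral_const_mul,
    integral_fderiv_apply_eq_neg_integral_mul_divg hg hG (Or.inr hGc), ← integral_neg] at hL
  have hdiv (x : Euc n) (hx : x ∉ ball (0 : Euc n) (1 / 2)) : divg G x = 0 := by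
    have hz : fderiv ℝ G x = 0 := by
      by_contra h
      exact hx (hclosed (hclG (support_fderiv_subset ℝ h)))
    simp [divg, hz]
  have hdivc : Continuous (divg G) := by
    have : Continuous (fderiv ℝ G) := hG.continuous_fderiv (by norm_num)
    unfold divg
    fun_prop
  have i4 : Integrable fun x => -(Real.log (1 + Real.exp (-v x)) * divg G x) := by
    refine (Continuous.integrable_of_hasCompactSupport (by fun_prop)
      (HasCompactSupport.intro (isCompact_closedBall (0 : Euc n) (1 / 2)) fun x hx => ?_))
    rw [hdiv x fun h => hx (ball_subset_closedBall h)]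
    simp
  have j1 := (hgi 0 τ).integrable_indicator measurableSet_ball
  have j2 := (hgi 0 (1 / 2)).integrable_indicator measurableSet_ball
  have hM := integral_mono (j1.sub (j2.const_mul K)) i4 fun x => by
    have hgx := hg0 x
    have hone := hGone x
    have hlow := hGK x
    simp only [Pi.sub_apply]
    by_cases hxτ : x ∈ ball (0 : Euc n) τ
    · rw [indicator_of_mem hxτ, indicator_of_mem (hsub14 (hsubτ hxτ))]
      nlinarith [hone hxτ, mul_nonneg hK hgx]
    · rw [indicator_of_notMem hxτ]
      by_cases hx : x ∈ ball (0 : Euc n) (1 / 2)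
      · rw [indicator_of_mem hx]
        nlinarith
      · rw [indicator_of_notMem hx, hdiv x hx]
        simp
  simp only [Pi.sub_apply] at hM
  rw [integral_sub j1 (j2.const_mul K), integral_const_mul, integral_indicator measurableSet_ball,
    integral_indicator measurableSet_ball] at hM
  have k1 : ∫ x in ball (0 : Euc n) (1 / 2), Real.log (1 + Real.exp (-v x)) ≤ σ :=
    (integral_mono (hgi _ _) (hVi _ _) hgV).trans h1
  have k2 : ∫ x in ball (0 : Euc n) τ, Real.exp (-v x) ^ 2 / (1 + Real.exp (-v x)) ≤ e * σ :=
    (setIntegral_mono_set (hqi _ _) (ae_of_all _ fun x => by positivity)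
      hsubτ.eventuallyLE).trans h3
  have k3 : ∫ x in ball (0 : Euc n) τ, Real.exp (-v x) ≤
      (∫ x in ball (0 : Euc n) τ, Real.log (1 + Real.exp (-v x))) +
        ∫ x in ball (0 : Euc n) τ, Real.exp (-v x) ^ 2 / (1 + Real.exp (-v x)) := by
    rw [← integral_add (hgi _ _) (hqi _ _)]
    exact integral_mono (hVi _ _) ((hgi _ _).add (hqi _ _)) hVg
  have k4 : δ * S' * ∫ x, χ x * Real.exp (-v x) * ‖fderiv ℝ v x‖ ≤ δ * S' * (D * σ) := by gcongr
  have k5 : K * ∫ x in ball (0 : Euc n) (1 / 2), Real.log (1 + Real.exp (-v x)) ≤ K * σ := by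
    gcongr
  linarith

theorem sq_div_one_add_le_rpow {V p : ℝ} (hV : 0 ≤ V) (hp1 : 1 ≤ p) (hp2 : p ≤ 2) :
    V ^ 2 / (1 + V) ≤ V ^ p := by
  rcases hV.eq_or_lt with rfl | h
  · simpa using Real.rpow_nonneg le_rfl p
  rw [div_le_iff₀ (by positivity)]
  have h1 : V ^ (2 - p) ≤ 1 + V := by
    rcases le_total V 1 with h' | h'
    · linarith [Real.rpow_le_one hV h' (sub_nonneg.2 hp2)]
    · have := Real.rpow_le_rpow_of_exponent_le h' (by linarith : 2 - p ≤ 1)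
      rw [Real.rpow_one] at this
      linarith
  calc V ^ 2 = V ^ p * V ^ (2 - p) := by
        rw [← Real.rpow_add h, ← Real.rpow_natCast]
        norm_num
    _ ≤ _ := by gcongr

/-- Decay on the unit scale for weak supersolutions of `div F = c₀ e^{-v} + δ` whose field `F`
is `δ`-close to `∇v`. -/
theorem exists_unit_scale_decay {n : ℕ} (hn : 2 ≤ n) {c₀ C : ℝ} (hc₀ : 0 ≤ c₀) (hC : 0 ≤ C) :
    ∃ σs ∈ Ioo (0 : ℝ) 1, ∃ τ ∈ Ioo (0 : ℝ) (1 / 2), ∃ δs > (0 : ℝ), δs ≤ 1 / 2 ∧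
      ∀ δ : ℝ, 0 ≤ δ → δ ≤ δs → ∀ (v : Euc n → ℝ) (F : Euc n → Euc n) (σ : ℝ),
        WeakDivLE c₀ δ v F → ContDiff ℝ 1 v → Continuous F →
        (∀ x ∈ ball (0 : Euc n) (1 / 2), ‖F x - gradient v x‖ ≤ δ * ‖gradient v x‖) →
        ∫ x in ball (0 : Euc n) (1 / 2), Real.exp (-v x) ≤ σ →
        ∫ x in ball (0 : Euc n) (1 / 2), Real.exp (-v x) ^ 2 ≤ C * σ → σ ≤ σs →
        τ ^ ((2 : ℝ) - n) * ∫ x in ball (0 : Euc n) τ, Real.exp (-v x) ≤ 1 / 2 * σ := by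
  have hn' : (2 : ℝ) ≤ n := by exact_mod_cast hn
  set p : ℝ := (n : ℝ) / (n - 1) with hp
  have hp1 : 1 < p := by rw [hp, one_lt_div] <;> linarith
  have hp2 : p ≤ 2 := by rw [hp, div_le_iff₀] <;> linarith
  obtain ⟨Kg, hKg, hgns⟩ := exists_integral_rpow_le hn
  obtain ⟨K, hK, htest⟩ := exists_test_function (n := n) (by omega)
  let χ : ContDiffBump (0 : Euc n) := ⟨1 / 4, 3 / 8, by norm_num, by norm_num⟩
  have hχ : ContDiff ℝ 1 χ := χ.contDiff
  have hχs : tsupport χ ⊆ ball 0 (1 / 2) := by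
    rw [χ.tsupport_eq]
    exact closedBall_subset_ball (by norm_num)
  have hχone : ∀ x ∈ ball (0 : Euc n) (1 / 4), χ x = 1 := fun x hx =>
    χ.one_of_mem_closedBall (ball_subset_closedBall hx)
  obtain ⟨M, hM⟩ := (χ.hasCompactSupport.fderiv (𝕜 := ℝ)).exists_bound_of_continuous
    (hχ.continuous_fderiv (by norm_num))
  have hM0 : 0 ≤ M := (norm_nonneg _).trans (hM 0)
  set D := M + 18 * M ^ 2 + 2 * c₀ * C + 2 with hD
  have hD0 : 0 ≤ D := by positivity
  set τ : ℝ := 1 / (8 * (1 + K)) with hτ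
  have hτ0 : 0 < τ := by positivity
  have hτ8 : τ ≤ 1 / 8 := by
    rw [hτ]
    gcongr
    linarith
  have hKτ : K * τ ^ 2 ≤ 1 / 8 := by
    have h1 : K * τ ≤ 1 / 8 := by
      rw [hτ, mul_one_div, div_le_div_iff₀ (by positivity) (by norm_num)]
      linarith
    nlinarith
  obtain ⟨ψ, G, hψ, hG, hψ0, hψz, hGz, hψG, hGK, hGone⟩ := htest τ hτ0 hτ8
  obtain ⟨S, hS⟩ := (HasCompactSupport.intro (isCompact_closedBall (0 : Euc n) (1 / 4))
    fun x hx => hψz x fun h => hx (ball_subset_closedBall h)).exists_bound_of_continuous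
    hψ.continuous
  obtain ⟨S', hS'⟩ := (HasCompactSupport.intro (isCompact_closedBall (0 : Euc n) (1 / 4))
    fun x hx => hGz x fun h => hx (ball_subset_closedBall h)).exists_bound_of_continuous
    hG.continuous
  have hS0 : 0 ≤ S := (norm_nonneg _).trans (hS 0)
  have hS0' : 0 ≤ S' := (norm_nonneg _).trans (hS' 0)
  set T : ℝ := τ ^ ((2 : ℝ) - n) with hT
  have hT0 : 0 < T := Real.rpow_pos_of_pos hτ0 _
  have hTτ : T * τ ^ n = τ ^ 2 := by
    rw [hT, ← Real.rpow_natCast τ n, ← Real.rpow_add hτ0, ← Real.rpow_natCast]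
    norm_num
  obtain ⟨σs, hσs, hσs1⟩ : ∃ σs ∈ Ioo (0 : ℝ) 1,
      T * (1 + S * c₀) * (Kg * D ^ p * σs ^ (p - 1)) ≤ 1 / 8 := by
    have hlim : Tendsto (fun s : ℝ => T * (1 + S * c₀) * (Kg * D ^ p * s ^ (p - 1)))
        (nhdsWithin 0 (Ioi 0)) (nhds 0) := by
      have h : Continuous fun s : ℝ => T * (1 + S * c₀) * (Kg * D ^ p * s ^ (p - 1)) :=
        continuous_const.mul (continuous_const.mul
          (Real.continuous_rpow_const (by linarith)))
      have h0 := h.tendsto 0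
      simp only [Real.zero_rpow (by linarith : p - 1 ≠ 0), mul_zero] at h0
      exact h0.mono_left nhdsWithin_le_nhds
    obtain ⟨s, hs, hs'⟩ := ((hlim.eventually_le_const (by norm_num : (0 : ℝ) < 1 / 8)).and
      (Ioo_mem_nhdsGT (zero_lt_one (α := ℝ)))).exists
    exact ⟨s, hs', hs⟩
  refine ⟨σs, hσs, τ, ⟨hτ0, by linarith⟩, min (1 / 2) (1 / (8 * (T * (S + S' * D) + 1))),
    lt_min (by norm_num) (by positivity), min_le_left _ _, ?_⟩
  intro δ hδ0 hδ v F σ hW hv hF hE h1 h2 hσ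
  have hδ2 : δ ≤ 1 / 2 := hδ.trans (min_le_left _ _)
  have hδT : T * (δ * (S + S' * D)) ≤ 1 / 8 := by
    have h := hδ.trans (min_le_right _ _)
    rw [le_div_iff₀ (by positivity)] at h
    linarith
  have hσ0 : 0 ≤ σ := (integral_nonneg fun x => (Real.exp_pos _).le).trans h1
  obtain ⟨g1, g2⟩ := hW.integral_gradient_le hc₀ hv hF hχ hχs (fun _ => χ.nonneg)
    (fun _ => χ.le_one) hM hδ0 hδ2 hE h1 h2
  set e := Kg * D ^ p * σs ^ (p - 1) with he
  have hvc : Continuous v := hv.continuous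
  have h3 : ∫ x in ball (0 : Euc n) (1 / 4), Real.exp (-v x) ^ 2 / (1 + Real.exp (-v x)) ≤
      e * σ := by
    have hu : ContDiff ℝ 1 fun x => χ x * Real.exp (-v x) := by fun_prop
    have huc : HasCompactSupport fun x => χ x * Real.exp (-v x) := χ.hasCompactSupport.mul_right
    have hu0 (x : Euc n) : 0 ≤ χ x * Real.exp (-v x) := mul_nonneg χ.nonneg (Real.exp_pos _).le
    have hpc : Continuous fun x => (χ x * Real.exp (-v x)) ^ p :=
      hu.continuous.rpow_const fun x => Or.inr (by linarith)
    have hpi : Integrable fun x => (χ x * Real.exp (-v x)) ^ p := by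
      refine hpc.integrable_of_hasCompactSupport (huc.mono fun x hx => ?_)
      contrapose! hx
      simp only [Function.mem_support, not_not] at hx ⊢
      rw [hx, Real.zero_rpow (by linarith)]
    have a1 : ∫ x in ball (0 : Euc n) (1 / 4), Real.exp (-v x) ^ 2 / (1 + Real.exp (-v x)) ≤
        ∫ x in ball (0 : Euc n) (1 / 4), (χ x * Real.exp (-v x)) ^ p := by
      refine setIntegral_mono_on (integrableOn_ball_of_continuous
        (Continuous.div (by fun_prop) (by fun_prop) fun x => by positivity) _ _)
        hpi.integrableOn measurableSet_ball fun x hx => ?_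
      rw [hχone x hx, one_mul]
      exact sq_div_one_add_le_rpow (Real.exp_pos _).le hp1.le hp2
    have a2 : ∫ x in ball (0 : Euc n) (1 / 4), (χ x * Real.exp (-v x)) ^ p ≤
        ∫ x, (χ x * Real.exp (-v x)) ^ p :=
      setIntegral_le_integral hpi (ae_of_all _ fun x => Real.rpow_nonneg (hu0 x) _)
    have a3 : (∫ x, ‖fderiv ℝ (fun x => χ x * Real.exp (-v x)) x‖) ^ p ≤ (D * σ) ^ p :=
      Real.rpow_le_rpow (integral_nonneg fun x => norm_nonneg _) g2 (by linarith)
    have a4 : (D * σ) ^ p ≤ D ^ p * σs ^ (p - 1) * σ := by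
      rw [Real.mul_rpow hD0 hσ0, mul_assoc]
      gcongr
      have : σ ^ p = σ ^ (p - 1) * σ := by
        conv_rhs => rw [← Real.rpow_one σ, ← Real.rpow_mul hσ0, one_mul]
        rw [← Real.rpow_add' hσ0 (by linarith)]
        norm_num
      rw [this]
      gcongr
    calc _ ≤ Kg * (∫ x, ‖fderiv ℝ (fun x => χ x * Real.exp (-v x)) x‖) ^ p :=
          (a1.trans a2).trans (hgns _ hu huc hu0)
      _ ≤ Kg * (D ^ p * σs ^ (p - 1) * σ) := by
          gcongr
          exact a3.trans a4
      _ = e * σ := by rw [he]; ring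
  have hfin := hW.setIntegral_ball_le hc₀ hv hF hχ.continuous χ.hasCompactSupport
    (fun _ => χ.nonneg) hχone hδ0 hδ2 hE h1 g1 h3 hτ8 hψ hG hψ0 hψz hGz hψG
    (by positivity : 0 ≤ K * τ ^ n) hGK hGone (fun x => (le_abs_self _).trans (hS x)) hS'
  calc T * ∫ x in ball (0 : Euc n) τ, Real.exp (-v x) ≤
        T * ((e + K * τ ^ n + S * (c₀ * e + δ) + δ * S' * D) * σ) := by gcongr
    _ = (T * (1 + S * c₀) * e + K * (T * τ ^ n) + T * (δ * (S + S' * D))) * σ := by ring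
    _ ≤ 1 / 2 * σ := by
      rw [hTτ]
      gcongr
      linarith

theorem WeakDivLE.of_divg_le {n : ℕ} {c₀ δ : ℝ} {v : Euc n → ℝ} {F : Euc n → Euc n}
    (hv : Continuous v) (hF : ContDiff ℝ 1 F)
    (h : ∀ x ∈ ball (0 : Euc n) (1 / 2), divg F x ≤ c₀ * Real.exp (-v x) + δ) :
    WeakDivLE c₀ δ v F := by
  intro φ hφ hφ0 hφs
  have hφc : HasCompactSupport φ := hasCompactSupport_of_tsupport_subset_ball hφs
  have hφ' : Continuous φ := hφ.continuous
  have hdivc : Continuous (divg F) := by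
    have : Continuous (fderiv ℝ F) := hF.continuous_fderiv (by norm_num)
    unfold divg
    fun_prop
  rw [integral_fderiv_apply_eq_neg_integral_mul_divg hφ hF (Or.inl hφc), neg_neg]
  refine integral_mono ((hφ'.mul hdivc).integrable_of_hasCompactSupport hφc.mul_right)
    (Continuous.integrable_of_hasCompactSupport (by fun_prop) hφc.mul_right) fun x => ?_
  by_cases hx : x ∈ ball (0 : Euc n) (1 / 2)
  · exact mul_le_mul_of_nonneg_left (h x hx) (hφ0 x)
  · simp [image_eq_zero_of_notMem_tsupport fun h' => hx (hφs h')]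

theorem hasFDerivAt_comp_add_smul {n : ℕ} {E : Type*} [NormedAddCommGroup E] [NormedSpace ℝ E]
    {f : Euc n → E} {x y : Euc n} {r : ℝ} (hf : DifferentiableAt ℝ f (y + r • x)) :
    HasFDerivAt (fun z => f (y + r • z)) (r • fderiv ℝ f (y + r • x)) x := by
  have h := hf.hasFDerivAt.comp x (((hasFDerivAt_id x).const_smul r).const_add y)
  have h2 : fderiv ℝ f (y + r • x) ∘SL (r • ContinuousLinearMap.id ℝ (Euc n)) =
      r • fderiv ℝ f (y + r • x) := by
    ext w
    simp
  rwa [← h2]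

theorem divg_smul_comp_add_smul {n : ℕ} {H : Euc n → Euc n} {x y : Euc n} {r : ℝ}
    (hH : DifferentiableAt ℝ H (y + r • x)) :
    divg (fun z => r • H (y + r • z)) x = r ^ 2 * divg H (y + r • x) := by
  have h : fderiv ℝ (fun z => r • H (y + r • z)) x = _ :=
    ((hasFDerivAt_comp_add_smul hH).const_smul r).fderiv
  simp only [divg, h, Finset.mul_sum]
  refine Finset.sum_congr rfl fun i _ => ?_
  simp [inner_smul_left]
  ring

theorem setIntegral_ball_comp_add_smul {n : ℕ} (f : Euc n → ℝ) (y : Euc n) {r : ℝ} (hr : 0 < r)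
    (s : ℝ) : ∫ x in ball (0 : Euc n) s, f (y + r • x) =
      r ^ (-(n : ℝ)) * ∫ x in ball y (s * r), f x := by
  have h1 := Measure.setIntegral_comp_smul volume (fun x => f (y + x)) (ball (0 : Euc n) s) hr.ne'
  rw [h1, finrank_euclideanSpace_fin, abs_of_pos (by positivity), smul_eq_mul,
    Real.rpow_neg hr.le, Real.rpow_natCast, _root_.smul_ball hr.ne', smul_zero,
    Real.norm_of_nonneg hr.le, mul_comm r s]
  congr 1
  have h2 := (measurePreserving_add_left volume y).setIntegral_preimage_emb
    (Homeomorph.addLeft y).measurableEmbedding f (ball y (s * r))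
  rw [← h2]
  congr 2
  ext x
  simp [dist_eq_norm]

theorem contDiff_smul_of_tsupport_subset {n : ℕ} {k : WithTop ℕ∞} {E : Type*}
    [NormedAddCommGroup E] [NormedSpace ℝ E] {χ : Euc n → ℝ} {f : Euc n → E} {s : Set (Euc n)}
    (hs : IsOpen s) (hχ : ContDiff ℝ k χ) (hf : ContDiffOn ℝ k f s) (h : tsupport χ ⊆ s) :
    ContDiff ℝ k fun x => χ x • f x := by
  refine contDiff_iff_contDiffAt.2 fun x => ?_
  by_cases hx : x ∈ tsupport χ
  · exact hχ.contDiffAt.smul (hf.contDiffAt (hs.mem_nhds (h hx)))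
  · refine contDiffAt_const (c := (0 : E)) |>.congr_of_eventuallyEq ?_
    filter_upwards [notMem_tsupport_iff_eventuallyEq.1 hx] with z hz
    simp [hz]

/-- Rescaling of the decay estimate on the unit scale to a ball `B_r(y)`. -/
theorem rescaled_decay {m : ℕ} {c₀ C₁ δ σs τ r : ℝ} {y : Euc m}
    {A : Euc m → (Euc m →L[ℝ] Euc m)} {v : Euc m → ℝ} (hC₁ : 0 ≤ C₁)
    (hδ0 : 0 ≤ δ) (hδ : δ ≤ 1) (hτ : τ ∈ Ioo (0 : ℝ) (1 / 2))
    (hdecay : ∀ (v : Euc m → ℝ) (F : Euc m → Euc m) (σ : ℝ),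
      WeakDivLE c₀ δ v F → ContDiff ℝ 1 v → Continuous F →
      (∀ x ∈ ball (0 : Euc m) (1 / 2), ‖F x - gradient v x‖ ≤ δ * ‖gradient v x‖) →
      ∫ x in ball (0 : Euc m) (1 / 2), Real.exp (-v x) ≤ σ →
      ∫ x in ball (0 : Euc m) (1 / 2), Real.exp (-v x) ^ 2 ≤ 2 * C₁ * σ → σ ≤ σs →
      τ ^ ((2 : ℝ) - m) * ∫ x in ball (0 : Euc m) τ, Real.exp (-v x) ≤ 1 / 2 * σ)
    (hA : ContDiffOn ℝ 1 A (ball 0 2))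
    (hAδ : ∀ y ∈ ball (0 : Euc m) 2, ‖A y - ContinuousLinearMap.id ℝ (Euc m)‖ ≤ δ)
    (hv : ContDiffOn ℝ 2 v (ball 0 2))
    (hdiv : ∀ x ∈ ball (0 : Euc m) 2,
      divg (fun y => A y (gradient v y)) x ≤ c₀ * Real.exp (-(v x)) + δ)
    (hr0 : 0 < r) (hr1 : r ≤ 1) (hy : closedBall y r ⊆ ball 0 2)
    (hint : (∫ x in ball y (r / 2), Real.exp (-(v x)) ^ 2) ≤
      C₁ * (r ^ (-2 : ℝ) + δ) * ∫ x in ball y r, Real.exp (-(v x)))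
    (hσ : r ^ ((2 : ℝ) - m) * (∫ x in ball y r, Real.exp (-(v x))) ≤ σs) :
    (τ * r) ^ ((2 : ℝ) - m) * (∫ x in ball y (τ * r), Real.exp (-(v x))) ≤
      (1 / 2) * (r ^ ((2 : ℝ) - m) * ∫ x in ball y r, Real.exp (-(v x))) := by
  have hmaps (x : Euc m) (hx : x ∈ ball (0 : Euc m) 1) : y + r • x ∈ ball (0 : Euc m) 2 := by
    refine hy ?_
    rw [mem_ball_zero_iff] at hx
    rw [mem_closedBall, dist_self_add_left, norm_smul, Real.norm_of_nonneg hr0.le]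
    nlinarith
  let χ : ContDiffBump (0 : Euc m) := ⟨3 / 4, 7 / 8, by norm_num, by norm_num⟩
  have hχs : tsupport χ ⊆ ball 0 1 := by
    rw [χ.tsupport_eq]
    exact closedBall_subset_ball (by norm_num)
  have hχone : ∀ x ∈ ball (0 : Euc m) (3 / 4), χ x = 1 := fun x hx =>
    χ.one_of_mem_closedBall (ball_subset_closedBall hx)
  have hgrad : ContDiffOn ℝ 1 (gradient v) (ball 0 2) :=
    (InnerProductSpace.toDual ℝ (Euc m)).symm.toContinuousLinearEquiv.contDiff.comp_contDiffOn
      (hv.fderiv_of_isOpen isOpen_ball (by norm_num))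
  have hH : ContDiffOn ℝ 1 (fun z => A z (gradient v z)) (ball 0 2) := hA.clm_apply hgrad
  have haff : ContDiff ℝ 2 fun x : Euc m => y + r • x := by fun_prop
  have hvr : ContDiffOn ℝ 1 (fun x => v (y + r • x) - 2 * Real.log r) (ball 0 1) :=
    ((hv.comp haff.contDiffOn hmaps).of_le (by norm_num)).sub contDiffOn_const
  have hFr : ContDiffOn ℝ 1 (fun x => r • A (y + r • x) (gradient v (y + r • x))) (ball 0 1) :=
    (hH.comp (haff.of_le (by norm_num)).contDiffOn hmaps).const_smul r
  set w : Euc m → ℝ := fun x => χ x • (v (y + r • x) - 2 * Real.log r) with hw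
  set F : Euc m → Euc m := fun x => χ x • r • A (y + r • x) (gradient v (y + r • x)) with hF
  have hwC : ContDiff ℝ 1 w :=
    contDiff_smul_of_tsupport_subset isOpen_ball χ.contDiff hvr hχs
  have hFC : ContDiff ℝ 1 F :=
    contDiff_smul_of_tsupport_subset isOpen_ball χ.contDiff hFr hχs
  have hweq (x : Euc m) (hx : x ∈ ball (0 : Euc m) (3 / 4)) :
      w x = v (y + r • x) - 2 * Real.log r := by simp [hw, hχone x hx]
  have hFeq (x : Euc m) (hx : x ∈ ball (0 : Euc m) (3 / 4)) :
      F x = r • A (y + r • x) (gradient v (y + r • x)) := by simp [hF, hχone x hx]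
  have hexp (x : Euc m) (hx : x ∈ ball (0 : Euc m) (3 / 4)) :
      Real.exp (-w x) = r ^ 2 * Real.exp (-v (y + r • x)) := by
    rw [hweq x hx, neg_sub, sub_eq_add_neg, Real.exp_add, two_mul, Real.exp_add, Real.exp_log hr0,
      sq]
  have hsub1 : ball (0 : Euc m) (3 / 4) ⊆ ball 0 1 := ball_subset_ball (by norm_num)
  have hsub2 : ball (0 : Euc m) (1 / 2) ⊆ ball 0 (3 / 4) := ball_subset_ball (by norm_num)
  have hgw (x : Euc m) (hx : x ∈ ball (0 : Euc m) (3 / 4)) :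
      gradient w x = r • gradient v (y + r • x) := by
    have hd : DifferentiableAt ℝ v (y + r • x) :=
      (hv.contDiffAt (isOpen_ball.mem_nhds (hmaps x (hsub1 hx)))).differentiableAt (by norm_num)
    have he : w =ᶠ[nhds x] fun z => v (y + r • z) - 2 * Real.log r := by
      filter_upwards [isOpen_ball.mem_nhds hx] with z hz using hweq z hz
    rw [gradient, he.fderiv_eq, ((hasFDerivAt_comp_add_smul hd).sub_const _).fderiv, gradient]
    simp
  have hW : WeakDivLE c₀ δ w F := by
    refine WeakDivLE.of_divg_le hwC.continuous hFC fun x hx => ?_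
    have hx' := hsub2 hx
    have hd : DifferentiableAt ℝ (fun z => A z (gradient v z)) (y + r • x) :=
      (hH.contDiffAt (isOpen_ball.mem_nhds (hmaps x (hsub1 hx')))).differentiableAt (by norm_num)
    have he : F =ᶠ[nhds x] fun z => r • A (y + r • z) (gradient v (y + r • z)) := by
      filter_upwards [isOpen_ball.mem_nhds hx'] with z hz using hFeq z hz
    have hdF : divg F x = r ^ 2 * divg (fun z => A z (gradient v z)) (y + r • x) := by
      rw [← divg_smul_comp_add_smul hd]
      simp only [divg, he.fderiv_eq]
    rw [hdF, hexp x hx']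
    have h1 := mul_le_mul_of_nonneg_left (hdiv _ (hmaps x (hsub1 hx'))) (sq_nonneg r)
    have h2 : r ^ 2 * δ ≤ δ := mul_le_of_le_one_left hδ0 (pow_le_one₀ hr0.le hr1)
    linarith
  have hE (x : Euc m) (hx : x ∈ ball (0 : Euc m) (1 / 2)) :
      ‖F x - gradient w x‖ ≤ δ * ‖gradient w x‖ := by
    rw [hFeq x (hsub2 hx), hgw x (hsub2 hx), ← smul_sub, norm_smul, norm_smul]
    have h1 := (A (y + r • x) - ContinuousLinearMap.id ℝ (Euc m)).le_of_opNorm_le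
      (hAδ _ (hmaps x (hsub1 (hsub2 hx)))) (gradient v (y + r • x))
    simp only [_root_.sub_apply, ContinuousLinearMap.id_apply] at h1
    calc _ ≤ ‖r‖ * (δ * ‖gradient v (y + r • x)‖) := by gcongr
      _ = _ := by ring
  have hscale (s : ℝ) (hs : s ≤ 3 / 4) : ∫ x in ball (0 : Euc m) s, Real.exp (-w x) =
      r ^ ((2 : ℝ) - m) * ∫ x in ball y (s * r), Real.exp (-v x) := by
    rw [setIntegral_congr_fun measurableSet_ball
      fun x hx => hexp x (ball_subset_ball hs hx), integral_const_mul,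
      setIntegral_ball_comp_add_smul (fun x => Real.exp (-v x)) y hr0, ← mul_assoc,
      ← Real.rpow_natCast, ← Real.rpow_add hr0]
    rfl
  have hscale2 : ∫ x in ball (0 : Euc m) (1 / 2), Real.exp (-w x) ^ 2 =
      r ^ 2 * r ^ ((2 : ℝ) - m) * ∫ x in ball y (r / 2), Real.exp (-v x) ^ 2 := by
    have h (x : Euc m) (hx : x ∈ ball (0 : Euc m) (1 / 2)) :
        Real.exp (-w x) ^ 2 = r ^ 4 * Real.exp (-v (y + r • x)) ^ 2 := by
      rw [hexp x (hsub2 hx)]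
      ring
    rw [setIntegral_congr_fun measurableSet_ball h, integral_const_mul,
      setIntegral_ball_comp_add_smul (fun x => Real.exp (-v x) ^ 2) y hr0, ← mul_assoc,
      one_div_mul_eq_div, sub_eq_add_neg, Real.rpow_add hr0, ← mul_assoc]
    congr 2
    norm_num
    ring
  have hcont : ContinuousOn (fun x => Real.exp (-v x)) (closedBall y r) :=
    (hv.continuousOn.mono hy).neg.rexp
  have hInt : IntegrableOn (fun x => Real.exp (-v x)) (ball y r) :=
    (hcont.integrableOn_compact (isCompact_closedBall y r)).mono_set ball_subset_closedBall
  have hI0 : 0 ≤ ∫ x in ball y r, Real.exp (-v x) := integral_nonneg fun x => (Real.exp_pos _).le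
  have hP : 0 < r ^ ((2 : ℝ) - m) := Real.rpow_pos_of_pos hr0 _
  have h1 : ∫ x in ball (0 : Euc m) (1 / 2), Real.exp (-w x) ≤
      r ^ ((2 : ℝ) - m) * ∫ x in ball y r, Real.exp (-v x) := by
    rw [hscale _ (by norm_num)]
    refine mul_le_mul_of_nonneg_left (setIntegral_mono_set hInt
      (ae_of_all _ fun x => (Real.exp_pos _).le)
      (ball_subset_ball (by linarith)).eventuallyLE) hP.le
  have h2 : ∫ x in ball (0 : Euc m) (1 / 2), Real.exp (-w x) ^ 2 ≤
      2 * C₁ * (r ^ ((2 : ℝ) - m) * ∫ x in ball y r, Real.exp (-v x)) := by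
    have hr2 : r ^ 2 * (r ^ (-2 : ℝ) + δ) ≤ 2 := by
      have h3 : r ^ 2 * r ^ (-2 : ℝ) = 1 := by
        rw [Real.rpow_neg hr0.le, Real.rpow_two, mul_inv_cancel₀ (by positivity)]
      have h4 : r ^ 2 * δ ≤ 1 := mul_le_one₀ (pow_le_one₀ hr0.le hr1) hδ0 hδ
      rw [mul_add]
      linarith
    rw [hscale2]
    calc _ ≤ r ^ 2 * r ^ ((2 : ℝ) - m) *
          (C₁ * (r ^ (-2 : ℝ) + δ) * ∫ x in ball y r, Real.exp (-v x)) := by gcongr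
      _ = r ^ 2 * (r ^ (-2 : ℝ) + δ) *
          (C₁ * (r ^ ((2 : ℝ) - m) * ∫ x in ball y r, Real.exp (-v x))) := by ring
      _ ≤ 2 * (C₁ * (r ^ ((2 : ℝ) - m) * ∫ x in ball y r, Real.exp (-v x))) := by gcongr
      _ = _ := by ring
  have h := hdecay w F _ hW hwC hFC.continuous hE h1 h2 hσ
  rwa [hscale τ (by linarith [hτ.2]), ← mul_assoc, ← Real.mul_rpow hτ.1.le hr0.le] at h

/-- Lemma 10.6: Morrey-type decay estimate for `V = e^{−v}`. -/
theorem stmt16 (m : ℕ) (hm : 1 ≤ m) (c₀ C₁ : ℝ) (hc₀ : 0 < c₀) (hC₁ : 0 < C₁) :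
    ∃ σstar ∈ Ioo (0:ℝ) 1, ∃ τstar ∈ Ioo (0:ℝ) 1, ∃ δstar > (0:ℝ),
      ∀ δ : ℝ, 0 < δ → δ ≤ δstar →
      ∀ A : Euc m → (Euc m →L[ℝ] Euc m), ∀ v : Euc m → ℝ,
        ContDiffOn ℝ 1 A (ball 0 2) → SymmField A →
        (∀ y ∈ ball (0:Euc m) 2, ‖A y - ContinuousLinearMap.id ℝ (Euc m)‖ ≤ δ) →
        ContDiffOn ℝ 2 v (ball 0 2) →
        (∀ x ∈ ball (0:Euc m) 2,
          divg (fun y => A y (gradient v y)) x ≤ c₀ * Real.exp (-(v x)) + δ) →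
        (∀ y : Euc m, ∀ r : ℝ, 0 < r → ball y r ⊆ ball 0 2 →
          (∫ x in ball y (r/2), Real.exp (-(v x)) ^ 2) ≤
            C₁ * (r ^ (-2:ℝ) + δ) * ∫ x in ball y r, Real.exp (-(v x))) →
        ∀ y ∈ ball (0:Euc m) 1, ∀ r : ℝ, 0 < r → r < 1 →
          r ^ ((2:ℝ) - m) * (∫ x in ball y r, Real.exp (-(v x))) ≤ σstar →
          (τstar * r) ^ ((2:ℝ) - m) * (∫ x in ball y (τstar * r), Real.exp (-(v x))) ≤
            (1/2) * (r ^ ((2:ℝ) - m) * ∫ x in ball y r, Real.exp (-(v x))) := by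
  have hball : ∀ y ∈ ball (0 : Euc m) 1, ∀ r : ℝ, r < 1 → closedBall y r ⊆ ball 0 2 :=
    fun y hy r hr => closedBall_subset_ball' (by linarith [mem_ball.1 hy])
  rcases hm.eq_or_lt with rfl | hm2
  · refine ⟨1 / 2, by norm_num, 1 / 2, by norm_num, 1, one_pos, ?_⟩
    intro δ _ _ A v _ _ _ hv _ _ y hy r hr0 hr1 _
    have hInt : IntegrableOn (fun x => Real.exp (-v x)) (ball y r) :=
      (((hv.continuousOn.mono (hball y hy r hr1)).neg.rexp).integrableOn_compact
        (isCompact_closedBall y r)).mono_set ball_subset_closedBall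
    have h : ∫ x in ball y (1 / 2 * r), Real.exp (-v x) ≤ ∫ x in ball y r, Real.exp (-v x) :=
      setIntegral_mono_set hInt (ae_of_all _ fun x => (Real.exp_pos _).le)
        (ball_subset_ball (by linarith)).eventuallyLE
    have he : (2 : ℝ) - (1 : ℕ) = 1 := by norm_num
    rw [he, Real.rpow_one, Real.rpow_one, mul_assoc]
    gcongr
  · obtain ⟨σs, hσs, τ, hτ, δs, hδs, hδs2, h⟩ :=
      exists_unit_scale_decay hm2 hc₀.le (by positivity : 0 ≤ 2 * C₁)
    refine ⟨σs, hσs, τ, ⟨hτ.1, by linarith [hτ.2]⟩, δs, hδs, ?_⟩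
    intro δ hδ0 hδ A v hA _ hAδ hv hdiv hint y hy r hr0 hr1 hσ
    have hsub := hball y hy r hr1
    exact rescaled_decay hC₁.le hδ0.le (by linarith) hτ (h δ hδ0.le hδ) hA hAδ hv hdiv hr0 hr1.le
      hsub (hint y r hr0 (ball_subset_closedBall.trans hsub)) hσ
end
end

section
/- Fix m ≥ 1, c₀ > 0 and C₁ > 0. There exist constants σ⋆ ∈ (0,1) and δ⋆ > 0, depending only on m, c₀, C₁, such that the following holds for any δ ∈ (0, δ⋆]. Let A be a C¹ field of symmetric m×m matrices on B₂(0) ⊂ ℝ^m with |A − Id| ≤ δ, let v ∈ C²(B₂(0)) satisfy div(A∇v) ≤ c₀ e^{−v} + δ in B₂(0), set V := e^{−v}, and assume the integral estimate: for every ball B_r(y) ⊂ B₂(0), ∫_{B_{r/2}(y)} V² ≤ C₁ (r^{−2} + δ) ∫_{B_r(y)} V. If ∫_{B₂(0)} V ≤ σ⋆, then sup_{B₁(0)} V ≤ 1/2. -/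
open Set Metric MeasureTheory Filter
open scoped RealInnerProductSpace

noncomputable section

/-- A nonnegative function has zero derivative wherever it vanishes. -/
theorem support_fderiv_subset_of_nonneg {E : Type*} [NormedAddCommGroup E] [NormedSpace ℝ E]
    {g : E → ℝ} (h0 : ∀ x, 0 ≤ g x) :
    Function.support (fderiv ℝ g) ⊆ Function.support g := by
  intro x hx hgx
  refine hx (IsLocalMin.fderiv_eq_zero (Eventually.of_forall fun y => ?_))
  rw [hgx]; exact h0 y

theorem eLpNorm_one_le_of_support {E F : Type*} [MeasurableSpace E] [NormedAddCommGroup F]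
    {μ : Measure E} {f : E → F} (hf : AEStronglyMeasurable f μ) {s : Set E}
    (hs : Function.support f ⊆ s) {p q : ℝ} (hp : 0 < p) (hpq : p ≤ q) :
    eLpNorm f (ENNReal.ofReal p) μ ≤
      eLpNorm f (ENNReal.ofReal q) μ * μ s ^ (1 / p - 1 / q) := by
  have h := eLpNorm_le_eLpNorm_mul_rpow_measure_univ (μ := μ.restrict s)
    (ENNReal.ofReal_le_ofReal hpq) hf.restrict
  rwa [eLpNorm_restrict_eq_of_support_subset hs, eLpNorm_restrict_eq_of_support_subset hs,
    Measure.restrict_apply_univ, ENNReal.toReal_ofReal hp.le,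
    ENNReal.toReal_ofReal (hp.le.trans hpq)] at h

theorem enorm_le_lintegral_fderiv_one {g : Euc 1 → ℝ} (hg : ContDiff ℝ 1 g)
    (hc : HasCompactSupport g) (x : Euc 1) :
    ‖g x‖ₑ ≤ ∫⁻ y, ‖fderiv ℝ g y‖ₑ := by
  let e : Euc 1 := EuclideanSpace.single 0 1
  let φ : ℝ → Euc 1 := fun t => t • e
  have hφe : φ = fun t => WithLp.toLp 2 (fun _ => t) := by
    funext t; ext i; fin_cases i; simp [φ, e]
  have hmp : MeasurePreserving φ volume volume := by
    rw [hφe]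
    exact (EuclideanSpace.volume_preserving_symm_measurableEquiv_toLp (Fin 1)).symm.comp
      (volume_preserving_funUnique (Fin 1) ℝ).symm
  have hx : φ (x 0) = x := by ext i; fin_cases i; simp [φ, e]
  have hiso : Isometry φ := by
    refine Isometry.of_dist_eq fun s t => ?_
    simp [φ, dist_eq_norm, ← sub_smul, norm_smul, e]
  have hd : ∀ t, HasDerivAt (g ∘ φ) (fderiv ℝ g (φ t) e) t := fun t =>
    ((hg.differentiable one_ne_zero (φ t)).hasFDerivAt).comp_hasDerivAt t
      (by simpa using (hasDerivAt_id t).smul_const e)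
  have hc' : HasCompactSupport (g ∘ φ) := hc.comp_isClosedEmbedding hiso.isClosedEmbedding
  have hgφ : ContDiff ℝ 1 (g ∘ φ) := hg.comp (contDiff_id.smul contDiff_const)
  have h1 := HasCompactSupport.enorm_le_lintegral_Ici_deriv hgφ hc' (x 0)
  rw [Function.comp_apply, hx] at h1
  calc ‖g x‖ₑ ≤ ∫⁻ t in Iic (x 0), ‖deriv (g ∘ φ) t‖ₑ := h1
    _ ≤ ∫⁻ t, ‖deriv (g ∘ φ) t‖ₑ := setLIntegral_le_lintegral _ _
    _ ≤ ∫⁻ t, ‖fderiv ℝ g (φ t)‖ₑ := by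
        refine lintegral_mono fun t => ?_
        rw [(hd t).deriv]
        refine ((fderiv ℝ g (φ t)).le_opENorm e).trans (le_of_eq ?_)
        have : ‖e‖ₑ = 1 := by simp [e, enorm_eq_nnnorm]
        rw [this, mul_one]
    _ = ∫⁻ y, ‖fderiv ℝ g y‖ₑ :=
        hmp.lintegral_comp (hg.continuous_fderiv one_ne_zero).enorm.measurable

/-- Faber–Krahn inequality. -/
theorem faber_krahn_eLpNorm {m : ℕ} (hm : 1 ≤ m) : ∃ C : NNReal, ∀ g : Euc m → ℝ,
    ContDiff ℝ 1 g → HasCompactSupport g → (∀ x, 0 ≤ g x) →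
    eLpNorm g 2 volume ≤
      C * (volume (Function.support g) ^ (1 / m : ℝ) * eLpNorm (fderiv ℝ g) 2 volume) := by
  rcases hm.eq_or_lt with rfl | hm2
  · refine ⟨1, fun g hg hc h0 => ?_⟩
    have hdc : AEStronglyMeasurable (fderiv ℝ g) volume :=
      (hg.continuous_fderiv one_ne_zero).aestronglyMeasurable
    set S := Function.support g
    have h1 := eLpNorm_one_le_of_support hdc (support_fderiv_subset_of_nonneg h0)
      one_pos one_le_two
    have h2 : eLpNorm g 2 volume ≤ volume S ^ (1 / 2 : ℝ) * ∫⁻ y, ‖fderiv ℝ g y‖ₑ := by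
      rw [← eLpNorm_restrict_eq_of_support_subset (subset_refl S)]
      refine (eLpNorm_mono_enorm_ae (g := fun _ => ∫⁻ y, ‖fderiv ℝ g y‖ₑ)
        (Eventually.of_forall fun x => ?_)).trans ?_
      · simpa using enorm_le_lintegral_fderiv_one hg hc x
      · rcases eq_or_ne (volume S) 0 with hS | hS
        · simp [Measure.restrict_eq_zero.2 hS]
        · rw [eLpNorm_const _ two_ne_zero (by simpa using hS)]
          simp [mul_comm]
    simp only [ENNReal.ofReal_one, eLpNorm_one_eq_lintegral_enorm, ENNReal.ofReal_ofNat] at h1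
    refine h2.trans ?_
    refine (mul_le_mul_right h1 _).trans (le_of_eq ?_)
    have : volume S ^ (1 / (1 : ℕ) : ℝ) =
        volume S ^ (1 / 2 : ℝ) * volume S ^ (1 / 1 - 1 / 2 : ℝ) := by
      rw [← ENNReal.rpow_add_of_nonneg] <;> norm_num
    rw [this]
    simp only [ENNReal.coe_one, one_mul]
    ring
  · have hm' : (2 : ℝ) ≤ m := by exact_mod_cast hm2
    let p : NNReal := ⟨2 * m / (m + 2), by positivity⟩
    have hpR : (p : ℝ) = 2 * m / (m + 2) := rfl
    refine ⟨eLpNormLESNormFDerivOfEqInnerConst (volume : Measure (Euc m)) p, fun g hg hc h0 => ?_⟩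
    have hdc : AEStronglyMeasurable (fderiv ℝ g) volume :=
      (hg.continuous_fderiv one_ne_zero).aestronglyMeasurable
    have h := eLpNorm_le_eLpNorm_fderiv_of_eq_inner (volume : Measure (Euc m)) hg hc
      (p := p) (p' := 2) (by
        rw [← NNReal.coe_le_coe, hpR, NNReal.coe_one, le_div_iff₀ (by positivity)]; linarith)
      (by simp; omega) (by
        rw [NNReal.coe_inv, hpR]; simp; field_simp; ring)
    have h1 := eLpNorm_one_le_of_support hdc (support_fderiv_subset_of_nonneg h0)
      (p := p) (q := 2) (by rw [hpR]; positivity)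
      (by rw [hpR, div_le_iff₀ (by positivity)]; linarith)
    have he : (1 / (p : ℝ) - 1 / 2) = 1 / m := by rw [hpR]; field_simp; ring
    rw [he, ENNReal.ofReal_coe_nnreal, ENNReal.ofReal_ofNat, mul_comm] at h1
    refine h.trans ?_
    gcongr

theorem toReal_eLpNorm_two_sq {E F : Type*} [MeasurableSpace E] [NormedAddCommGroup F]
    {μ : Measure E} {f : E → F} (hf : AEStronglyMeasurable f μ) :
    (eLpNorm f 2 μ).toReal ^ 2 = ∫ x, ‖f x‖ ^ 2 ∂μ := by
  have h := eLpNorm_nnreal_pow_eq_lintegral (μ := μ) (f := f) (p := 2) two_ne_zero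
  simp only [NNReal.coe_ofNat, ENNReal.coe_ofNat, ENNReal.rpow_ofNat] at h
  rw [← ENNReal.toReal_pow, h, integral_eq_lintegral_of_nonneg_ae
    (Eventually.of_forall fun x => by positivity)
    (show AEStronglyMeasurable (fun x => ‖f x‖ ^ 2) μ from hf.norm.pow 2)]
  congr 1
  refine lintegral_congr fun x => ?_
  rw [ENNReal.ofReal_pow (norm_nonneg _), ofReal_norm]

theorem faber_krahn {m : ℕ} (hm : 1 ≤ m) : ∃ C : ℝ, 0 < C ∧ ∀ g : Euc m → ℝ,
    ContDiff ℝ 1 g → HasCompactSupport g → (∀ x, 0 ≤ g x) → ∀ ℓ : ℝ, 0 ≤ ℓ →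
    volume.real (Function.support g) ≤ ℓ ^ m →
    ∫ x, g x ^ 2 ≤ C * ℓ ^ 2 * ∫ x, ‖fderiv ℝ g x‖ ^ 2 := by
  obtain ⟨C, hC⟩ := faber_krahn_eLpNorm hm
  refine ⟨C ^ 2 + 1, by positivity, fun g hg hc h0 ℓ hℓ hS => ?_⟩
  have hd : Continuous (fderiv ℝ g) := hg.continuous_fderiv one_ne_zero
  have hSfin : volume (Function.support g) ≠ ⊤ :=
    ((measure_mono subset_closure).trans_lt hc.measure_lt_top).ne
  have hfin : eLpNorm (fderiv ℝ g) 2 volume ≠ ⊤ :=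
    (hd.memLp_of_hasCompactSupport (hc.fderiv ℝ)).eLpNorm_ne_top
  have hvol : (volume (Function.support g)).toReal ^ (1 / m : ℝ) ≤ ℓ := by
    calc _ ≤ (ℓ ^ m) ^ (1 / m : ℝ) :=
          Real.rpow_le_rpow ENNReal.toReal_nonneg hS (by positivity)
      _ = ℓ := by rw [one_div]; exact Real.pow_rpow_inv_natCast hℓ (by omega)
  have h1 : (eLpNorm g 2 volume).toReal ≤ C * (ℓ * (eLpNorm (fderiv ℝ g) 2 volume).toReal) := by
    have := ENNReal.toReal_mono (by finiteness) (hC g hg hc h0)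
    rw [ENNReal.toReal_mul, ENNReal.toReal_mul, ENNReal.coe_toReal, ← ENNReal.toReal_rpow] at this
    refine this.trans ?_
    gcongr
  have h2 := pow_le_pow_left₀ ENNReal.toReal_nonneg h1 2
  rw [mul_pow, mul_pow, toReal_eLpNorm_two_sq hg.continuous.aestronglyMeasurable,
    toReal_eLpNorm_two_sq hd.aestronglyMeasurable] at h2
  simp only [Real.norm_eq_abs, sq_abs] at h2
  have : 0 ≤ ∫ x, ‖fderiv ℝ g x‖ ^ 2 := by positivity
  nlinarith [mul_nonneg (sq_nonneg ℓ) this]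

/-- A `C¹` truncation which vanishes on `(-∞, 0]` and grows linearly at infinity. -/
def trunc (t : ℝ) : ℝ := (max t 0) ^ 2 / (1 + max t 0)

/-- The derivative of `trunc`. -/
def truncDeriv (t : ℝ) : ℝ := max t 0 * (max t 0 + 2) / (1 + max t 0) ^ 2

theorem hasDerivAt_trunc (t : ℝ) : HasDerivAt trunc (truncDeriv t) t := by
  have hneg : ∀ s ≤ (0 : ℝ), HasDerivWithinAt trunc (truncDeriv s) (Iic 0) s := by
    intro s hs
    have h0 : truncDeriv s = 0 := by simp [truncDeriv, hs]
    rw [h0]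
    refine (hasDerivWithinAt_const s (Iic 0) (0 : ℝ)).congr (fun x hx => ?_) ?_
    · simp [trunc, mem_Iic.1 hx]
    · simp [trunc, hs]
  have hpos : ∀ s, 0 ≤ s → HasDerivWithinAt trunc (truncDeriv s) (Ici 0) s := by
    intro s hs
    have h1 : HasDerivAt (fun x : ℝ => x ^ 2 / (1 + x)) (truncDeriv s) s := by
      have hne : 1 + s ≠ 0 := by positivity
      convert! ((hasDerivAt_id s).pow 2).div ((hasDerivAt_id s).const_add 1) hne using 1
      simp only [truncDeriv, max_eq_left hs, id, Pi.pow_apply]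
      congr 1
      ring
    refine h1.hasDerivWithinAt.congr (fun x hx => ?_) ?_
    · simp [trunc, mem_Ici.1 hx]
    · simp [trunc, hs]
  rcases lt_trichotomy t 0 with h | rfl | h
  · exact (hneg t h.le).hasDerivAt (Iic_mem_nhds h)
  · have := (hneg 0 le_rfl).union (hpos 0 le_rfl)
    rwa [Iic_union_Ici, hasDerivWithinAt_univ] at this
  · exact (hpos t h.le).hasDerivAt (Ici_mem_nhds h)

theorem one_add_max_ne (t : ℝ) : 1 + max t 0 ≠ 0 := by positivity

theorem continuous_truncDeriv : Continuous truncDeriv := by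
  unfold truncDeriv
  exact Continuous.div (by fun_prop) (by fun_prop) fun t => pow_ne_zero _ (one_add_max_ne t)

theorem contDiff_trunc : ContDiff ℝ 1 trunc := by
  rw [contDiff_one_iff_deriv]
  refine ⟨fun t => (hasDerivAt_trunc t).differentiableAt, ?_⟩
  rw [funext fun t => (hasDerivAt_trunc t).deriv]
  exact continuous_truncDeriv

theorem trunc_nonneg (t : ℝ) : 0 ≤ trunc t := by unfold trunc; positivity

theorem truncDeriv_nonneg (t : ℝ) : 0 ≤ truncDeriv t := by unfold truncDeriv; positivity

theorem truncDeriv_le_one (t : ℝ) : truncDeriv t ≤ 1 := by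
  unfold truncDeriv
  rw [div_le_one (by positivity)]
  nlinarith

theorem trunc_le (t : ℝ) : trunc t ≤ max t 0 := by
  unfold trunc
  rw [div_le_iff₀ (by positivity)]
  nlinarith [le_max_right t 0]

theorem max_sub_one_le_trunc (t : ℝ) : max (t - 1) 0 ≤ trunc t := by
  refine max_le ?_ (trunc_nonneg t)
  unfold trunc
  rw [le_div_iff₀ (by positivity)]
  nlinarith [le_max_right t 0, le_max_left t 0]

theorem trunc_sq_le (t : ℝ) : trunc t ^ 2 ≤ max t 0 ^ 2 * truncDeriv t := by
  unfold trunc truncDeriv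
  have hp : 0 ≤ max t 0 := le_max_right _ _
  rw [div_pow, ← mul_div_assoc]
  gcongr
  nlinarith [pow_nonneg hp 3]

theorem trunc_eq_zero {t : ℝ} (ht : t ≤ 0) : trunc t = 0 := by simp [trunc, ht]

theorem contDiff_of_tsupport_subset {E F : Type*} [NormedAddCommGroup E] [NormedSpace ℝ E]
    [NormedAddCommGroup F] [NormedSpace ℝ F] {n : WithTop ℕ∞} {U : Set E} (hU : IsOpen U)
    {h : E → F} (hh : ContDiffOn ℝ n h U) (hs : tsupport h ⊆ U) : ContDiff ℝ n h := by
  rw [contDiff_iff_contDiffAt]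
  intro x
  by_cases hx : x ∈ U
  · exact hh.contDiffAt (hU.mem_nhds hx)
  · have : h =ᶠ[nhds x] fun _ => 0 := notMem_tsupport_iff_eventuallyEq.1 fun h' => hx (hs h')
    exact contDiffAt_const.congr_of_eventuallyEq this

theorem exists_cutoff (m : ℕ) : ∃ K : ℝ, 0 ≤ K ∧ ∀ (y : Euc m) (r : ℝ), 0 < r →
    ∃ η : Euc m → ℝ, ContDiff ℝ 1 η ∧ (∀ x, 0 ≤ η x) ∧ (∀ x, η x ≤ 1) ∧
      (∀ x ∈ ball y (r / 4), η x = 1) ∧ tsupport η ⊆ ball y (r / 2) ∧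
      ∀ x, ‖fderiv ℝ η x‖ ≤ K * r⁻¹ := by
  let b : ContDiffBump (0 : Euc m) := ⟨1 / 4, 3 / 8, by norm_num, by norm_num⟩
  have hb : ContDiff ℝ 1 b := b.contDiff
  obtain ⟨K, hK⟩ := hb.lipschitzWith_of_hasCompactSupport b.hasCompactSupport one_ne_zero
  refine ⟨K, K.2, fun y r hr => ⟨fun x => b (r⁻¹ • (x - y)), ?_, fun x => b.nonneg,
    fun x => b.le_one, fun x hx => ?_, ?_, fun x => ?_⟩⟩
  · exact hb.comp (by fun_prop)
  · refine b.one_of_mem_closedBall ?_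
    rw [mem_ball, dist_eq_norm] at hx
    rw [mem_closedBall_zero_iff, norm_smul, norm_inv, Real.norm_of_nonneg hr.le,
      inv_mul_le_iff₀ hr]
    change ‖x - y‖ ≤ r * (1 / 4)
    linarith
  · refine (closure_minimal (t := closedBall y (r * (3 / 8))) (fun x hx => ?_)
      isClosed_closedBall).trans (closedBall_subset_ball (by linarith))
    have hx' : r⁻¹ • (x - y) ∈ Function.support b := hx
    rw [b.support_eq, mem_ball_zero_iff, norm_smul, norm_inv, Real.norm_of_nonneg hr.le,
      inv_mul_lt_iff₀ hr] at hx'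
    rw [mem_closedBall, dist_eq_norm]
    exact hx'.le
  · refine (norm_fderiv_le_of_lipschitz ℝ (C := K * ⟨r⁻¹, by positivity⟩) ?_).trans_eq rfl
    refine hK.comp (LipschitzWith.of_dist_le_mul fun x z => ?_)
    rw [dist_eq_norm, ← smul_sub, norm_smul, sub_sub_sub_cancel_right, norm_inv,
      Real.norm_of_nonneg hr.le, dist_eq_norm]
    rfl

theorem integral_fderiv_eq_zero {m : ℕ} {g : Euc m → ℝ} (hg : ContDiff ℝ 1 g)
    (hc : HasCompactSupport g) (e : Euc m) : ∫ x, fderiv ℝ g x e = 0 := by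
  have hd : Continuous fun x => fderiv ℝ g x e :=
    (hg.continuous_fderiv one_ne_zero).clm_apply continuous_const
  have hdc : HasCompactSupport fun x => fderiv ℝ g x e := hc.fderiv_apply ℝ e
  have := integral_mul_fderiv_eq_neg_fderiv_mul_of_integrable (𝕜 := ℝ)
    (μ := (volume : Measure (Euc m))) (f := fun _ => (1 : ℝ)) (g := g) (v := e)
    (by simp) (by simpa using hd.integrable_of_hasCompactSupport hdc)
    (by simpa using hg.continuous.integrable_of_hasCompactSupport hc)
    (fun x _ => differentiableAt_const _)
    (fun x _ => hg.differentiable one_ne_zero x)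
  simpa using this

theorem continuous_divg {m : ℕ} {X : Euc m → Euc m} (hX : ContDiff ℝ 1 X) :
    Continuous (divg X) := by
  unfold divg
  exact continuous_finsetSum _ fun i _ =>
    ((hX.continuous_fderiv one_ne_zero).clm_apply continuous_const).inner continuous_const

theorem divg_eq_zero_of_notMem_tsupport {m : ℕ} {X : Euc m → Euc m} {x : Euc m}
    (hx : x ∉ tsupport X) : divg X x = 0 := by
  simp [divg, fderiv_of_notMem_tsupport ℝ hx]

theorem integral_divg_eq_zero {m : ℕ} {X : Euc m → Euc m} (hX : ContDiff ℝ 1 X)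
    (hc : HasCompactSupport X) : ∫ x, divg X x = 0 := by
  have hcomp : ∀ (i : Fin m) x, ⟪fderiv ℝ X x (eb m i), eb m i⟫ =
      fderiv ℝ (fun z => ⟪X z, eb m i⟫) x (eb m i) := by
    intro i x
    rw [fderiv_inner_apply ℝ (hX.differentiable one_ne_zero x) (differentiableAt_const _)]
    simp
  have hX' : ∀ i, ContDiff ℝ 1 fun z => ⟪X z, eb m i⟫ := fun i => hX.inner ℝ contDiff_const
  have hc' : ∀ i, HasCompactSupport fun z => ⟪X z, eb m i⟫ := fun i =>
    hc.comp_left (g := fun z => ⟪z, eb m i⟫) (by simp)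
  simp only [divg, hcomp]
  rw [integral_finsetSum]
  · exact Finset.sum_eq_zero fun i _ => integral_fderiv_eq_zero (hX' i) (hc' i) _
  · intro i _
    exact (((hX' i).continuous_fderiv one_ne_zero).clm_apply
      continuous_const).integrable_of_hasCompactSupport ((hc' i).fderiv_apply ℝ _)

theorem divg_smul {m : ℕ} {φ : Euc m → ℝ} {X : Euc m → Euc m} {x : Euc m}
    (hφ : DifferentiableAt ℝ φ x) (hX : DifferentiableAt ℝ X x) :
    divg (fun z => φ z • X z) x = φ x * divg X x + fderiv ℝ φ x (X x) := by
  have h1 : fderiv ℝ φ x (X x) = ∑ i, ⟪X x, eb m i⟫ * fderiv ℝ φ x (eb m i) := by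
    conv_lhs => rw [← (EuclideanSpace.basisFun (Fin m) ℝ).sum_repr (X x)]
    simp [map_sum, eb, EuclideanSpace.inner_single_right]
  rw [h1]
  simp only [divg]
  rw [fderiv_fun_smul hφ hX, Finset.mul_sum, ← Finset.sum_add_distrib]
  refine Finset.sum_congr rfl fun i _ => ?_
  simp [inner_add_left, inner_smul_left]
  ring

theorem continuousOn_fderiv_of_isOpen {m : ℕ} {U : Set (Euc m)} (hU : IsOpen U) {u : Euc m → ℝ}
    (hu : ContDiffOn ℝ 1 u U) : ContinuousOn (fderiv ℝ u) U :=
  hu.continuousOn_fderiv_of_isOpen hU le_rfl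

/-- Caccioppoli inequality for a truncated subsolution of `div X ≥ -f`. -/
theorem caccioppoli {m : ℕ} {U : Set (Euc m)} (hU : IsOpen U) {u f η : Euc m → ℝ}
    {X : Euc m → Euc m} (hu : ContDiffOn ℝ 1 u U) (hX : ContDiffOn ℝ 1 X U)
    (hf : ContinuousOn f U) (hf0 : ∀ x ∈ U, 0 ≤ f x)
    (hell : ∀ x ∈ U, 1 / 2 * ‖fderiv ℝ u x‖ ^ 2 ≤ fderiv ℝ u x (X x))
    (hbd : ∀ x ∈ U, ‖X x‖ ≤ 3 / 2 * ‖fderiv ℝ u x‖)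
    (hdiv : ∀ x ∈ U, -divg X x ≤ f x)
    (hη : ContDiff ℝ 1 η) (hη0 : ∀ x, 0 ≤ η x) (hη1 : ∀ x, η x ≤ 1)
    {y : Euc m} {ρ : ℝ} (hρU : closedBall y ρ ⊆ U) (hηs : tsupport η ⊆ ball y ρ)
    {L : ℝ} (hL : ∀ x, ‖fderiv ℝ η x‖ ≤ L) :
    ∫ x in ball y ρ, η x ^ 2 * truncDeriv (u x) * ‖fderiv ℝ u x‖ ^ 2 ≤
      4 * (∫ x in ball y ρ, f x * max (u x) 0) +
        36 * L ^ 2 * ∫ x in ball y ρ, max (u x) 0 ^ 2 := by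
  have hBU : ball y ρ ⊆ U := ball_subset_closedBall.trans hρU
  have hint : ∀ {h : Euc m → ℝ}, ContinuousOn h U → IntegrableOn h (ball y ρ) := fun hh =>
    ((hh.mono hρU).integrableOn_compact (isCompact_closedBall y ρ)).mono_set
      ball_subset_closedBall
  have hFu : ContDiffOn ℝ 1 (fun x => trunc (u x)) U := contDiff_trunc.comp_contDiffOn hu
  have hφ : ContDiffOn ℝ 1 (fun x => η x ^ 2 * trunc (u x)) U :=
    (hη.contDiffOn.pow 2).mul hFu
  set Φ : Euc m → Euc m := fun x => (η x ^ 2 * trunc (u x)) • X x with hΦ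
  have hΦs : tsupport Φ ⊆ tsupport η := by
    refine closure_mono fun x hx => ?_
    contrapose! hx
    simp only [Function.mem_support, not_not] at hx
    simp [hΦ, hx]
  have hΦ1 : ContDiff ℝ 1 Φ :=
    contDiff_of_tsupport_subset hU (hφ.smul hX) (hΦs.trans (hηs.trans hBU))
  have hΦc : HasCompactSupport Φ := by
    refine HasCompactSupport.of_support_subset_isCompact (isCompact_closedBall y ρ) ?_
    exact (subset_tsupport Φ).trans (hΦs.trans (hηs.trans ball_subset_closedBall))
  have hzero : ∫ x in ball y ρ, divg Φ x = 0 := by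
    rw [setIntegral_eq_integral_of_forall_compl_eq_zero, integral_divg_eq_zero hΦ1 hΦc]
    intro x hx
    exact divg_eq_zero_of_notMem_tsupport fun h => hx (hηs (hΦs h))
  have hu' : ContinuousOn (fderiv ℝ u) U := continuousOn_fderiv_of_isOpen hU hu
  have hmax : ContinuousOn (fun x => max (u x) 0) U := 
    (continuous_id.max continuous_const).comp_continuousOn hu.continuousOn
  have iP : IntegrableOn (fun x => η x ^ 2 * truncDeriv (u x) * ‖fderiv ℝ u x‖ ^ 2) (ball y ρ) :=
    hint (((hη.continuous.continuousOn.pow 2).mul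
      (continuous_truncDeriv.comp_continuousOn hu.continuousOn)).mul (hu'.norm.pow 2))
  have if1 : IntegrableOn (fun x => f x * max (u x) 0) (ball y ρ) := hint (hf.mul hmax)
  have iu : IntegrableOn (fun x => max (u x) 0 ^ 2) (ball y ρ) := hint (hmax.pow 2)
  have iD : IntegrableOn (divg Φ) (ball y ρ) := hint (continuous_divg hΦ1).continuousOn
  have key : ∀ x ∈ ball y ρ, η x ^ 2 * truncDeriv (u x) * ‖fderiv ℝ u x‖ ^ 2 ≤
      4 * divg Φ x + (4 * (f x * max (u x) 0) + 36 * L ^ 2 * max (u x) 0 ^ 2) := by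
    intro x hxB
    have hxU := hBU hxB
    have hnx := hU.mem_nhds hxU
    have dX : DifferentiableAt ℝ X x := (hX.contDiffAt hnx).differentiableAt one_ne_zero
    have du : DifferentiableAt ℝ u x := (hu.contDiffAt hnx).differentiableAt one_ne_zero
    have dη : DifferentiableAt ℝ η x := hη.differentiable one_ne_zero x
    have hd : HasFDerivAt (fun z => η z ^ 2 * trunc (u z))
        (η x ^ 2 • (truncDeriv (u x) • fderiv ℝ u x) +
          trunc (u x) • ((2 * η x) • fderiv ℝ η x)) x := by
      have h1 := (hasDerivAt_trunc (u x)).comp_hasFDerivAt x du.hasFDerivAt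
      have h2 : HasFDerivAt (fun z => η z ^ 2) ((2 * η x) • fderiv ℝ η x) x := by
        simpa using dη.hasFDerivAt.pow 2
      exact h2.mul h1
    have hdivΦ : divg Φ x = η x ^ 2 * trunc (u x) * divg X x +
        (η x ^ 2 * (truncDeriv (u x) * fderiv ℝ u x (X x)) +
          trunc (u x) * (2 * η x * fderiv ℝ η x (X x))) := by
      rw [hΦ, divg_smul hd.differentiableAt dX, hd.fderiv]
      simp
    set F := trunc (u x)
    set D := truncDeriv (u x)
    set t := max (u x) 0
    set G := ‖fderiv ℝ u x‖
    have hF0 : 0 ≤ F := trunc_nonneg _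
    have hD0 : 0 ≤ D := truncDeriv_nonneg _
    have ht0 : 0 ≤ t := le_max_right _ _
    have hG0 : 0 ≤ G := norm_nonneg _
    have hL0 : 0 ≤ L := (norm_nonneg _).trans (hL x)
    have hFt : F ≤ t := trunc_le _
    have hFD : F ^ 2 ≤ t ^ 2 * D := trunc_sq_le _
    have e0 := hη0 x
    have e1 : η x ^ 2 ≤ 1 := pow_le_one₀ e0 (hη1 x)
    have a1 : -(f x * t) ≤ η x ^ 2 * F * divg X x := by
      have h1 : η x ^ 2 * F * -divg X x ≤ η x ^ 2 * F * f x :=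
        mul_le_mul_of_nonneg_left (hdiv x hxU) (by positivity)
      have h2 : η x ^ 2 * F ≤ 1 * t := by gcongr
      have h3 := mul_le_mul_of_nonneg_right h2 (hf0 x hxU)
      linarith
    have a2 : η x ^ 2 * (D * (1 / 2 * G ^ 2)) ≤ η x ^ 2 * (D * fderiv ℝ u x (X x)) := by
      gcongr
      exact hell x hxU
    have a3 : -(F * (2 * η x * (L * (3 / 2 * G)))) ≤ F * (2 * η x * fderiv ℝ η x (X x)) := by
      have h1 : |fderiv ℝ η x (X x)| ≤ L * (3 / 2 * G) :=
        ((fderiv ℝ η x).le_opNorm (X x)).trans (by gcongr; exacts [hL x, hbd x hxU])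
      have h2 := (abs_le.1 h1).1
      have h3 := mul_le_mul_of_nonneg_left h2 (show 0 ≤ F * (2 * η x) by positivity)
      linarith
    have a4 : 3 * (F * η x * G * L) ≤ 1 / 4 * (η x ^ 2 * D * G ^ 2) + 9 * L ^ 2 * t ^ 2 := by
      refine (abs_le_of_sq_le_sq' ?_ (by positivity)).2
      have h1 := mul_le_mul_of_nonneg_right hFD (sq_nonneg (η x * G * L))
      nlinarith [sq_nonneg (1 / 4 * (η x ^ 2 * D * G ^ 2) - 9 * L ^ 2 * t ^ 2)]
    rw [hdivΦ]
    linarith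
  have i3 : IntegrableOn (fun x => 4 * (f x * max (u x) 0) + 36 * L ^ 2 * max (u x) 0 ^ 2)
      (ball y ρ) := (if1.const_mul 4).add (iu.const_mul _)
  have i4 : IntegrableOn (fun x => 4 * divg Φ x +
      (4 * (f x * max (u x) 0) + 36 * L ^ 2 * max (u x) 0 ^ 2)) (ball y ρ) :=
    (iD.const_mul 4).add i3
  calc _ ≤ ∫ x in ball y ρ,
        (4 * divg Φ x + (4 * (f x * max (u x) 0) + 36 * L ^ 2 * max (u x) 0 ^ 2)) :=
        setIntegral_mono_on iP i4 measurableSet_ball key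
    _ = _ := by
        rw [integral_add (iD.const_mul 4) i3,
          integral_add (if1.const_mul 4) (iu.const_mul _), integral_const_mul, hzero,
          integral_const_mul, integral_const_mul]
        ring

/-- One step of the De Giorgi iteration. -/
theorem deGiorgi_step {m : ℕ} (hm : 1 ≤ m) : ∃ C : ℝ, 0 < C ∧
    ∀ {U : Set (Euc m)}, IsOpen U → ∀ {u f : Euc m → ℝ} {X : Euc m → Euc m},
    ContDiffOn ℝ 1 u U → ContDiffOn ℝ 1 X U → ContinuousOn f U → (∀ x ∈ U, 0 ≤ f x) →
    (∀ x ∈ U, 1 / 2 * ‖fderiv ℝ u x‖ ^ 2 ≤ fderiv ℝ u x (X x)) →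
    (∀ x ∈ U, ‖X x‖ ≤ 3 / 2 * ‖fderiv ℝ u x‖) →
    (∀ x ∈ U, -divg X x ≤ f x) →
    ∀ (y : Euc m) (r ℓ : ℝ), 0 < r → closedBall y (r / 2) ⊆ U → 0 ≤ ℓ →
    volume.real (ball y (r / 2) ∩ {x | 0 < u x}) ≤ ℓ ^ m →
    ∫ x in ball y (r / 4), max (u x - 1) 0 ^ 2 ≤
      C * ℓ ^ 2 * (r⁻¹ ^ 2 * (∫ x in ball y (r / 2), max (u x) 0 ^ 2) +
        ∫ x in ball y (r / 2), f x * max (u x) 0) := by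
  obtain ⟨C, hC0, hC⟩ := faber_krahn hm
  obtain ⟨K, hK0, hK⟩ := exists_cutoff m
  refine ⟨C * (74 * K ^ 2 + 8), by positivity, ?_⟩
  intro U hU u f X hu hX hf hf0 hell hbd hdiv y r ℓ hr hρU hℓ hvol
  obtain ⟨η, hη, hη0, hη1, hηone, hηs, hηL⟩ := hK y r hr
  have hcac := caccioppoli hU hu hX hf hf0 hell hbd hdiv hη hη0 hη1 hρU hηs hηL
  have hBU : ball y (r / 2) ⊆ U := ball_subset_closedBall.trans hρU
  have hint : ∀ {h : Euc m → ℝ}, ContinuousOn h U → IntegrableOn h (ball y (r / 2)) := fun hh =>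
    ((hh.mono hρU).integrableOn_compact (isCompact_closedBall y (r / 2))).mono_set
      ball_subset_closedBall
  set g : Euc m → ℝ := fun x => η x * trunc (u x) with hg
  have hgsup : ∀ x, g x ≠ 0 → η x ≠ 0 := fun x hx h => hx (by simp [hg, h])
  have hgs : tsupport g ⊆ tsupport η := closure_mono hgsup
  have hg1 : ContDiff ℝ 1 g := contDiff_of_tsupport_subset hU
    (hη.contDiffOn.mul (contDiff_trunc.comp_contDiffOn hu)) (hgs.trans (hηs.trans hBU))
  have hgc : HasCompactSupport g :=
    HasCompactSupport.of_support_subset_isCompact (isCompact_closedBall y (r / 2))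
      ((subset_tsupport g).trans (hgs.trans (hηs.trans ball_subset_closedBall)))
  have hsupp : Function.support g ⊆ ball y (r / 2) ∩ {x | 0 < u x} := by
    intro x hx
    refine ⟨hηs (subset_tsupport η (hgsup x hx)), ?_⟩
    by_contra h
    exact hx (by simp [hg, trunc_eq_zero (not_lt.1 h)])
  have hvol' : volume.real (Function.support g) ≤ ℓ ^ m :=
    (measureReal_mono hsupp ((measure_mono inter_subset_left).trans_lt
      measure_ball_lt_top).ne).trans hvol
  have hFK := hC g hg1 hgc (fun x => mul_nonneg (hη0 x) (trunc_nonneg _)) ℓ hℓ hvol'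
  have hgd : Continuous (fderiv ℝ g) := hg1.continuous_fderiv one_ne_zero
  have hu' : ContinuousOn (fderiv ℝ u) U := continuousOn_fderiv_of_isOpen hU hu
  have hmax : ContinuousOn (fun x => max (u x) 0) U := 
    (continuous_id.max continuous_const).comp_continuousOn hu.continuousOn
  have iP : IntegrableOn (fun x => η x ^ 2 * truncDeriv (u x) * ‖fderiv ℝ u x‖ ^ 2)
      (ball y (r / 2)) :=
    hint (((hη.continuous.continuousOn.pow 2).mul
      (continuous_truncDeriv.comp_continuousOn hu.continuousOn)).mul (hu'.norm.pow 2))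
  have iu : IntegrableOn (fun x => max (u x) 0 ^ 2) (ball y (r / 2)) := hint (hmax.pow 2)
  have ig : Integrable fun x => g x ^ 2 :=
    (hg1.continuous.pow 2).integrable_of_hasCompactSupport
      (by simpa only [pow_two] using hgc.mul_left (f := g))
  have hlow : ∫ x in ball y (r / 4), max (u x - 1) 0 ^ 2 ≤ ∫ x, g x ^ 2 := by
    refine le_trans (setIntegral_mono_on ?_ ig.integrableOn measurableSet_ball fun x hx => ?_)
      (setIntegral_le_integral ig (Eventually.of_forall fun x => sq_nonneg (g x)))
    · exact (hint (((continuous_id.sub continuous_const).max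
        continuous_const).comp_continuousOn hu.continuousOn |>.pow 2)).mono_set
        (ball_subset_ball (by linarith))
    · simp only [hg, hηone x hx, one_mul]
      gcongr
      exact max_sub_one_le_trunc _
  have hgrad : ∫ x, ‖fderiv ℝ g x‖ ^ 2 ≤
      2 * (K * r⁻¹) ^ 2 * (∫ x in ball y (r / 2), max (u x) 0 ^ 2) +
      2 * ∫ x in ball y (r / 2), η x ^ 2 * truncDeriv (u x) * ‖fderiv ℝ u x‖ ^ 2 := by
    rw [← integral_const_mul, ← integral_const_mul,
      ← integral_add (iu.const_mul _) (iP.const_mul _),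
      ← setIntegral_eq_integral_of_forall_compl_eq_zero (s := ball y (r / 2))]
    · refine setIntegral_mono_on (hint (hgd.norm.pow 2).continuousOn)
        ((iu.const_mul _).add (iP.const_mul _)) measurableSet_ball fun x hx => ?_
      have du : DifferentiableAt ℝ u x :=
        (hu.contDiffAt (hU.mem_nhds (hBU hx))).differentiableAt one_ne_zero
      have dη : DifferentiableAt ℝ η x := hη.differentiable one_ne_zero x
      have hd : HasFDerivAt g (η x • (truncDeriv (u x) • fderiv ℝ u x) +
          trunc (u x) • fderiv ℝ η x) x :=
        dη.hasFDerivAt.mul ((hasDerivAt_trunc (u x)).comp_hasFDerivAt x du.hasFDerivAt)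
      rw [hd.fderiv]
      have hn : ‖η x • (truncDeriv (u x) • fderiv ℝ u x) + trunc (u x) • fderiv ℝ η x‖ ≤
          η x * (truncDeriv (u x) * ‖fderiv ℝ u x‖) + max (u x) 0 * (K * r⁻¹) := by
        refine (norm_add_le _ _).trans ?_
        rw [norm_smul, norm_smul, norm_smul, Real.norm_of_nonneg (hη0 x),
          Real.norm_of_nonneg (truncDeriv_nonneg _), Real.norm_of_nonneg (trunc_nonneg _)]
        gcongr
        exacts [trunc_le _, hηL x]
      have hD0 := truncDeriv_nonneg (u x)
      have hD1 := truncDeriv_le_one (u x)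
      have h2 := pow_le_pow_left₀ (norm_nonneg _) hn 2
      have h3 : η x ^ 2 * ‖fderiv ℝ u x‖ ^ 2 * (truncDeriv (u x) ^ 2) ≤
          η x ^ 2 * ‖fderiv ℝ u x‖ ^ 2 * truncDeriv (u x) := by
        gcongr
        nlinarith
      nlinarith [sq_nonneg (η x * (truncDeriv (u x) * ‖fderiv ℝ u x‖) -
        max (u x) 0 * (K * r⁻¹))]
    · intro x hx
      rw [fderiv_of_notMem_tsupport ℝ fun h => hx (hηs (hgs h))]
      simp
  have hA : 0 ≤ ∫ x in ball y (r / 2), max (u x) 0 ^ 2 :=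
    integral_nonneg fun x => sq_nonneg _
  have hB : 0 ≤ ∫ x in ball y (r / 2), f x * max (u x) 0 :=
    setIntegral_nonneg measurableSet_ball fun x hx =>
      mul_nonneg (hf0 x (hBU hx)) (le_max_right _ _)
  refine hlow.trans (hFK.trans ?_)
  set I₁ := ∫ x in ball y (r / 2), max (u x) 0 ^ 2
  set I₂ := ∫ x in ball y (r / 2), f x * max (u x) 0
  have hbound : ∫ x, ‖fderiv ℝ g x‖ ^ 2 ≤ (74 * K ^ 2 + 8) * (r⁻¹ ^ 2 * I₁ + I₂) := by
    have h1 : 0 ≤ r⁻¹ ^ 2 * I₁ := by positivity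
    have h2 : 0 ≤ K ^ 2 * I₂ := by positivity
    rw [mul_pow] at hgrad hcac
    linarith
  calc _ ≤ C * ℓ ^ 2 * ((74 * K ^ 2 + 8) * (r⁻¹ ^ 2 * I₁ + I₂)) := by gcongr
    _ = _ := by ring

theorem divg_const_smul {m : ℕ} {X : Euc m → Euc m} {x : Euc m} (hX : DifferentiableAt ℝ X x)
    (c : ℝ) : divg (fun z => c • X z) x = c * divg X x := by
  simp [divg_smul (differentiableAt_const c) hX]

theorem volume_real_ball {m : ℕ} (y : Euc m) {r : ℝ} (hr : 0 < r) :
    volume.real (ball y r) = r ^ m * volume.real (ball (0 : Euc m) 1) := by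
  rw [Measure.real, Measure.addHaar_ball_of_pos volume y hr, ENNReal.toReal_mul,
    finrank_euclideanSpace_fin, ENNReal.toReal_ofReal (by positivity), Measure.real]

/-- Pointwise bounds on the truncations of `w` at the level `k + z`, where `Q` is the square of
the truncation of `w` at the level `k`. -/
theorem truncation_bounds {w k z lam : ℝ} (hz : 0 < z) (hlam : 0 < lam) :
    max (z⁻¹ * (w - (k + z))) 0 ^ 2 ≤ max (w - k) 0 ^ 2 / z ^ 2 ∧
    max (z⁻¹ * (w - (k + z))) 0 ≤ max (w - k) 0 ^ 2 / z ^ 2 ∧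
    Real.exp w * max (z⁻¹ * (w - (k + z))) 0 ≤
      1 / 2 * (lam * Real.exp w ^ 2 + max (w - k) 0 ^ 2 / z ^ 2 / lam) ∧
    Real.exp w ≤ Real.exp (k + z) +
      1 / 2 * (lam * Real.exp w ^ 2 + max (w - k) 0 ^ 2 / z ^ 2 / lam) ∧
    (0 < z⁻¹ * (w - (k + z)) → 1 ≤ max (w - k) 0 ^ 2 / z ^ 2) := by
  set q := max (w - k) 0 / z with hq
  have hQ : max (w - k) 0 ^ 2 / z ^ 2 = q ^ 2 := by rw [hq, div_pow]
  rw [hQ]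
  have hq0 : 0 ≤ q := by positivity
  have hu : max (z⁻¹ * (w - (k + z))) 0 = max (q - 1) 0 := by
    rcases le_total (w - k) 0 with h | h
    · have h1 : q = 0 := by simp [hq, h]
      rw [h1, max_eq_right, max_eq_right (by norm_num)]
      exact mul_nonpos_of_nonneg_of_nonpos (by positivity) (by linarith)
    · congr 1
      rw [hq, max_eq_left h]
      field_simp
      ring
  have hp0 : 0 ≤ max (q - 1) 0 := le_max_right _ _
  have hpq : max (q - 1) 0 ≤ q := max_le (by linarith) hq0
  have hyoung : ∀ s : ℝ, s ^ 2 ≤ q ^ 2 →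
      Real.exp w * s ≤ 1 / 2 * (lam * Real.exp w ^ 2 + q ^ 2 / lam) := by
    intro s hs
    have h1 : s ^ 2 / lam ≤ q ^ 2 / lam := by gcongr
    have h2 : 0 ≤ (lam * Real.exp w - s) ^ 2 / lam := by positivity
    have h3 : (lam * Real.exp w - s) ^ 2 / lam =
        lam * Real.exp w ^ 2 - 2 * (Real.exp w * s) + s ^ 2 / lam := by
      field_simp
      ring
    linarith
  have hone : 0 < z⁻¹ * (w - (k + z)) → 1 ≤ q ^ 2 := by
    intro h
    have h1 : 0 < max (q - 1) 0 := hu ▸ lt_max_of_lt_left h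
    have h2 : 1 < q := by
      by_contra hcon
      rw [max_eq_right (by linarith)] at h1
      exact lt_irrefl _ h1
    nlinarith
  have hsq : max (q - 1) 0 ^ 2 ≤ q ^ 2 := by gcongr
  rw [hu]
  refine ⟨hsq, ?_, hyoung _ hsq, ?_, hone⟩
  · exact max_le (by nlinarith) (sq_nonneg q)
  · rcases le_or_gt w (k + z) with h | h
    · have := Real.exp_le_exp.2 h
      have : 0 ≤ 1 / 2 * (lam * Real.exp w ^ 2 + q ^ 2 / lam) := by positivity
      linarith
    · have h1 := hyoung 1 (by
        rw [one_pow]; exact hone (mul_pos (inv_pos.2 hz) (by linarith)))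
      have := Real.exp_pos (k + z)
      linarith

set_option maxHeartbeats 800000 in
/-- One step of the simultaneous decay of the excess of `w` over a level and of the scaled
integral of `exp w`. -/
theorem decay_step {m : ℕ} (hm : 1 ≤ m) {c₀ C₁ : ℝ} (hc₀ : 0 < c₀) (hC₁ : 0 < C₁) :
    ∃ z₀ : ℝ, 0 < z₀ ∧ z₀ ≤ 1 / 4 ∧ ∀ {U : Set (Euc m)}, IsOpen U → ∀ {w : Euc m → ℝ}
    {X : Euc m → Euc m} {δ K z r : ℝ} {y : Euc m},
    ContDiffOn ℝ 1 w U → ContDiffOn ℝ 1 X U →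
    (∀ x ∈ U, 1 / 2 * ‖fderiv ℝ w x‖ ^ 2 ≤ fderiv ℝ w x (X x)) →
    (∀ x ∈ U, ‖X x‖ ≤ 3 / 2 * ‖fderiv ℝ w x‖) →
    (∀ x ∈ U, -divg X x ≤ c₀ * Real.exp (w x) + δ) →
    0 ≤ δ → δ ≤ 1 →
    Real.exp K * volume.real (ball (0 : Euc m) 1) ≤ 1 / 2 * z₀ ^ (6 * m) →
    0 < r → r ≤ 1 → closedBall y r ⊆ U → 0 < z → z ≤ z₀ → z ^ (6 * m) = z₀ ^ (6 * m) * r →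
    ∫ x in ball y (r / 2), Real.exp (w x) ^ 2 ≤
      C₁ * (r⁻¹ ^ 2 + δ) * ∫ x in ball y r, Real.exp (w x) →
    ∫ x in ball y r, max (w x - (K - 4 * z)) 0 ^ 2 ≤ z ^ (6 * m + 12) * r ^ m →
    r ^ 2 * ∫ x in ball y r, Real.exp (w x) ≤ z ^ (6 * m) * r ^ m →
    (∫ x in ball y ((1 / 2) ^ (6 * m) * r), max (w x - (K - 4 * (z / 2))) 0 ^ 2 ≤
      (z / 2) ^ (6 * m + 12) * ((1 / 2) ^ (6 * m) * r) ^ m) ∧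
    ((1 / 2) ^ (6 * m) * r) ^ 2 * ∫ x in ball y ((1 / 2) ^ (6 * m) * r), Real.exp (w x) ≤
      (z / 2) ^ (6 * m) * ((1 / 2) ^ (6 * m) * r) ^ m := by
  obtain ⟨C, hC0, hC⟩ := deGiorgi_step hm
  obtain ⟨n, hn⟩ : ∃ n, n = 6 * m := ⟨_, rfl⟩
  simp only [← hn]
  obtain ⟨τ, hτ⟩ : ∃ τ : ℝ, τ = (1 / 2) ^ n := ⟨_, rfl⟩
  have hτ0 : 0 < τ := by rw [hτ]; positivity
  have hτ4 : τ ≤ 1 / 4 := by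
    calc τ ≤ (1 / 2 : ℝ) ^ 2 := by
          rw [hτ]; exact pow_le_pow_of_le_one (by norm_num) (by norm_num) (by omega)
      _ = 1 / 4 := by norm_num
  set C' : ℝ := C * (2 + c₀ * (C₁ + 1)) with hC'
  have hC'0 : 0 < C' := by positivity
  set z₀ : ℝ := min (1 / 4) (min ((1 / 2) ^ (n + 12) * τ ^ m / C') (1 / 2 * τ ^ m / (C₁ + 1)))
    with hz₀
  have hz₀0 : 0 < z₀ := by positivity
  have hz₀4 : z₀ ≤ 1 / 4 := min_le_left _ _
  have hz₀a : C' * z₀ ≤ (1 / 2) ^ (n + 12) * τ ^ m := by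
    rw [← le_div_iff₀' hC'0]
    exact (min_le_right _ _).trans (min_le_left _ _)
  have hz₀b : (C₁ + 1) * z₀ ≤ 1 / 2 * τ ^ m := by
    rw [← le_div_iff₀' (by positivity)]
    exact (min_le_right _ _).trans (min_le_right _ _)
  clear_value z₀
  refine ⟨z₀, hz₀0, hz₀4, ?_⟩
  intro U hU w X δ K z r y hw hX hell hbd hdiv hδ0 hδ1 hK hr0 hr1 hrU hz hzz₀ hzr hV2 hi hii
  rw [← hτ]
  have hz1 : z ≤ 1 := by linarith
  set k := K - 4 * z with hk
  obtain ⟨lam, hlam⟩ : ∃ lam : ℝ, lam = z ^ 5 * r ^ 2 := ⟨_, rfl⟩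
  have hlam0 : 0 < lam := by rw [hlam]; positivity
  set Q : Euc m → ℝ := fun x => max (w x - k) 0 ^ 2 with hQ
  set u : Euc m → ℝ := fun x => z⁻¹ * (w x - (k + z)) with hu
  set j : Euc m → ℝ := fun x =>
    1 / 2 * (lam * Real.exp (w x) ^ 2 + Q x / z ^ 2 / lam) with hj
  have hTB := fun x => truncation_bounds (w := w x) (k := k) hz hlam0
  have hwc : ContinuousOn w U := hw.continuousOn
  have hint : ∀ {h : Euc m → ℝ} {ρ : ℝ}, ρ ≤ r → ContinuousOn h U → IntegrableOn h (ball y ρ) :=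
    fun hρ hh => ((hh.mono hrU).integrableOn_compact (isCompact_closedBall y r)).mono_set
      ((ball_subset_ball hρ).trans ball_subset_closedBall)
  have cV : ContinuousOn (fun x => Real.exp (w x)) U := hwc.rexp
  have cQ : ContinuousOn Q U := by
    have : Continuous fun t : ℝ => max (t - k) 0 ^ 2 := by fun_prop
    exact this.comp_continuousOn hwc
  have cj : ContinuousOn j U := by
    simp only [hj]
    fun_prop
  have hwu : ContDiffOn ℝ 1 u U := contDiffOn_const.mul (hw.sub contDiffOn_const)
  have cu : ContinuousOn (fun x => max (u x) 0) U :=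
    (continuous_id.max continuous_const).comp_continuousOn hwu.continuousOn
  have hr2 : r / 2 ≤ r := by linarith
  have hsub2 : ball y (r / 2) ⊆ ball y r := ball_subset_ball hr2
  have hQ0 : ∀ x, 0 ≤ Q x := fun x => sq_nonneg _
  have hQ1 : ∫ x in ball y (r / 2), Q x ≤ z ^ (n + 12) * r ^ m :=
    (setIntegral_mono_set (hint le_rfl cQ) (Eventually.of_forall hQ0)
      hsub2.eventuallyLE).trans hi
  have hP2 : r ^ 4 * ∫ x in ball y (r / 2), Real.exp (w x) ^ 2 ≤ 2 * C₁ * (z ^ n * r ^ m) := by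
    have hI0 : 0 ≤ ∫ x in ball y r, Real.exp (w x) := by positivity
    have h1 : r ^ 2 * (r⁻¹ ^ 2 + δ) ≤ 2 := by
      rw [mul_add, ← mul_pow, mul_inv_cancel₀ hr0.ne', one_pow]
      have : r ^ 2 * δ ≤ 1 * 1 := by gcongr; exact pow_le_one₀ hr0.le hr1
      linarith
    calc _ ≤ r ^ 4 * (C₁ * (r⁻¹ ^ 2 + δ) * ∫ x in ball y r, Real.exp (w x)) := by gcongr
      _ = C₁ * (r ^ 2 * (r⁻¹ ^ 2 + δ)) * (r ^ 2 * ∫ x in ball y r, Real.exp (w x)) := by ring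
      _ ≤ C₁ * 2 * (z ^ n * r ^ m) := by gcongr
      _ = _ := by ring
  have iQ := hint hr2 cQ
  have iQz : IntegrableOn (fun x => Q x / z ^ 2) (ball y (r / 2)) := iQ.div_const _
  have ij := hint hr2 cj
  have hJ : r ^ 2 * ∫ x in ball y (r / 2), j x ≤ (C₁ + 1) * (z ^ (n + 5) * r ^ m) := by
    have h1 : ∫ x in ball y (r / 2), j x =
        1 / 2 * (lam * (∫ x in ball y (r / 2), Real.exp (w x) ^ 2) +
          (∫ x in ball y (r / 2), Q x) / z ^ 2 / lam) := by
      simp only [hj]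
      have iV : IntegrableOn (fun x => lam * Real.exp (w x) ^ 2) (ball y (r / 2)) :=
        (hint hr2 (cV.pow 2)).const_mul lam
      have iQl : IntegrableOn (fun x => Q x / z ^ 2 / lam) (ball y (r / 2)) :=
        (iQ.div_const _).div_const _
      rw [integral_const_mul, integral_add iV iQl, integral_const_mul, integral_div, integral_div]
    have h2 : (∫ x in ball y (r / 2), Q x) / z ^ 2 / lam * r ^ 2 ≤ z ^ (n + 5) * r ^ m := by
      rw [div_div, div_mul_eq_mul_div, div_le_iff₀ (by positivity), hlam]
      calc _ ≤ (z ^ (n + 12) * r ^ m) * r ^ 2 := by gcongr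
        _ = _ := by ring
    have h3 : r ^ 2 * (lam * ∫ x in ball y (r / 2), Real.exp (w x) ^ 2) ≤
        2 * C₁ * (z ^ (n + 5) * r ^ m) := by
      rw [hlam]
      calc _ = z ^ 5 * (r ^ 4 * ∫ x in ball y (r / 2), Real.exp (w x) ^ 2) := by ring
        _ ≤ z ^ 5 * (2 * C₁ * (z ^ n * r ^ m)) := by gcongr
        _ = _ := by ring
    rw [h1]
    have : 0 ≤ z ^ (n + 5) * r ^ m := by positivity
    linarith
  have hτr4 : τ * r ≤ r / 4 := by nlinarith
  have hj0 : ∀ x, 0 ≤ j x := fun x => by have := hQ0 x; positivity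
  constructor
  · have hvol : volume.real (ball y (r / 2) ∩ {x | 0 < u x}) ≤ (z ^ 6 * r) ^ m := by
      have hfin : volume (ball y (r / 2) ∩ {x | 0 < u x}) ≠ ⊤ :=
        ((measure_mono inter_subset_left).trans_lt measure_ball_lt_top).ne
      have hms : MeasurableSet (ball y (r / 2) ∩ {x | 0 < u x}) :=
        ((hwu.continuousOn.mono (hsub2.trans (ball_subset_closedBall.trans
          hrU))).isOpen_inter_preimage isOpen_ball isOpen_Ioi).measurableSet
      have h1 : volume.real (ball y (r / 2) ∩ {x | 0 < u x}) ≤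
          ∫ x in ball y (r / 2), Q x / z ^ 2 := by
        calc _ = ∫ x in ball y (r / 2) ∩ {x | 0 < u x}, (1 : ℝ) := by simp
          _ ≤ ∫ x in ball y (r / 2) ∩ {x | 0 < u x}, Q x / z ^ 2 := by
              refine setIntegral_mono_on (integrableOn_const hfin)
                (iQz.mono_set inter_subset_left) hms fun x hx => ?_
              exact (hTB x).2.2.2.2 hx.2
          _ ≤ _ := setIntegral_mono_set iQz
              (Eventually.of_forall fun x => div_nonneg (hQ0 x) (sq_nonneg z))
              inter_subset_left.eventuallyLE
      rw [integral_div] at h1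
      refine h1.trans ?_
      rw [div_le_iff₀ (by positivity), mul_pow, ← pow_mul, ← hn]
      refine hQ1.trans ?_
      have : z ^ (n + 12) ≤ z ^ (n + 2) := pow_le_pow_of_le_one hz.le hz1 (by omega)
      calc _ ≤ z ^ (n + 2) * r ^ m := by gcongr
        _ = _ := by ring
    have hXz : ContDiffOn ℝ 1 (fun x => z⁻¹ • X x) U := hX.const_smul z⁻¹
    have hfu : ∀ x ∈ U, fderiv ℝ u x = z⁻¹ • fderiv ℝ w x := by
      intro x hx
      have dw : DifferentiableAt ℝ w x :=
        (hw.contDiffAt (hU.mem_nhds hx)).differentiableAt one_ne_zero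
      simp only [hu]
      rw [fderiv_const_mul (dw.sub_const _), fderiv_sub_const]
    have hzi : 0 < z⁻¹ := inv_pos.2 hz
    have hmain := hC hU (f := fun x => z⁻¹ * (c₀ * Real.exp (w x) + δ)) hwu hXz
      (continuousOn_const.mul ((continuousOn_const.mul cV).add continuousOn_const))
      (fun x _ => by positivity)
      (fun x hx => by
        rw [hfu x hx, norm_smul, Real.norm_of_nonneg hzi.le]
        simp only [smul_apply, map_smul, smul_eq_mul]
        have := mul_le_mul_of_nonneg_left (hell x hx) (sq_nonneg z⁻¹)
        linarith)
      (fun x hx => by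
        rw [hfu x hx, norm_smul, norm_smul, Real.norm_of_nonneg hzi.le]
        have := mul_le_mul_of_nonneg_left (hbd x hx) hzi.le
        linarith)
      (fun x hx => by
        rw [divg_const_smul ((hX.contDiffAt (hU.mem_nhds hx)).differentiableAt one_ne_zero)]
        have := mul_le_mul_of_nonneg_left (hdiv x hx) hzi.le
        linarith)
      y r (z ^ 6 * r) hr0 ((closedBall_subset_closedBall hr2).trans hrU) (by positivity) hvol
    have hu2 : ∫ x in ball y (r / 2), max (u x) 0 ^ 2 ≤ (∫ x in ball y (r / 2), Q x) / z ^ 2 := by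
      rw [← integral_div]
      exact setIntegral_mono_on (hint hr2 (cu.pow 2)) (iQ.div_const _) measurableSet_ball
        fun x _ => (hTB x).1
    have iR : IntegrableOn (fun x => z⁻¹ * (c₀ * j x + Q x / z ^ 2)) (ball y (r / 2)) :=
      ((ij.const_mul c₀).add (iQ.div_const _)).const_mul _
    have hfu2 : ∫ x in ball y (r / 2), z⁻¹ * (c₀ * Real.exp (w x) + δ) * max (u x) 0 ≤
        z⁻¹ * (c₀ * (∫ x in ball y (r / 2), j x) + (∫ x in ball y (r / 2), Q x) / z ^ 2) := by
      rw [← integral_div, ← integral_const_mul c₀,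
        ← integral_add (ij.const_mul c₀) (iQ.div_const _), ← integral_const_mul]
      refine setIntegral_mono_on (hint hr2 ((continuousOn_const.mul ((continuousOn_const.mul
        cV).add continuousOn_const)).mul cu)) iR measurableSet_ball fun x _ => ?_
      rw [mul_assoc]
      refine mul_le_mul_of_nonneg_left ?_ hzi.le
      have h1 := mul_le_mul_of_nonneg_left (hTB x).2.2.1 hc₀.le
      have h2 : δ * max (u x) 0 ≤ 1 * (Q x / z ^ 2) := by
        gcongr
        exact (hTB x).2.1
      change c₀ * (Real.exp (w x) * max (u x) 0) ≤ c₀ * j x at h1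
      linarith
    have hscale : ∀ x, max (w x - (K - 4 * (z / 2))) 0 ^ 2 = z ^ 2 * max (u x - 1) 0 ^ 2 := by
      intro x
      rw [← mul_pow, mul_max_of_nonneg _ _ hz.le, mul_zero]
      congr 2
      simp only [hu, hk]
      field_simp
      ring
    have cu1 : ContinuousOn (fun x => max (u x - 1) 0 ^ 2) U := by
      have : Continuous fun t : ℝ => max (t - 1) 0 ^ 2 := by fun_prop
      exact this.comp_continuousOn hwu.continuousOn
    simp_rw [hscale]
    rw [integral_const_mul]
    have hmono : ∫ x in ball y (τ * r), max (u x - 1) 0 ^ 2 ≤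
        ∫ x in ball y (r / 4), max (u x - 1) 0 ^ 2 :=
      setIntegral_mono_set (hint (by linarith) cu1) (Eventually.of_forall fun x => sq_nonneg _)
        (ball_subset_ball hτr4).eventuallyLE
    set J := ∫ x in ball y (r / 2), j x
    set Q1 := ∫ x in ball y (r / 2), Q x
    have hb1 : r ^ 2 * (r⁻¹ ^ 2 * (Q1 / z ^ 2)) ≤ z ^ (n + 4) * r ^ m := by
      rw [← mul_assoc, ← mul_pow, mul_inv_cancel₀ hr0.ne', one_pow, one_mul,
        div_le_iff₀ (by positivity)]
      have : z ^ (n + 12) ≤ z ^ (n + 6) := pow_le_pow_of_le_one hz.le hz1 (by omega)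
      calc _ ≤ z ^ (n + 6) * r ^ m := hQ1.trans (by gcongr)
        _ = _ := by ring
    have hb2 : r ^ 2 * (z⁻¹ * (c₀ * J)) ≤ c₀ * (C₁ + 1) * (z ^ (n + 4) * r ^ m) := by
      calc _ = z⁻¹ * c₀ * (r ^ 2 * J) := by ring
        _ ≤ z⁻¹ * c₀ * ((C₁ + 1) * (z ^ (n + 5) * r ^ m)) := by gcongr
        _ = _ := by field_simp; ring
    have hb3 : r ^ 2 * (z⁻¹ * (Q1 / z ^ 2)) ≤ z ^ (n + 4) * r ^ m := by
      have hQ10 : 0 ≤ Q1 := integral_nonneg hQ0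
      have h1 : r ^ 2 ≤ 1 := pow_le_one₀ hr0.le hr1
      have h2 : z ^ (n + 12) ≤ z ^ (n + 7) := pow_le_pow_of_le_one hz.le hz1 (by omega)
      calc _ ≤ 1 * (z⁻¹ * (z ^ (n + 7) * r ^ m / z ^ 2)) := by
            gcongr
            exact hQ1.trans (by gcongr)
        _ = _ := by field_simp; ring
    calc _ ≤ z ^ 2 * (C * (z ^ 6 * r) ^ 2 * (r⁻¹ ^ 2 * (Q1 / z ^ 2) +
            z⁻¹ * (c₀ * J + Q1 / z ^ 2))) := by
          gcongr
          refine hmono.trans (hmain.trans ?_)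
          gcongr
      _ = C * z ^ 14 * (r ^ 2 * (r⁻¹ ^ 2 * (Q1 / z ^ 2)) + r ^ 2 * (z⁻¹ * (c₀ * J)) +
            r ^ 2 * (z⁻¹ * (Q1 / z ^ 2))) := by ring
      _ ≤ C * z ^ 14 * (z ^ (n + 4) * r ^ m + c₀ * (C₁ + 1) * (z ^ (n + 4) * r ^ m) +
            z ^ (n + 4) * r ^ m) := by gcongr
      _ = C' * z ^ 6 * (z ^ (n + 12) * r ^ m) := by rw [hC']; ring
      _ ≤ C' * z₀ * (z ^ (n + 12) * r ^ m) := by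
          have : z ^ 6 ≤ z₀ := (pow_le_of_le_one hz.le hz1 (by norm_num)).trans hzz₀
          gcongr
      _ ≤ (1 / 2) ^ (n + 12) * τ ^ m * (z ^ (n + 12) * r ^ m) := by gcongr
      _ = _ := by rw [mul_pow, div_pow, div_pow]; ring
  · have hωr := volume_real_ball y (mul_pos hτ0 hr0)
    have hle : ∫ x in ball y (τ * r), Real.exp (w x) ≤
        Real.exp K * ((τ * r) ^ m * volume.real (ball (0 : Euc m) 1)) +
          ∫ x in ball y (r / 2), j x := by
      have hτr : τ * r ≤ r := by linarith
      have ic : IntegrableOn (fun _ : Euc m => Real.exp K) (ball y (τ * r)) :=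
        integrableOn_const measure_ball_lt_top.ne
      calc _ ≤ ∫ x in ball y (τ * r), (Real.exp K + j x) := by
            refine setIntegral_mono_on (hint hτr cV) (ic.add (hint hτr cj))
              measurableSet_ball fun x _ => ?_
            have h1 : Real.exp (k + z) ≤ Real.exp K := Real.exp_le_exp.2 (by rw [hk]; linarith)
            have h2 : Real.exp (w x) ≤ Real.exp (k + z) + j x := (hTB x).2.2.2.1
            linarith
        _ = Real.exp K * ((τ * r) ^ m * volume.real (ball (0 : Euc m) 1)) +
              ∫ x in ball y (τ * r), j x := by
            rw [integral_add ic (hint hτr cj), setIntegral_const, hωr, smul_eq_mul]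
            ring
        _ ≤ _ := add_le_add le_rfl (setIntegral_mono_set ij (Eventually.of_forall hj0)
            (ball_subset_ball (by linarith)).eventuallyLE)
    set J := ∫ x in ball y (r / 2), j x
    have h1 : (τ * r) ^ 2 * (Real.exp K * ((τ * r) ^ m * volume.real (ball (0 : Euc m) 1))) ≤
        1 / 2 * (τ * (z ^ n * (τ * r) ^ m)) := by
      have ht : τ ^ 2 ≤ τ := pow_le_of_le_one hτ0.le (by linarith) two_ne_zero
      have hrr : r ^ 2 ≤ r := pow_le_of_le_one hr0.le hr1 two_ne_zero
      calc _ = τ ^ 2 * r ^ 2 * (τ * r) ^ m *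
            (Real.exp K * volume.real (ball (0 : Euc m) 1)) := by ring
        _ ≤ τ * r * (τ * r) ^ m * (1 / 2 * z₀ ^ n) := by gcongr
        _ = _ := by rw [hzr]; ring
    have h2 : (τ * r) ^ 2 * J ≤ 1 / 2 * (τ * (z ^ n * (τ * r) ^ m)) := by
      have ht : τ ^ 2 ≤ τ := pow_le_of_le_one hτ0.le (by linarith) two_ne_zero
      have hz5 : z ^ 5 ≤ z₀ := (pow_le_of_le_one hz.le hz1 (by norm_num)).trans hzz₀
      calc _ = τ ^ 2 * (r ^ 2 * J) := by ring
        _ ≤ τ * ((C₁ + 1) * (z ^ (n + 5) * r ^ m)) := by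
            have hJ0 : 0 ≤ J := integral_nonneg hj0
            gcongr
        _ = τ * (z ^ n * r ^ m) * ((C₁ + 1) * z ^ 5) := by ring
        _ ≤ τ * (z ^ n * r ^ m) * (1 / 2 * τ ^ m) := by
            have : (C₁ + 1) * z ^ 5 ≤ 1 / 2 * τ ^ m :=
              (mul_le_mul_of_nonneg_left hz5 (by positivity)).trans hz₀b
            exact mul_le_mul_of_nonneg_left this (by positivity)
        _ = _ := by rw [mul_pow]; ring
    calc _ ≤ (τ * r) ^ 2 * (Real.exp K * ((τ * r) ^ m * volume.real (ball (0 : Euc m) 1)) + J) := by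
          gcongr
      _ ≤ τ * (z ^ n * (τ * r) ^ m) := by linarith
      _ = _ := by rw [hτ]; simp only [div_pow, one_pow]; ring

/-- A function whose excess over the levels `K - 4 * z j` decays on shrinking balls around `y`
is at most `K` at `y`. -/
theorem le_of_forall_setIntegral_excess_le {m : ℕ} {U : Set (Euc m)} {w : Euc m → ℝ}
    (hw : ContinuousOn w U) {y : Euc m} {K : ℝ} {z r : ℕ → ℝ} {N : ℕ} (hN : N ≠ 0)
    (hz : Tendsto z atTop (nhds 0)) (hz0 : ∀ j, 0 ≤ z j) (hr : Tendsto r atTop (nhds 0))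
    (hr0 : ∀ j, 0 < r j) (hU : U ∈ nhds y) (hrU : ∀ j, closedBall y (r j) ⊆ U)
    (h : ∀ j, ∫ x in ball y (r j), max (w x - (K - 4 * z j)) 0 ^ 2 ≤ z j ^ N * r j ^ m) :
    w y ≤ K := by
  by_contra! hcon
  obtain ⟨c, hc0, hc⟩ : ∃ c, 0 < c ∧ K + c < w y :=
    ⟨(w y - K) / 2, by linarith, by linarith⟩
  obtain ⟨ρ, hρ0, hρ⟩ := Metric.eventually_nhds_iff_ball.1
    ((hw.continuousAt hU).eventually_const_lt hc)
  have hω : 0 < volume.real (ball (0 : Euc m) 1) :=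
    ENNReal.toReal_pos (measure_ball_pos _ _ one_pos).ne' measure_ball_lt_top.ne
  have hlim : Tendsto (fun j => z j ^ N) atTop (nhds 0) := by
    simpa [hN] using hz.pow N
  obtain ⟨j, hj1, hj2⟩ := ((hr.eventually_lt_const hρ0).and
    (hlim.eventually_lt_const (by positivity :
      0 < c ^ 2 * volume.real (ball (0 : Euc m) 1)))).exists
  have hint : IntegrableOn (fun x => max (w x - (K - 4 * z j)) 0 ^ 2) (ball y (r j)) := by
    have hcont : Continuous fun t : ℝ => max (t - (K - 4 * z j)) 0 ^ 2 := by fun_prop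
    exact ((hcont.comp_continuousOn (hw.mono (hrU j))).integrableOn_compact
      (isCompact_closedBall y (r j))).mono_set ball_subset_closedBall
  have h1 : c ^ 2 * volume.real (ball (0 : Euc m) 1) * r j ^ m ≤ z j ^ N * r j ^ m := by
    calc _ = ∫ _ in ball y (r j), c ^ 2 := by
          rw [setIntegral_const, volume_real_ball y (hr0 j), smul_eq_mul]
          ring
      _ ≤ ∫ x in ball y (r j), max (w x - (K - 4 * z j)) 0 ^ 2 := by
          refine setIntegral_mono_on (integrableOn_const measure_ball_lt_top.ne) hint
            measurableSet_ball fun x hx => ?_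
          have := hρ x (ball_subset_ball hj1.le hx)
          have := hz0 j
          gcongr
          exact le_max_of_le_left (by linarith)
      _ ≤ _ := h j
  exact absurd (le_of_mul_le_mul_right h1 (pow_pos (hr0 j) m)) (not_le.2 hj2)

/-- The small regularity theorem for a subsolution `w` with flux `X`. -/
theorem exists_exp_le_half {m : ℕ} (hm : 1 ≤ m) {c₀ C₁ : ℝ} (hc₀ : 0 < c₀) (hC₁ : 0 < C₁) :
    ∃ σ ∈ Ioo (0 : ℝ) 1, ∀ {U : Set (Euc m)}, IsOpen U → ∀ {w : Euc m → ℝ} {X : Euc m → Euc m}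
    {δ : ℝ} {y : Euc m}, ContDiffOn ℝ 1 w U → ContDiffOn ℝ 1 X U →
    (∀ x ∈ U, 1 / 2 * ‖fderiv ℝ w x‖ ^ 2 ≤ fderiv ℝ w x (X x)) →
    (∀ x ∈ U, ‖X x‖ ≤ 3 / 2 * ‖fderiv ℝ w x‖) →
    (∀ x ∈ U, -divg X x ≤ c₀ * Real.exp (w x) + δ) →
    0 ≤ δ → δ ≤ 1 → closedBall y 1 ⊆ U →
    (∀ r, 0 < r → r ≤ 1 → ∫ x in ball y (r / 2), Real.exp (w x) ^ 2 ≤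
      C₁ * (r⁻¹ ^ 2 + δ) * ∫ x in ball y r, Real.exp (w x)) →
    ∫ x in ball y 1, Real.exp (w x) ≤ σ → Real.exp (w y) ≤ 1 / 2 := by
  obtain ⟨z₀, hz₀, hz₀4, hstep⟩ := decay_step hm hc₀ hC₁
  have hω : 0 < volume.real (ball (0 : Euc m) 1) :=
    ENNReal.toReal_pos (measure_ball_pos _ _ one_pos).ne' measure_ball_lt_top.ne
  set ω := volume.real (ball (0 : Euc m) 1)
  set κ : ℝ := min (1 / 2) (1 / 2 * z₀ ^ (6 * m) / ω) with hκ
  have hκ0 : 0 < κ := by positivity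
  have hκ2 : κ ≤ 1 / 2 := min_le_left _ _
  have hκω : κ * ω ≤ 1 / 2 * z₀ ^ (6 * m) := by
    rw [← le_div_iff₀ hω]
    exact min_le_right _ _
  clear_value κ
  have he : 1 ≤ Real.exp 1 := Real.one_le_exp zero_le_one
  set σ : ℝ := κ * z₀ ^ (6 * m + 12) / (2 * Real.exp 1) with hσ
  have hσ0 : 0 < σ := by positivity
  have hσle : σ ≤ κ * z₀ ^ (6 * m + 12) := div_le_self (by positivity) (by linarith)
  have hz₀1 : z₀ ≤ 1 := by linarith
  refine ⟨σ, ⟨hσ0, ?_⟩, ?_⟩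
  · have : κ * z₀ ^ (6 * m + 12) ≤ 1 / 2 * 1 := by
      gcongr
      exact pow_le_one₀ hz₀.le hz₀1
    linarith
  intro U hU w X δ y hw hX hell hbd hdiv hδ0 hδ1 hyU hV2 hσV
  obtain ⟨K, hK⟩ : ∃ K, Real.exp K = κ := ⟨Real.log κ, Real.exp_log hκ0⟩
  have hwc := hw.continuousOn
  have hint : ∀ {h : Euc m → ℝ}, ContinuousOn h U → IntegrableOn h (ball y 1) := fun hh =>
    ((hh.mono hyU).integrableOn_compact (isCompact_closedBall y 1)).mono_set
      ball_subset_closedBall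
  set z : ℕ → ℝ := fun j => z₀ * (1 / 2) ^ j with hzdef
  set r : ℕ → ℝ := fun j => ((1 / 2) ^ (6 * m)) ^ j with hrdef
  have hz0 : ∀ j, 0 < z j := fun j => by positivity
  have hr0 : ∀ j, 0 < r j := fun j => by positivity
  have hzle : ∀ j, z j ≤ z₀ := fun j =>
    mul_le_of_le_one_right hz₀.le (pow_le_one₀ (by norm_num) (by norm_num))
  have hrle : ∀ j, r j ≤ 1 := fun j =>
    pow_le_one₀ (by positivity) (pow_le_one₀ (by norm_num) (by norm_num))
  have hzs : ∀ j, z (j + 1) = z j / 2 := fun j => by simp only [hzdef, pow_succ]; ring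
  have hrs : ∀ j, r (j + 1) = (1 / 2) ^ (6 * m) * r j := fun j => by
    simp only [hrdef, pow_succ _ j]; ring
  have hzr : ∀ j, z j ^ (6 * m) = z₀ ^ (6 * m) * r j := fun j => by
    simp only [hzdef, hrdef, mul_pow, ← pow_mul, mul_comm]
  have hrU : ∀ j, closedBall y (r j) ⊆ U := fun j =>
    (closedBall_subset_closedBall (hrle j)).trans hyU
  have hdecay : ∀ j, (∫ x in ball y (r j), max (w x - (K - 4 * z j)) 0 ^ 2 ≤
        z j ^ (6 * m + 12) * r j ^ m) ∧
      r j ^ 2 * ∫ x in ball y (r j), Real.exp (w x) ≤ z j ^ (6 * m) * r j ^ m := by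
    intro j
    induction j with
    | zero =>
      have hz00 : z 0 = z₀ := by simp [hzdef]
      have hr00 : r 0 = 1 := by simp [hrdef]
      rw [hz00, hr00]
      simp only [one_pow, mul_one, one_mul]
      constructor
      · have hcont : Continuous fun t : ℝ => max (t - (K - 4 * z₀)) 0 ^ 2 := by fun_prop
        have hpt : ∀ x, max (w x - (K - 4 * z₀)) 0 ^ 2 ≤
            2 * Real.exp 1 / κ * Real.exp (w x) := by
          intro x
          have h1 : 2 * Real.exp (w x - (K - 4 * z₀)) ≤ 2 * Real.exp 1 / κ * Real.exp (w x) := by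
            have h2 : Real.exp (w x - (K - 4 * z₀)) ≤ Real.exp (1 + w x - K) :=
              Real.exp_le_exp.2 (by linarith)
            rw [Real.exp_sub (1 + w x), Real.exp_add, hK] at h2
            calc _ ≤ 2 * (Real.exp 1 * Real.exp (w x) / κ) := by linarith
              _ = _ := by ring
          refine le_trans ?_ h1
          rcases le_total (w x - (K - 4 * z₀)) 0 with h | h
          · rw [max_eq_right h, zero_pow two_ne_zero]
            positivity
          · rw [max_eq_left h]
            have := Real.quadratic_le_exp_of_nonneg h
            linarith
        calc _ ≤ ∫ x in ball y 1, 2 * Real.exp 1 / κ * Real.exp (w x) :=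
              setIntegral_mono_on (hint (hcont.comp_continuousOn hwc))
                ((hint hwc.rexp).const_mul _) measurableSet_ball fun x _ => hpt x
          _ ≤ 2 * Real.exp 1 / κ * σ := by
              rw [integral_const_mul]
              gcongr
          _ = _ := by rw [hσ]; field_simp
      · refine hσV.trans (hσle.trans ?_)
        calc _ ≤ 1 * z₀ ^ (6 * m) := by
              have : z₀ ^ (6 * m + 12) ≤ z₀ ^ (6 * m) :=
                pow_le_pow_of_le_one hz₀.le hz₀1 (by omega)
              gcongr
              linarith
          _ = _ := one_mul _
    | succ j ih =>
      rw [hzs, hrs]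
      exact hstep hU hw hX hell hbd hdiv hδ0 hδ1 (by rw [hK]; exact hκω) (hr0 j) (hrle j) (hrU j)
        (hz0 j) (hzle j) (hzr j) (hV2 _ (hr0 j) (hrle j)) ih.1 ih.2
  have hzlim : Tendsto z atTop (nhds 0) := by
    simpa [hzdef] using (tendsto_pow_atTop_nhds_zero_of_lt_one (r := (1 / 2 : ℝ)) (by norm_num)
      (by norm_num)).const_mul z₀
  have hrlim : Tendsto r atTop (nhds 0) :=
    tendsto_pow_atTop_nhds_zero_of_lt_one (by positivity)
      (pow_lt_one₀ (by norm_num) (by norm_num) (by omega))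
  have hwK : w y ≤ K := le_of_forall_setIntegral_excess_le hwc (by omega) hzlim
    (fun j => (hz0 j).le) hrlim hr0 (hU.mem_nhds (hyU (mem_closedBall_self zero_le_one))) hrU
    fun j => (hdecay j).1
  calc Real.exp (w y) ≤ Real.exp K := Real.exp_le_exp.2 hwK
    _ ≤ 1 / 2 := hK.trans_le hκ2

theorem contDiffOn_gradient {m : ℕ} {U : Set (Euc m)} (hU : IsOpen U) {v : Euc m → ℝ}
    (hv : ContDiffOn ℝ 2 v U) : ContDiffOn ℝ 1 (gradient v) U :=
  (InnerProductSpace.toDual ℝ (Euc m)).symm.contDiff.comp_contDiffOn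
    (hv.fderiv_of_isOpen hU (by norm_num))

theorem divg_neg {m : ℕ} (F : Euc m → Euc m) (x : Euc m) :
    divg (fun y => -F y) x = -divg F x := by
  simp [divg, fderiv_fun_neg]

theorem inner_apply_ge_of_norm_sub_id_le {m : ℕ} {T : Euc m →L[ℝ] Euc m} {δ : ℝ}
    (hT : ‖T - ContinuousLinearMap.id ℝ (Euc m)‖ ≤ δ) (g : Euc m) :
    (1 - δ) * ‖g‖ ^ 2 ≤ ⟪g, T g⟫ ∧ ‖T g‖ ≤ (1 + δ) * ‖g‖ := by
  have h : ‖(T - ContinuousLinearMap.id ℝ (Euc m)) g‖ ≤ δ * ‖g‖ :=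
    (T - ContinuousLinearMap.id ℝ (Euc m)).le_of_opNorm_le hT g
  have hTg : T g = g + (T - ContinuousLinearMap.id ℝ (Euc m)) g := by simp
  rw [hTg]
  constructor
  · rw [inner_add_right, real_inner_self_eq_norm_sq]
    have h1 := (abs_le.1 (abs_real_inner_le_norm g
      ((T - ContinuousLinearMap.id ℝ (Euc m)) g))).1
    nlinarith [norm_nonneg g]
  · linarith [norm_add_le g ((T - ContinuousLinearMap.id ℝ (Euc m)) g)]

/-- Lemma 10.7: small regularity theorem — an `L¹` smallness bound on `V = e^{−v}`
upgrades to an `L^∞` bound. -/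
theorem stmt17 (m : ℕ) (hm : 1 ≤ m) (c₀ C₁ : ℝ) (hc₀ : 0 < c₀) (hC₁ : 0 < C₁) :
    ∃ σstar ∈ Ioo (0:ℝ) 1, ∃ δstar > (0:ℝ),
      ∀ δ : ℝ, 0 < δ → δ ≤ δstar →
      ∀ A : Euc m → (Euc m →L[ℝ] Euc m), ∀ v : Euc m → ℝ,
        ContDiffOn ℝ 1 A (ball 0 2) → SymmField A →
        (∀ y ∈ ball (0:Euc m) 2, ‖A y - ContinuousLinearMap.id ℝ (Euc m)‖ ≤ δ) →
        ContDiffOn ℝ 2 v (ball 0 2) →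
        (∀ x ∈ ball (0:Euc m) 2,
          divg (fun y => A y (gradient v y)) x ≤ c₀ * Real.exp (-(v x)) + δ) →
        (∀ y : Euc m, ∀ r : ℝ, 0 < r → ball y r ⊆ ball 0 2 →
          (∫ x in ball y (r/2), Real.exp (-(v x)) ^ 2) ≤
            C₁ * (r ^ (-2:ℝ) + δ) * ∫ x in ball y r, Real.exp (-(v x))) →
        (∫ x in ball (0:Euc m) 2, Real.exp (-(v x))) ≤ σstar →
        ∀ x ∈ ball (0:Euc m) 1, Real.exp (-(v x)) ≤ 1/2 := by
  obtain ⟨σ, hσ, hmain⟩ := exists_exp_le_half hm hc₀ hC₁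
  refine ⟨σ, hσ, 1 / 2, by norm_num, ?_⟩
  intro δ hδ0 hδ A v hA _ hAid hv hdiv hV2 hσV y hy
  have hU : IsOpen (ball (0 : Euc m) 2) := isOpen_ball
  have hgrad := contDiffOn_gradient hU hv
  have hinner : ∀ x h, fderiv ℝ v x h = ⟪gradient v x, h⟫ := fun x h => by
    simp [gradient]
  have hnorm : ∀ x, ‖fderiv ℝ v x‖ = ‖gradient v x‖ := fun x => by simp [gradient]
  have hfneg : ∀ x, fderiv ℝ (fun x => -(v x)) x = -fderiv ℝ v x := fun x => fderiv_fun_neg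
  have hyU : closedBall y 1 ⊆ ball 0 2 := by
    intro x hx
    rw [mem_closedBall] at hx
    rw [mem_ball] at hy ⊢
    linarith [dist_triangle x y 0]
  have hVint : IntegrableOn (fun x => Real.exp (-(v x))) (ball (0 : Euc m) 2) := by
    by_contra hcon
    have h1 := hV2 0 2 two_pos subset_rfl
    rw [integral_undef hcon, mul_zero, div_self two_ne_zero] at h1
    have hc : ContinuousOn (fun x => Real.exp (-(v x)) ^ 2) (closedBall (0 : Euc m) 1) :=
      (hv.continuousOn.neg.rexp.pow 2).mono (closedBall_subset_ball one_lt_two)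
    have h2 : 0 < ∫ x in ball (0 : Euc m) 1, Real.exp (-(v x)) ^ 2 := by
      rw [setIntegral_pos_iff_support_of_nonneg_ae (Eventually.of_forall fun x => by positivity)
        ((hc.integrableOn_compact (isCompact_closedBall 0 1)).mono_set ball_subset_closedBall)]
      have : Function.support (fun x => Real.exp (-(v x)) ^ 2) = univ :=
        eq_univ_of_forall fun x => (pow_pos (Real.exp_pos _) 2).ne'
      rw [this, univ_inter]
      exact measure_ball_pos _ _ one_pos
    exact absurd h1 (not_le.2 h2)
  refine hmain hU (w := fun x => -(v x)) (X := fun x => -(A x (gradient v x))) (δ := δ)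
    (hv.of_le one_le_two).neg (hA.clm_apply hgrad).neg ?_ ?_ ?_ hδ0.le (by linarith) hyU ?_ ?_
  · intro x hx
    rw [hfneg, norm_neg, hnorm, neg_apply, map_neg, neg_neg, hinner]
    have := (inner_apply_ge_of_norm_sub_id_le (hAid x hx) (gradient v x)).1
    nlinarith [sq_nonneg ‖gradient v x‖]
  · intro x hx
    rw [hfneg, norm_neg, norm_neg, hnorm]
    have := (inner_apply_ge_of_norm_sub_id_le (hAid x hx) (gradient v x)).2
    nlinarith [norm_nonneg (gradient v x)]
  · intro x hx
    rw [divg_neg, neg_neg]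
    exact hdiv x hx
  · intro r hr0 hr1
    have h := hV2 y r hr0 ((ball_subset_ball hr1).trans (ball_subset_closedBall.trans hyU))
    have hpow : r ^ (-2 : ℝ) = r⁻¹ ^ 2 := by
      rw [Real.rpow_neg hr0.le, inv_pow, ← Real.rpow_natCast]
      norm_num
    rwa [hpow] at h
  · exact (setIntegral_mono_set hVint (Eventually.of_forall fun x => (Real.exp_pos _).le)
      (ball_subset_closedBall.trans hyU).eventuallyLE).trans hσV
end
end

section
/- There exist constants A₁ > 0, A₋₁ > 0 and C > 0 (depending only on W) such that for all t ≥ 0: |g(t) − 1 + A₁ e^{−t}| ≤ C e^{−2t}, |g′(t) − A₁ e^{−t}| ≤ C e^{−2t}, and |g″(t) + A₁ e^{−t}| ≤ C e^{−2t}; and for all t ≤ 0: |g(t) + 1 − A₋₁ e^{t}| ≤ C e^{2t}, |g′(t) − A₋₁ e^{t}| ≤ C e^{2t}, and |g″(t) − A₋₁ e^{t}| ≤ C e^{2t}. In particular the energy constant σ₀ := ∫_ℝ ( (1/2) g′(t)² + W(g(t)) ) dt is finite and positive. -/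
open Set Metric MeasureTheory Filter
open scoped RealInnerProductSpace

noncomputable section

/-- A function whose derivative is dominated by `L c e^{-ct}` oscillates by at most `L e^{-cs}`
beyond time `s`. -/
theorem abs_sub_le_of_abs_deriv_le_exp {f f' : ℝ → ℝ} {L c : ℝ} (hL : 0 ≤ L)
    (hf : ∀ t, HasDerivAt f (f' t) t)
    (hf' : ∀ t, 0 ≤ t → |f' t| ≤ L * (c * Real.exp (-(c * t))))
    {s t : ℝ} (hs : 0 ≤ s) (hst : s ≤ t) : |f t - f s| ≤ L * Real.exp (-(c * s)) := by
  have hexp : ∀ t, HasDerivAt (fun t => L * Real.exp (-(c * t)))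
      (-(L * (c * Real.exp (-(c * t))))) t := fun t => by
    have := (((hasDerivAt_id t).const_mul c).neg.exp).const_mul L
    convert! this using 1
    simp only [Pi.neg_apply, id_eq]; ring
  have hanti : AntitoneOn (fun t => f t + L * Real.exp (-(c * t))) (Ici 0) := by
    have hd := fun t => (hf t).add (hexp t)
    refine antitoneOn_of_deriv_nonpos (convex_Ici 0)
      (fun x _ => (hd x).continuousAt.continuousWithinAt)
      (fun x _ => (hd x).differentiableAt.differentiableWithinAt) fun x hx => ?_
    rw [interior_Ici] at hx
    have := (abs_le.1 (hf' x (le_of_lt hx))).2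
    refine ((hd x).deriv).trans_le ?_
    linarith
  have hmono : MonotoneOn (fun t => f t - L * Real.exp (-(c * t))) (Ici 0) := by
    have hd := fun t => (hf t).sub (hexp t)
    refine monotoneOn_of_deriv_nonneg (convex_Ici 0)
      (fun x _ => (hd x).continuousAt.continuousWithinAt)
      (fun x _ => (hd x).differentiableAt.differentiableWithinAt) fun x hx => ?_
    rw [interior_Ici] at hx
    have := (abs_le.1 (hf' x (le_of_lt hx))).1
    refine le_of_le_of_eq ?_ ((hd x).deriv).symm
    linarith
  have h1 := hanti hs (hs.trans hst) hst
  have h2 := hmono hs (hs.trans hst) hst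
  have h3 : 0 ≤ L * Real.exp (-(c * t)) := by positivity
  simp only at h1 h2
  rw [abs_le]
  constructor <;> linarith

/-- A positive solution of `h' = -h + O(h²)` tending to zero is asymptotic to a positive multiple
of `e^{-t}`, up to an error `O(e^{-2t})`. -/
theorem exists_exp_asymptotics {h p : ℝ → ℝ} {K : ℝ} (hK : 0 ≤ K) (hpos : ∀ t, 0 < h t)
    (hd : ∀ t, HasDerivAt h (-p t) t) (hp : ∀ t, |p t - h t| ≤ K * h t ^ 2)
    (hlim : Tendsto h atTop (nhds 0)) (hle : ∀ t, h t ≤ 2) :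
    ∃ A > (0 : ℝ), ∃ C > (0 : ℝ), ∀ t, 0 ≤ t →
      h t ≤ C * Real.exp (-t) ∧ |h t - A * Real.exp (-t)| ≤ C * Real.exp (-2 * t) := by
  obtain ⟨T, hT0, hT⟩ : ∃ T, 0 ≤ T ∧ ∀ t, T ≤ t → 2 * K * h t ≤ 1 := by
    have h1 : Tendsto (fun t => 2 * K * h t) atTop (nhds (2 * K * 0)) := hlim.const_mul _
    rw [mul_zero] at h1
    obtain ⟨T, hT⟩ := eventually_atTop.1 (h1.eventually_le_const one_pos)
    exact ⟨max T 0, le_max_right _ _, fun t ht => hT t ((le_max_left _ _).trans ht)⟩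
  obtain ⟨M, hM0, hM⟩ : ∃ M, 0 < M ∧ ∀ t, 0 ≤ t → h t ≤ M * Real.exp (-(1 / 2 * t)) := by
    have hder : ∀ t, HasDerivAt (fun t => h t * Real.exp (1 / 2 * t))
        ((h t / 2 - p t) * Real.exp (1 / 2 * t)) t := fun t => by
      have := (hd t).mul (((hasDerivAt_id t).const_mul (1 / 2 : ℝ)).exp)
      convert! this using 1
      simp; ring
    have hanti : AntitoneOn (fun t => h t * Real.exp (1 / 2 * t)) (Ici T) := by
      refine antitoneOn_of_deriv_nonpos (convex_Ici T)
        (fun x _ => (hder x).continuousAt.continuousWithinAt)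
        (fun x _ => (hder x).differentiableAt.differentiableWithinAt) fun x hx => ?_
      rw [interior_Ici] at hx
      rw [(hder x).deriv]
      have h1 := (abs_le.1 (hp x)).1
      have h2 := mul_le_mul_of_nonneg_right (hT x (le_of_lt hx)) (hpos x).le
      exact mul_nonpos_of_nonpos_of_nonneg (by nlinarith) (Real.exp_pos _).le
    refine ⟨2 * Real.exp (1 / 2 * T), by positivity, fun t ht => ?_⟩
    have key : h t * Real.exp (1 / 2 * t) ≤ 2 * Real.exp (1 / 2 * T) := by
      rcases le_total T t with htT | htT
      · refine (hanti (mem_Ici.2 le_rfl) htT htT).trans ?_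
        exact mul_le_mul_of_nonneg_right (hle T) (Real.exp_pos _).le
      · exact mul_le_mul (hle t) (Real.exp_le_exp.2 (by linarith)) (Real.exp_pos _).le zero_le_two
    rwa [Real.exp_neg, ← div_eq_mul_inv, le_div_iff₀ (Real.exp_pos _)]
  obtain ⟨B, hB⟩ : ∃ B, ∀ t, 0 ≤ t → |Real.log (h t) + t| ≤ B := by
    refine ⟨|Real.log (h 0) + 0| + 2 * K * M, fun t ht => ?_⟩
    have hder : ∀ t, HasDerivAt (fun t => Real.log (h t) + t) (-p t / h t + 1) t :=
      fun t => ((hd t).log (hpos t).ne').add (hasDerivAt_id t)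
    have := abs_sub_le_of_abs_deriv_le_exp (L := 2 * K * M) (c := 1 / 2) (by positivity) hder
      (fun t ht => ?_) le_rfl ht
    · have h2 := abs_sub_abs_le_abs_sub (Real.log (h t) + t) (Real.log (h 0) + 0)
      simp only [mul_zero, neg_zero, Real.exp_zero, mul_one] at this
      linarith
    · have h1 : -p t / h t + 1 = -(p t - h t) / h t := by
        field_simp [(hpos t).ne']; ring
      rw [h1, abs_div, abs_neg, abs_of_pos (hpos t), div_le_iff₀ (hpos t)]
      refine (hp t).trans ?_
      have := mul_le_mul_of_nonneg_left (hM t ht) (mul_nonneg hK (hpos t).le)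
      linarith
  have hφ : ∀ t, h t * Real.exp t = Real.exp (Real.log (h t) + t) := fun t => by
    rw [Real.exp_add, Real.exp_log (hpos t)]
  have hup : ∀ t, 0 ≤ t → h t * Real.exp t ≤ Real.exp B := fun t ht => by
    rw [hφ]; exact Real.exp_le_exp.2 (abs_le.1 (hB t ht)).2
  have hlow : ∀ t, 0 ≤ t → Real.exp (-B) ≤ h t * Real.exp t := fun t ht => by
    rw [hφ]; exact Real.exp_le_exp.2 (abs_le.1 (hB t ht)).1
  have hhle : ∀ t, 0 ≤ t → h t ≤ Real.exp B * Real.exp (-t) := fun t ht => by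
    rw [Real.exp_neg, ← div_eq_mul_inv, le_div_iff₀ (Real.exp_pos _)]
    exact hup t ht
  set L := K * Real.exp B ^ 2 with hLdef
  have hL : 0 ≤ L := by positivity
  have hosc : ∀ s t, 0 ≤ s → s ≤ t →
      |h t * Real.exp t - h s * Real.exp s| ≤ L * Real.exp (-(1 * s)) := fun s t hs hst => by
    have hder : ∀ t, HasDerivAt (fun t => h t * Real.exp t) ((h t - p t) * Real.exp t) t :=
      fun t => by
        have := (hd t).mul (Real.hasDerivAt_exp t)
        convert! this using 1
        ring
    refine abs_sub_le_of_abs_deriv_le_exp hL hder (fun t ht => ?_) hs hst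
    rw [abs_mul, abs_of_pos (Real.exp_pos t), abs_sub_comm, one_mul, one_mul]
    have h2 : h t ^ 2 ≤ (Real.exp B * Real.exp (-t)) ^ 2 :=
      pow_le_pow_left₀ (hpos t).le (hhle t ht) 2
    calc |p t - h t| * Real.exp t ≤ (K * (Real.exp B * Real.exp (-t)) ^ 2) * Real.exp t := by
          gcongr; exact (hp t).trans (by gcongr)
      _ = L * Real.exp (-t) * (Real.exp (-t) * Real.exp t) := by ring
      _ = L * Real.exp (-t) := by rw [← Real.exp_add]; simp
  have hnat : Tendsto (fun n : ℕ => L * Real.exp (-(1 * (n : ℝ)))) atTop (nhds 0) := by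
    have h1 : Tendsto (fun n : ℕ => Real.exp (-(n : ℝ))) atTop (nhds 0) :=
      Real.tendsto_exp_neg_atTop_nhds_zero.comp tendsto_natCast_atTop_atTop
    simpa using h1.const_mul L
  obtain ⟨A, hA⟩ : ∃ A, Tendsto (fun n : ℕ => h n * Real.exp n) atTop (nhds A) := by
    refine cauchySeq_tendsto_of_complete (cauchySeq_of_le_tendsto_0' _ (fun n m hnm => ?_) hnat)
    rw [dist_comm, Real.dist_eq]
    exact hosc n m (Nat.cast_nonneg n) (Nat.cast_le.2 hnm)
  have hA0 : 0 < A := (Real.exp_pos (-B)).trans_le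
    (ge_of_tendsto' hA fun n => hlow n (Nat.cast_nonneg n))
  have hAt : ∀ t, 0 ≤ t → |A - h t * Real.exp t| ≤ L * Real.exp (-t) := fun t ht => by
    refine le_of_tendsto (hA.sub_const _).abs ?_
    obtain ⟨N, hN⟩ := exists_nat_ge t
    filter_upwards [eventually_ge_atTop N] with n hn
    simpa using hosc t n ht (hN.trans (Nat.cast_le.2 hn))
  refine ⟨A, hA0, Real.exp B + L, by positivity, fun t ht => ⟨?_, ?_⟩⟩
  · exact (hhle t ht).trans (mul_le_mul_of_nonneg_right (by linarith) (Real.exp_pos _).le)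
  · have h1 : h t - A * Real.exp (-t) = -(A - h t * Real.exp t) * Real.exp (-t) := by
      have : Real.exp t * Real.exp (-t) = 1 := by rw [← Real.exp_add]; simp
      linear_combination (-h t) * this
    have h2 : Real.exp (-2 * t) = Real.exp (-t) * Real.exp (-t) := by
      rw [← Real.exp_add]; ring_nf
    rw [h1, abs_mul, abs_neg, abs_of_pos (Real.exp_pos _), h2, ← mul_assoc]
    gcongr
    refine (hAt t ht).trans (mul_le_mul_of_nonneg_right ?_ (Real.exp_pos _).le)
    linarith [Real.exp_pos B]

theorem IsDoubleWell.comp_neg {W : ℝ → ℝ} (hW : IsDoubleWell W) :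
    IsDoubleWell fun u => W (-u) := by
  obtain ⟨h1, h2, h3, h4, h5, h6, h7, h8, h9, h10⟩ := hW
  refine ⟨h1.comp contDiff_neg.contDiffOn fun u hu => ⟨by linarith [hu.2], by linarith [hu.1]⟩,
    fun t ht => h2 (-t) ⟨by linarith [ht.2], by linarith [ht.1]⟩, by simpa using h4, h3,
    ?_, ?_, ?_, ?_, ?_, fun t ht h => ?_⟩
  · simp [deriv_comp_neg, h6]
  · simp [deriv_comp_neg, h5]
  · simp [iteratedDeriv_comp_neg, h8]
  · simp [iteratedDeriv_comp_neg, h7]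
  · simp [deriv_comp_neg, h9]
  · rw [deriv_comp_neg, neg_eq_zero] at h
    exact neg_eq_zero.1 (h10 (-t) ⟨by linarith [ht.2], by linarith [ht.1]⟩ h)

/-- Taylor expansions of a double-well potential and of its derivative at the well `-1`. -/
theorem IsDoubleWell.exists_taylor_bound {W : ℝ → ℝ} (hW : IsDoubleWell W) :
    ∃ K, 0 ≤ K ∧ ∀ u ∈ Ioo (-1 : ℝ) 1,
      |W u - (u + 1) ^ 2 / 2| ≤ K * (u + 1) ^ 3 ∧ |deriv W u - (u + 1)| ≤ K * (u + 1) ^ 2 := by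
  obtain ⟨hC, -, hWm, -, hdm, -, hddm, -⟩ := hW
  set I : Set ℝ := Icc (-1) 1
  have hI : UniqueDiffOn ℝ I := uniqueDiffOn_Icc (by norm_num)
  have hmem : (-1 : ℝ) ∈ I := ⟨le_rfl, by norm_num⟩
  have hF : ContDiffOn ℝ (1 + 1) (derivWithin W I) I := hC.derivWithin hI (by norm_num)
  have hFeq : ∀ u ∈ Ioo (-1 : ℝ) 1, derivWithin W I u = deriv W u := fun u hu =>
    derivWithin_of_mem_nhds (Icc_mem_nhds hu.1 hu.2)
  have hD : HasDerivAt (deriv W) 1 (-1) := by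
    rw [iteratedDeriv_succ, iteratedDeriv_one] at hddm
    have := (differentiableAt_of_deriv_ne_zero (by rw [hddm]; exact one_ne_zero)).hasDerivAt
    rwa [hddm] at this
  have hF0 : derivWithin W I (-1) = 0 := by
    have h1 : Tendsto (derivWithin W I) (nhdsWithin (-1) (Ioo (-1) 1))
        (nhds (derivWithin W I (-1))) :=
      (hF.continuousOn (-1) hmem).mono_left (nhdsWithin_mono _ Ioo_subset_Icc_self)
    have h2 : Tendsto (derivWithin W I) (nhdsWithin (-1) (Ioo (-1) 1)) (nhds 0) := by
      have h3 : Tendsto (deriv W) (nhdsWithin (-1) (Ioo (-1) 1)) (nhds 0) := by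
        have := hD.continuousAt.tendsto
        rw [hdm] at this
        exact this.mono_left nhdsWithin_le_nhds
      refine h3.congr' ?_
      filter_upwards [self_mem_nhdsWithin] with u hu using (hFeq u hu).symm
    have : (nhdsWithin (-1 : ℝ) (Ioo (-1) 1)).NeBot := left_nhdsWithin_Ioo_neBot (by norm_num)
    exact tendsto_nhds_unique h1 h2
  have hF1 : derivWithin (derivWithin W I) I (-1) = 1 := by
    refine HasDerivWithinAt.derivWithin ?_ (hI _ hmem)
    refine (hD.hasDerivWithinAt (s := I)).congr_of_eventuallyEq ?_ (by rw [hF0, hdm])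
    filter_upwards [self_mem_nhdsWithin, mem_nhdsWithin_of_mem_nhds (Iio_mem_nhds
      (show (-1 : ℝ) < 1 by norm_num))] with u hu hu1
    rcases eq_or_lt_of_le hu.1 with h | h
    · rw [← h, hF0, hdm]
    · exact hFeq u ⟨h, hu1⟩
  obtain ⟨K₁, hK₁⟩ := exists_taylor_mean_remainder_bound (n := 1) (by norm_num : (-1 : ℝ) ≤ 1)
    (f := derivWithin W I) (by simpa only [Nat.cast_one] using hF)
  obtain ⟨K₂, hK₂⟩ := exists_taylor_mean_remainder_bound (n := 2) (by norm_num : (-1 : ℝ) ≤ 1)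
    (f := W) (by convert! hC using 1)
  refine ⟨max (max K₁ K₂) 0, le_max_right _ _, fun u hu => ⟨?_, ?_⟩⟩
  · have := hK₂ u (Ioo_subset_Icc_self hu)
    have h2 : iteratedDerivWithin 2 W I (-1) = 1 := by
      rw [iteratedDerivWithin_succ, iteratedDerivWithin_one, hF1]
    simp only [taylorWithinEval_succ, taylor_within_zero_eval, Real.norm_eq_abs, zero_add,
      iteratedDerivWithin_one, Nat.reduceAdd] at this
    rw [h2, hF0, hWm] at this
    refine le_trans (le_of_eq_of_le ?_ this) ?_
    · norm_num [Nat.factorial]; ring_nf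
    · rw [sub_neg_eq_add]
      have : 0 ≤ u + 1 := by linarith [hu.1]
      gcongr
      exact (le_max_right _ _).trans (le_max_left _ _)
  · have := hK₁ u (Ioo_subset_Icc_self hu)
    simp only [taylorWithinEval_succ, taylor_within_zero_eval, Real.norm_eq_abs, zero_add,
      iteratedDerivWithin_one] at this
    rw [hF1, hF0, hFeq u hu] at this
    refine le_trans (le_of_eq_of_le ?_ this) ?_
    · norm_num
    · rw [sub_neg_eq_add, one_add_one_eq_two]
      gcongr
      exact (le_max_left _ _).trans (le_max_left _ _)

/-- Equipartition of energy along a heteroclinic orbit descending to `-1` at `+∞`. -/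
theorem IsDoubleWell.half_sq_deriv_eq {W : ℝ → ℝ} (hW : IsDoubleWell W) {v : ℝ → ℝ}
    (hv : ContDiff ℝ 2 v) (hode : ∀ t, deriv (deriv v) t = deriv W (v t))
    (hvr : ∀ t, v t ∈ Ioo (-1 : ℝ) 1) (hv' : ∀ t, deriv v t < 0)
    (hlim : Tendsto v atTop (nhds (-1))) (t : ℝ) : 1 / 2 * deriv v t ^ 2 = W (v t) := by
  obtain ⟨hC, hWpos, hWm, -⟩ := hW
  have hd1 : ∀ t, HasDerivAt v (deriv v t) t := fun t =>
    (hv.differentiable (by norm_num) t).hasDerivAt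
  have hd2 : ∀ t, HasDerivAt (deriv v) (deriv W (v t)) t := fun t => by
    rw [← hode]
    exact ((hv.differentiable_deriv_two) t).hasDerivAt
  have hdW : ∀ t, HasDerivAt W (deriv W (v t)) (v t) := fun t =>
    ((hC.differentiableOn (by norm_num) (v t) (Ioo_subset_Icc_self (hvr t))).differentiableAt
      (Icc_mem_nhds (hvr t).1 (hvr t).2)).hasDerivAt
  have hE : ∀ t, HasDerivAt (fun t => 1 / 2 * deriv v t ^ 2 - W (v t)) 0 t := fun t => by
    have := (((hd2 t).pow 2).const_mul (1 / 2 : ℝ)).sub ((hdW t).comp t (hd1 t))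
    convert! this using 1
    simp; ring
  obtain ⟨E, hEt⟩ : ∃ E, ∀ t, 1 / 2 * deriv v t ^ 2 - W (v t) = E :=
    ⟨_, fun t => is_const_of_deriv_eq_zero (fun t => (hE t).differentiableAt)
      (fun t => (hE t).deriv) t 0⟩
  have hWlim : Tendsto (fun t => W (v t)) atTop (nhds 0) := by
    have h1 : ContinuousWithinAt W (Icc (-1) 1) (-1) :=
      hC.continuousOn (-1) ⟨le_rfl, by norm_num⟩
    rw [ContinuousWithinAt, hWm] at h1
    exact h1.comp (tendsto_nhdsWithin_iff.2
      ⟨hlim, Eventually.of_forall fun t => Ioo_subset_Icc_self (hvr t)⟩)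
  have hE0 : 0 ≤ E := by
    have h1 : Tendsto (fun t => -W (v t)) atTop (nhds (-0)) := hWlim.neg
    rw [neg_zero] at h1
    refine le_of_tendsto h1 (Eventually.of_forall fun t => ?_)
    rw [← hEt t]
    nlinarith [sq_nonneg (deriv v t)]
  have hE1 : E = 0 := by
    by_contra hne
    have hEpos : 0 < E := lt_of_le_of_ne hE0 (Ne.symm hne)
    set q := Real.sqrt (2 * E)
    have hq : 0 < q := Real.sqrt_pos.2 (by linarith)
    have hle : ∀ t, deriv v t ≤ -q := fun t => by
      have h1 : q ≤ |deriv v t| := by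
        rw [← Real.sqrt_sq_eq_abs]
        exact Real.sqrt_le_sqrt (by linarith [hEt t, hWpos _ (hvr t)])
      rw [abs_of_neg (hv' t)] at h1
      linarith
    have hanti : Antitone fun t => v t + q * t := by
      have hd : ∀ t, HasDerivAt (fun t => v t + q * t) (deriv v t + q) t := fun t => by
        have := (hd1 t).add ((hasDerivAt_id t).const_mul q)
        rwa [mul_one] at this
      exact antitone_of_deriv_nonpos (fun t => (hd t).differentiableAt) fun t => by
        rw [(hd t).deriv]; linarith [hle t]
    have h1 := hanti (show (0 : ℝ) ≤ 2 / q by positivity)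
    simp only [mul_zero, add_zero, mul_div_cancel₀ _ hq.ne'] at h1
    linarith [(hvr 0).2, (hvr (2 / q)).1]
  linarith [hEt t]

/-- Asymptotics at `+∞` of a heteroclinic orbit descending to the well `-1`. -/
theorem IsDoubleWell.exists_profile_asymptotics {W : ℝ → ℝ} (hW : IsDoubleWell W) {v : ℝ → ℝ}
    (hv : ContDiff ℝ 2 v) (hode : ∀ t, deriv (deriv v) t = deriv W (v t))
    (hvr : ∀ t, v t ∈ Ioo (-1 : ℝ) 1) (hv' : ∀ t, deriv v t < 0)
    (hlim : Tendsto v atTop (nhds (-1))) :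
    ∃ A > (0 : ℝ), ∃ C > (0 : ℝ), ∀ t, 0 ≤ t →
      |v t + 1 - A * Real.exp (-t)| ≤ C * Real.exp (-2 * t) ∧
      |deriv v t + A * Real.exp (-t)| ≤ C * Real.exp (-2 * t) ∧
      |deriv (deriv v) t - A * Real.exp (-t)| ≤ C * Real.exp (-2 * t) := by
  obtain ⟨K, hK, hKW⟩ := hW.exists_taylor_bound
  have hpos : ∀ t, 0 < v t + 1 := fun t => by linarith [(hvr t).1]
  have hp : ∀ t, |-deriv v t - (v t + 1)| ≤ 2 * K * (v t + 1) ^ 2 := fun t => by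
    have h1 := (hKW _ (hvr t)).1
    rw [← hW.half_sq_deriv_eq hv hode hvr hv' hlim t] at h1
    have h2 : |-deriv v t - (v t + 1)| * (v t + 1) ≤ 2 * K * (v t + 1) ^ 2 * (v t + 1) :=
      calc |-deriv v t - (v t + 1)| * (v t + 1)
          ≤ |-deriv v t - (v t + 1)| * |-deriv v t + (v t + 1)| := by
            gcongr
            exact le_trans (by linarith [hv' t]) (le_abs_self _)
        _ = |2 * (1 / 2 * deriv v t ^ 2 - (v t + 1) ^ 2 / 2)| := by
            rw [← abs_mul]; ring_nf
        _ ≤ 2 * K * (v t + 1) ^ 2 * (v t + 1) := by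
            rw [abs_mul, abs_two]; linarith
    exact le_of_mul_le_mul_right h2 (hpos t)
  obtain ⟨A, hA, C, hC, hAC⟩ := exists_exp_asymptotics (h := fun t => v t + 1)
    (p := fun t => -deriv v t) (K := 2 * K) (by positivity) hpos
    (fun t => by
      simpa using ((hv.differentiable (by norm_num) t).hasDerivAt).add_const 1)
    hp (by simpa using hlim.add_const 1) (fun t => by linarith [(hvr t).2])
  refine ⟨A, hA, C + 2 * K * C ^ 2, by positivity, fun t ht => ?_⟩
  obtain ⟨h1, h2⟩ := hAC t ht
  have h3 : 2 * K * (v t + 1) ^ 2 ≤ 2 * K * C ^ 2 * Real.exp (-2 * t) := by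
    have h4 : Real.exp (-2 * t) = Real.exp (-t) ^ 2 := by
      rw [← Real.exp_nat_mul]; push_cast; ring_nf
    rw [h4, mul_assoc _ (C ^ 2), ← mul_pow]
    have := (hpos t).le
    gcongr
  have h5 : |deriv W (v t) - (v t + 1)| ≤ 2 * K * (v t + 1) ^ 2 := by
    refine (hKW _ (hvr t)).2.trans ?_
    nlinarith [mul_nonneg hK (sq_nonneg (v t + 1))]
  have h6 := abs_le.1 (hp t)
  have h7 := abs_le.1 h5
  have h8 := abs_le.1 h2
  have h9 : 0 ≤ 2 * K * (v t + 1) ^ 2 := by positivity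
  rw [hode, add_mul]
  refine ⟨abs_le.2 ⟨?_, ?_⟩, abs_le.2 ⟨?_, ?_⟩, abs_le.2 ⟨?_, ?_⟩⟩ <;> linarith

/-- Asymptotic expansions of the one-dimensional profile `g` at `±∞`, and finiteness and
positivity of the energy constant `σ₀`. -/
theorem stmt18 (W : ℝ → ℝ) (hW : IsDoubleWell W)
    (g : ℝ → ℝ) (hg : ContDiff ℝ 2 g) (hode : ∀ t, deriv (deriv g) t = deriv W (g t))
    (hg0 : g 0 = 0) (hgr : ∀ t, g t ∈ Ioo (-1:ℝ) 1) (hg' : ∀ t, 0 < deriv g t)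
    (htop : Tendsto g atTop (nhds 1)) (hbot : Tendsto g atBot (nhds (-1))) :
    ∃ A₁ > (0:ℝ), ∃ Am₁ > (0:ℝ), ∃ C > (0:ℝ),
      (∀ t : ℝ, 0 ≤ t →
        |g t - 1 + A₁ * Real.exp (-t)| ≤ C * Real.exp (-2*t) ∧
        |deriv g t - A₁ * Real.exp (-t)| ≤ C * Real.exp (-2*t) ∧
        |deriv (deriv g) t + A₁ * Real.exp (-t)| ≤ C * Real.exp (-2*t)) ∧
      (∀ t : ℝ, t ≤ 0 →
        |g t + 1 - Am₁ * Real.exp t| ≤ C * Real.exp (2*t) ∧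
        |deriv g t - Am₁ * Real.exp t| ≤ C * Real.exp (2*t) ∧
        |deriv (deriv g) t - Am₁ * Real.exp t| ≤ C * Real.exp (2*t)) ∧
      Integrable (fun t : ℝ => (1/2) * (deriv g t) ^ 2 + W (g t)) ∧
      0 < ∫ t : ℝ, ((1/2) * (deriv g t) ^ 2 + W (g t)) := by
  have hdneg : deriv (fun t => -g t) = fun t => -deriv g t := deriv.fun_neg'
  have hdcomp : deriv (fun t => g (-t)) = fun t => -deriv g (-t) := funext fun t =>
    deriv_comp_neg g t
  have hd2neg : ∀ t, deriv (deriv fun t => -g t) t = -deriv (deriv g) t := fun t => by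
    rw [hdneg, deriv.fun_neg]
  have hd2comp : ∀ t, deriv (deriv fun t => g (-t)) t = deriv (deriv g) (-t) := fun t => by
    rw [hdcomp, deriv.fun_neg, deriv_comp_neg (deriv g), neg_neg]
  have hneg_mem : ∀ t, -g t ∈ Ioo (-1 : ℝ) 1 := fun t =>
    ⟨by linarith [(hgr t).2], by linarith [(hgr t).1]⟩
  have hbot' : Tendsto (fun t => g (-t)) atTop (nhds (-1)) := hbot.comp tendsto_neg_atTop_atBot
  have hode' : ∀ t, deriv (deriv fun t => g (-t)) t = deriv W (g (-t)) := fun t => by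
    rw [hd2comp, hode]
  have hneg' : ∀ t, deriv (fun t => g (-t)) t < 0 := fun t => by
    rw [hdcomp]; linarith [hg' (-t)]
  obtain ⟨A, hA, C, hC, hAC⟩ := hW.comp_neg.exists_profile_asymptotics (v := fun t => -g t)
    hg.neg (fun t => by rw [hd2neg, hode, deriv_comp_neg, neg_neg]) hneg_mem
    (fun t => by rw [hdneg]; linarith [hg' t]) htop.neg
  obtain ⟨B, hB, D, hD, hBD⟩ := hW.exists_profile_asymptotics (v := fun t => g (-t))
    (hg.comp contDiff_neg) hode' (fun t => hgr (-t)) hneg' hbot'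
  have henergy : (fun t : ℝ => 1 / 2 * deriv g t ^ 2 + W (g t)) = fun t => deriv g t ^ 2 := by
    funext t
    have := hW.half_sq_deriv_eq (v := fun t => g (-t))
      (hg.comp contDiff_neg) hode' (fun t => hgr (-t)) hneg' hbot' (-t)
    simp only [hdcomp, neg_neg, neg_sq] at this
    rw [← this]; ring
  have hbound_top : ∀ t, 0 ≤ t → |g t - 1 + A * Real.exp (-t)| ≤ C * Real.exp (-2 * t) ∧
      |deriv g t - A * Real.exp (-t)| ≤ C * Real.exp (-2 * t) ∧
      |deriv (deriv g) t + A * Real.exp (-t)| ≤ C * Real.exp (-2 * t) := fun t ht => by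
    obtain ⟨h1, h2, h3⟩ := hAC t ht
    rw [hd2neg] at h3
    simp only [hdneg] at h2
    refine ⟨?_, ?_, ?_⟩
    · rw [← abs_neg]; convert! h1 using 2; ring
    · rw [← abs_neg]; convert! h2 using 2; ring
    · rw [← abs_neg]; convert! h3 using 2; ring
  have hbound_bot : ∀ t, t ≤ 0 → |g t + 1 - B * Real.exp t| ≤ D * Real.exp (2 * t) ∧
      |deriv g t - B * Real.exp t| ≤ D * Real.exp (2 * t) ∧
      |deriv (deriv g) t - B * Real.exp t| ≤ D * Real.exp (2 * t) := fun t ht => by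
    obtain ⟨h1, h2, h3⟩ := hBD (-t) (by linarith)
    rw [hd2comp] at h3
    simp only [hdcomp, neg_neg, neg_mul_neg] at h1 h2 h3
    refine ⟨h1, ?_, h3⟩
    rw [← abs_neg]; convert! h2 using 2; ring
  have hgd : ∀ t, HasDerivAt g (deriv g t) t := fun t =>
    (hg.differentiable (by norm_num) t).hasDerivAt
  have hcont : Continuous (deriv g) := hg.continuous_deriv (by norm_num)
  have hint : Integrable fun t => deriv g t := by
    rw [← integrableOn_univ, ← Iic_union_Ioi (a := (0 : ℝ))]
    refine IntegrableOn.union ?_ ?_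
    · have := integrableOn_Ioi_deriv_of_nonpos' (a := 0) (g := fun t => g (-t))
        (fun x _ => ((hg.comp contDiff_neg).differentiable (by norm_num) x).hasDerivAt)
        (fun x _ => (hneg' x).le) hbot'
      have heq : deriv (g ∘ fun t => -t) = fun t => -deriv g (-t) := hdcomp
      rw [heq] at this
      rw [integrableOn_Iic_iff_integrableOn_Iio, ← (Measure.measurePreserving_neg volume
        ).integrableOn_comp_preimage (Homeomorph.neg ℝ).measurableEmbedding]
      simpa [Function.comp_def] using this.neg
    · exact integrableOn_Ioi_deriv_of_nonneg' (fun x _ => hgd x) (fun x _ => (hg' x).le) htop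
  have hbdd : ∀ t, ‖deriv g t‖ ≤ A + C + (B + D) := fun t => by
    rw [Real.norm_eq_abs, abs_of_pos (hg' t)]
    rcases le_total 0 t with ht | ht
    · have h1 := (abs_le.1 (hbound_top t ht).2.1).2
      have h2 : Real.exp (-t) ≤ 1 := Real.exp_le_one_iff.2 (by linarith)
      have h3 : Real.exp (-2 * t) ≤ 1 := Real.exp_le_one_iff.2 (by linarith)
      nlinarith
    · have h1 := (abs_le.1 (hbound_bot t ht).2.1).2
      have h2 : Real.exp t ≤ 1 := Real.exp_le_one_iff.2 (by linarith)
      have h3 : Real.exp (2 * t) ≤ 1 := Real.exp_le_one_iff.2 (by linarith)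
      nlinarith
  have hint2 : Integrable fun t => deriv g t ^ 2 := by
    simp only [pow_two]
    exact hint.bdd_mul hcont.aestronglyMeasurable (Eventually.of_forall hbdd)
  refine ⟨A, hA, B, hB, C + D, by positivity, fun t ht => ?_, fun t ht => ?_, ?_, ?_⟩
  · obtain ⟨h1, h2, h3⟩ := hbound_top t ht
    have h4 : C * Real.exp (-2 * t) ≤ (C + D) * Real.exp (-2 * t) := by gcongr; linarith
    exact ⟨h1.trans h4, h2.trans h4, h3.trans h4⟩
  · obtain ⟨h1, h2, h3⟩ := hbound_bot t ht
    have h4 : D * Real.exp (2 * t) ≤ (C + D) * Real.exp (2 * t) := by gcongr; linarith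
    exact ⟨h1.trans h4, h2.trans h4, h3.trans h4⟩
  · rw [henergy]; exact hint2
  · rw [henergy, integral_pos_iff_support_of_nonneg (fun t => sq_nonneg _) hint2]
    have : Function.support (fun t => deriv g t ^ 2) = univ :=
      eq_univ_of_forall fun t => pow_ne_zero 2 (hg' t).ne'
    rw [this]
    simp
end
end
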